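/- Let A, B and C be three abelian groups. Then there exists a group S that is strongly torsion generated, has centre isomorphic to A, satisfies H_1(S) = 0, H_2(S) ≅ B and H_3(S) ≅ C, and in addition has the property that for infinitely many positive integers n the homology group H_n(S) contains an infinite cyclic direct summand, i.e. H_n(S) is isomorphic to ℤ × M_n for some abelian group M_n. -/

import Mathlib

open CategoryTheory AlgebraicTopology

/-- The chain complex (over `ℤ`) associated to the nerve of the one-object groupoid on a
group `G`, i.e. the simplicial chain complex of the classifying space `BG`; its homology in
positive degrees is the integral group homology of `G`. -/
noncomputable def classifyingComplex (G : Type) [Group G] : ChainComplex (ModuleCat ℤ) ℕ :=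
  (alternatingFaceMapComplex (ModuleCat ℤ)).obj
    (((SimplicialObject.whiskering (Type) (ModuleCat ℤ)).obj (ModuleCat.free ℤ)).obj
      (nerve (SingleObj G)))

/-- The integral group homology `H_n(G; ℤ)` of a group `G`. -/
noncomputable def grpHomology (G : Type) [Group G] (n : ℕ) : ModuleCat ℤ :=
  (classifyingComplex G).homology n

/-- A group `G` is strongly torsion generated if for every `n ≥ 2` there is an element of
order exactly `n` whose normal closure is all of `G`. -/
def StronglyTorsionGenerated (G : Type*) [Group G] : Prop :=
  ∀ n : ℕ, 2 ≤ n → ∃ g : G, orderOf g = n ∧ Subgroup.normalClosure {g} = ⊤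

namespace HG
open groupHomology

noncomputable abbrev cpx {G M : Type} [Group G] [AddCommGroup M] (ρ : Representation ℤ G M) :
  ChainComplex (ModuleCat ℤ) ℕ := inhomogeneousChains (Rep.of ρ)

/-- Equivariance of a linear map along a group homomorphism. -/
def Eqv {G G' M M' : Type} [Group G] [Group G'] [AddCommGroup M] [AddCommGroup M']
    (f : G →* G') (ρ : Representation ℤ G M) (ρ' : Representation ℤ G' M') (φ : M →ₗ[ℤ] M') : Prop :=
  ∀ g m, φ (ρ g m) = ρ' (f g) (φ m)

section
variable {G G' G'' M M' M'' : Type} [Group G] [Group G'] [Group G''] [AddCommGroup M] [AddCommGroup M'] [AddCommGroup M'']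
  {f : G →* G'} {f' : G' →* G''} {ρ : Representation ℤ G M} {ρ' : Representation ℤ G' M'} {ρ'' : Representation ℤ G'' M''}
  {φ : M →ₗ[ℤ] M'} {φ' : M' →ₗ[ℤ] M''}

lemma Eqv.comp (h' : Eqv f' ρ' ρ'' φ') (h : Eqv f ρ ρ' φ) : Eqv (f'.comp f) ρ ρ'' (φ' ∘ₗ φ) := by
  intro g m; simp [h g m, h' (f g)]

lemma Eqv.id (ρ : Representation ℤ G M) : Eqv (MonoidHom.id G) ρ ρ LinearMap.id := fun _ _ => rfl

noncomputable def cmap (h : Eqv f ρ ρ' φ) : cpx ρ ⟶ cpx ρ' :=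
  chainsMap (A := Rep.of ρ) (B := Rep.of ρ') f (Rep.ofHom ⟨φ, fun g => LinearMap.ext (h g)⟩)

lemma cmap_f (h : Eqv f ρ ρ' φ) (n : ℕ) (g : Fin n → G) (m : M) :
   (cmap h).f n (Finsupp.single g m) = Finsupp.single (f ∘ g) (φ m) := by
  simp [cmap, chainsMap_f]

lemma hom_ext_chain {K : ModuleCat ℤ} {n : ℕ} (a b : (cpx ρ).X n ⟶ K)
    (h : ∀ g m, a (Finsupp.single g m) = b (Finsupp.single g m)) : a = b := by
  refine ModuleCat.hom_ext (Finsupp.lhom_ext (fun g m => h g m))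

lemma cmap_comp (h' : Eqv f' ρ' ρ'' φ') (h : Eqv f ρ ρ' φ) : cmap h ≫ cmap h' = cmap (h'.comp h) := by
  ext n : 1
  refine hom_ext_chain _ _ fun g m => ?_
  rw [HomologicalComplex.comp_f, ModuleCat.comp_apply, cmap_f, cmap_f, cmap_f]
  rfl

lemma cmap_id : cmap (Eqv.id ρ) = 𝟙 (cpx ρ) := by
  ext n : 1
  refine hom_ext_chain _ _ fun g m => ?_
  rw [cmap_f]; rfl

lemma cmap_zero (h : Eqv f ρ ρ' 0) : cmap h = 0 := by
  ext n : 1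
  refine hom_ext_chain _ _ fun g m => ?_
  rw [cmap_f]; simp

/-- group homology -/
abbrev H (ρ : Representation ℤ G M) (n : ℕ) : Type := (cpx ρ).homology n

noncomputable def hmap (h : Eqv f ρ ρ' φ) (n : ℕ) : H ρ n →+ H ρ' n :=
  (HomologicalComplex.homologyMap (cmap h) n).hom.toAddMonoidHom

lemma hmap_comp (h' : Eqv f' ρ' ρ'' φ') (h : Eqv f ρ ρ' φ) (n : ℕ) (x : H ρ n) :
    hmap h' n (hmap h n x) = hmap (h'.comp h) n x := by
  have := congrArg (fun a => a x)
    (congrArg ModuleCat.Hom.hom (congrArg (fun a => HomologicalComplex.homologyMap a n) (cmap_comp h' h)))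
  simp only [HomologicalComplex.homologyMap_comp] at this
  exact this

lemma hmap_congr {f₁ f₂ : G →* G'} {φ₁ φ₂ : M →ₗ[ℤ] M'} (h₁ : Eqv f₁ ρ ρ' φ₁) (h₂ : Eqv f₂ ρ ρ' φ₂)
    (hf : f₁ = f₂) (hφ : φ₁ = φ₂) (n : ℕ) (x : H ρ n) : hmap h₁ n x = hmap h₂ n x := by
  subst hf; subst hφ; rfl

lemma hmap_id (h : Eqv (MonoidHom.id G) ρ ρ LinearMap.id) (n : ℕ) (x : H ρ n) : hmap h n x = x := by
  have := congrArg (fun a => a x)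
    (congrArg ModuleCat.Hom.hom (congrArg (fun a => HomologicalComplex.homologyMap a n) (cmap_id (ρ := ρ))))
  simp only [HomologicalComplex.homologyMap_id] at this
  exact this

lemma hmap_id' {f : G →* G} {φ : M →ₗ[ℤ] M} (h : Eqv f ρ ρ φ) (hf : ∀ g, f g = g) (hφ : ∀ m, φ m = m)
    (n : ℕ) (x : H ρ n) : hmap h n x = x := by
  rw [hmap_congr h (Eqv.id ρ) (MonoidHom.ext hf) (LinearMap.ext hφ), hmap_id]

lemma hmap_comp_eq {f₁ : G →* G''} {φ₁ : M →ₗ[ℤ] M''} (h' : Eqv f' ρ' ρ'' φ') (h : Eqv f ρ ρ' φ)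
    (h₁ : Eqv f₁ ρ ρ'' φ₁) (hf : ∀ g, f' (f g) = f₁ g) (hφ : ∀ m, φ' (φ m) = φ₁ m)
    (n : ℕ) (x : H ρ n) :
    hmap h' n (hmap h n x) = hmap h₁ n x := by
  rw [hmap_comp]; exact hmap_congr _ _ (MonoidHom.ext hf) (LinearMap.ext hφ) _ _

lemma hmap_inj_of_retract {φ' : M' →ₗ[ℤ] M} {f' : G' →* G} (h' : Eqv f' ρ' ρ φ') (h : Eqv f ρ ρ' φ)
    (hf : ∀ g, f' (f g) = g) (hφ : ∀ m, φ' (φ m) = m) (n : ℕ) : Function.LeftInverse (hmap h' n) (hmap h n) := by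
  intro x
  rw [hmap_comp]; exact hmap_id' _ hf hφ _ _

lemma hmap_zero (h : Eqv f ρ ρ' 0) (n : ℕ) (x : H ρ n) : hmap h n x = 0 := by
  have := congrArg (fun a => a x)
    (congrArg ModuleCat.Hom.hom (congrArg (fun a => HomologicalComplex.homologyMap a n) (cmap_zero h)))
  simp only [HomologicalComplex.homologyMap_zero] at this
  exact this

lemma hmap_add {φ₁ φ₂ : M →ₗ[ℤ] M'} (h₁ : Eqv f ρ ρ' φ₁) (h₂ : Eqv f ρ ρ' φ₂) (h₃ : Eqv f ρ ρ' (φ₁ + φ₂))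
    (n : ℕ) (x : H ρ n) : hmap h₃ n x = hmap h₁ n x + hmap h₂ n x := by
  have e : cmap h₃ = cmap h₁ + cmap h₂ := by
    ext n : 1
    refine hom_ext_chain _ _ fun g m => ?_
    rw [HomologicalComplex.add_f_apply, cmap_f]
    refine Eq.trans ?_ (congrArg₂ (· + ·) (cmap_f h₁ n g m) (cmap_f h₂ n g m)).symm
    simp
  have := congrArg (fun a => a x)
    (congrArg ModuleCat.Hom.hom (congrArg (fun a => HomologicalComplex.homologyMap a n) e))
  simp only [HomologicalComplex.homologyMap_add] at this
  exact this
end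

section SES
variable {G G' M₁ M₂ M₃ N₁ N₂ N₃ : Type} [Group G] [Group G'] [AddCommGroup M₁] [AddCommGroup M₂] [AddCommGroup M₃]
  [AddCommGroup N₁] [AddCommGroup N₂] [AddCommGroup N₃]
  {ρ₁ : Representation ℤ G M₁} {ρ₂ : Representation ℤ G M₂} {ρ₃ : Representation ℤ G M₃}
  {σ₁ : Representation ℤ G' N₁} {σ₂ : Representation ℤ G' N₂} {σ₃ : Representation ℤ G' N₃}
  {α : M₁ →ₗ[ℤ] M₂} {β : M₂ →ₗ[ℤ] M₃} {α' : N₁ →ₗ[ℤ] N₂} {β' : N₂ →ₗ[ℤ] N₃}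

/-- short exact sequences of modules -/
structure SES (ρ₁ : Representation ℤ G M₁) (ρ₂ : Representation ℤ G M₂) (ρ₃ : Representation ℤ G M₃)
   (α : M₁ →ₗ[ℤ] M₂) (β : M₂ →ₗ[ℤ] M₃) : Prop where
  eα : Eqv (MonoidHom.id G) ρ₁ ρ₂ α
  eβ : Eqv (MonoidHom.id G) ρ₂ ρ₃ β
  inj : Function.Injective α
  surj : Function.Surjective β
  zero : ∀ x, β (α x) = 0
  ex : ∀ y, β y = 0 → ∃ x, α x = y

namespace SES

noncomputable def sc (s : SES ρ₁ ρ₂ ρ₃ α β) : ShortComplex (ChainComplex (ModuleCat ℤ) ℕ) :=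
  ShortComplex.mk (cmap s.eα) (cmap s.eβ) (by
    rw [cmap_comp]
    ext n : 1
    refine hom_ext_chain _ _ fun g m => ?_
    rw [cmap_f]; simp [s.zero])

lemma cmap_f_mapRange {ρ₁ : Representation ℤ G M₁} {ρ₂ : Representation ℤ G M₂}
   (h : Eqv (MonoidHom.id G) ρ₁ ρ₂ α) (n : ℕ) :
   ((cmap h).f n).hom = Finsupp.mapRange.linearMap α := by
  refine Finsupp.lhom_ext fun g m => ?_
  erw [cmap_f]; simp

lemma se (s : SES ρ₁ ρ₂ ρ₃ α β) : s.sc.ShortExact := by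
  refine HomologicalComplex.shortExact_of_degreewise_shortExact _ fun n => ?_
  apply ModuleCat.shortComplex_shortExact
  · have hx : LinearMap.range α = LinearMap.ker β := by
      ext y; constructor
      · rintro ⟨x, rfl⟩; exact s.zero x
      · exact s.ex y
    have hr := Finsupp.range_mapRange_linearMap (I := Fin n → G) α (LinearMap.ker_eq_bot.2 s.inj)
    have hk := Finsupp.ker_mapRange (I := Fin n → G) β
    intro y
    have e1 := cmap_f_mapRange s.eα n
    have e2 := cmap_f_mapRange s.eβ n
    change ((cmap s.eβ).f n).hom y = 0 ↔ y ∈ Set.range ((cmap s.eα).f n).hom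
    rw [e1, e2]
    have key : (Finsupp.mapRange.linearMap (α := Fin n → G) β).ker = (Finsupp.mapRange.linearMap (α := Fin n → G) α).range := by
      rw [hr, hk, hx]
    exact iff_of_eq (congrArg (fun S : Submodule ℤ ((Fin n → G) →₀ M₂) => @id ((Fin n → G) →₀ M₂) y ∈ S) key)
  · have e1 := cmap_f_mapRange s.eα n
    change Function.Injective ((cmap s.eα).f n).hom
    rw [e1]; exact Finsupp.mapRange_injective _ (map_zero _) s.inj
  · have e1 := cmap_f_mapRange s.eβ n
    change Function.Surjective ((cmap s.eβ).f n).hom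
    rw [e1]; exact Finsupp.mapRange_surjective _ (map_zero _) s.surj

noncomputable def δ (s : SES ρ₁ ρ₂ ρ₃ α β) (n : ℕ) : H ρ₃ (n+1) →+ H ρ₁ n :=
  (s.se.δ (n+1) n rfl).hom.toAddMonoidHom

lemma ex₁ (s : SES ρ₁ ρ₂ ρ₃ α β) (n : ℕ) (x : H ρ₁ n) (hx : hmap s.eα n x = 0) : ∃ y, s.δ n y = x :=
  (ShortComplex.moduleCat_exact_iff _).1 (s.se.homology_exact₁ (n+1) n rfl) x hx
lemma ex₂ (s : SES ρ₁ ρ₂ ρ₃ α β) (n : ℕ) (x : H ρ₂ n) (hx : hmap s.eβ n x = 0) : ∃ y, hmap s.eα n y = x :=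
  (ShortComplex.moduleCat_exact_iff _).1 (s.se.homology_exact₂ n) x hx
lemma ex₃ (s : SES ρ₁ ρ₂ ρ₃ α β) (n : ℕ) (x : H ρ₃ (n+1)) (hx : s.δ n x = 0) : ∃ y, hmap s.eβ (n+1) y = x :=
  (ShortComplex.moduleCat_exact_iff _).1 (s.se.homology_exact₃ (n+1) n rfl) x hx
lemma αδ (s : SES ρ₁ ρ₂ ρ₃ α β) (n : ℕ) (x : H ρ₃ (n+1)) : hmap s.eα n (s.δ n x) = 0 :=
  congrArg (fun a => a.hom x) (s.se.δ_comp (n+1) n rfl)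
lemma δβ (s : SES ρ₁ ρ₂ ρ₃ α β) (n : ℕ) (x : H ρ₂ (n+1)) : s.δ n (hmap s.eβ (n+1) x) = 0 :=
  congrArg (fun a => a.hom x) (s.se.comp_δ (n+1) n rfl)
lemma βα (s : SES ρ₁ ρ₂ ρ₃ α β) (n : ℕ) (x : H ρ₁ n) : hmap s.eβ n (hmap s.eα n x) = 0 := by
  rw [hmap_comp]
  have h0 : Eqv (MonoidHom.id G) ρ₁ ρ₃ 0 := fun g m => by simp
  rw [hmap_congr _ h0 rfl (LinearMap.ext s.zero)]
  exact hmap_zero h0 n x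

lemma δ_nat (s : SES ρ₁ ρ₂ ρ₃ α β) (t : SES σ₁ σ₂ σ₃ α' β') {f : G →* G'} {φ₁ : M₁ →ₗ[ℤ] N₁}
   {φ₂ : M₂ →ₗ[ℤ] N₂} {φ₃ : M₃ →ₗ[ℤ] N₃} (h₁ : Eqv f ρ₁ σ₁ φ₁) (h₂ : Eqv f ρ₂ σ₂ φ₂) (h₃ : Eqv f ρ₃ σ₃ φ₃)
   (c : ∀ m, φ₂ (α m) = α' (φ₁ m)) (c' : ∀ m, φ₃ (β m) = β' (φ₂ m)) (n : ℕ) (x : H ρ₃ (n+1)) :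
   t.δ n (hmap h₃ (n+1) x) = hmap h₁ n (s.δ n x) := by
  let F : s.sc ⟶ t.sc := 
    { τ₁ := cmap h₁, τ₂ := cmap h₂, τ₃ := cmap h₃
      comm₁₂ := by
        change cmap h₁ ≫ cmap t.eα = cmap s.eα ≫ cmap h₂
        rw [cmap_comp, cmap_comp]
        have : α' ∘ₗ φ₁ = φ₂ ∘ₗ α := LinearMap.ext fun m => (c m).symm
        congr 1
      comm₂₃ := by
        change cmap h₂ ≫ cmap t.eβ = cmap s.eβ ≫ cmap h₃
        rw [cmap_comp, cmap_comp]
        have : β' ∘ₗ φ₂ = φ₃ ∘ₗ β := LinearMap.ext fun m => (c' m).symm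
        congr 1 }
  have := HomologicalComplex.HomologySequence.δ_naturality F s.se t.se (n+1) n rfl
  exact (congrArg (fun a => a.hom x) this).symm
end SES
end SES
end HG

namespace HG
open groupHomology

section
variable {G G' M M' : Type} [Group G] [Group G'] [AddCommGroup M] [AddCommGroup M']
  {f : G →* G'} {ρ : Representation ℤ G M} {ρ' : Representation ℤ G' M'} {φ : M →ₗ[ℤ] M'}

lemma next_eq (n : ℕ) : (ComplexShape.down ℕ).next n = n - 1 := by
  cases n with
  | zero => simp
  | succ n => simp

/-- homology class of a cycle -/
noncomputable def cls (ρ : Representation ℤ G M) (n : ℕ) (z : (cpx ρ).X n) (hz : (cpx ρ).d n (n-1) z = 0) : H ρ n :=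
  (cpx ρ).homologyπ n ((cpx ρ).cyclesMk z (n-1) (next_eq n) hz)

lemma i_mk (n : ℕ) (z : (cpx ρ).X n) (hz : (cpx ρ).d n (n-1) z = 0) :
    (cpx ρ).iCycles n ((cpx ρ).cyclesMk z (n-1) (next_eq n) hz) = z :=
  (cpx ρ).i_cyclesMk z (n-1) (next_eq n) hz

lemma i_inj (n : ℕ) : Function.Injective ((cpx ρ).iCycles n) :=
  (ModuleCat.mono_iff_injective _).1 inferInstance

lemma exists_cls (n : ℕ) (x : H ρ n) : ∃ z hz, cls ρ n z hz = x := by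
  obtain ⟨y, rfl⟩ := (ModuleCat.epi_iff_surjective ((cpx ρ).homologyπ n)).1 inferInstance x
  refine ⟨(cpx ρ).iCycles n y, ?_, ?_⟩
  · have := (cpx ρ).iCycles_d n (n-1)
    exact congrArg (fun a => a y) (congrArg ModuleCat.Hom.hom this)
  · unfold cls
    congr 1
    apply i_inj
    rw [i_mk]

lemma cls_zero (n : ℕ) (z : (cpx ρ).X n) (hz : (cpx ρ).d n (n-1) z = 0) :
    cls ρ n z hz = 0 ↔ ∃ w, (cpx ρ).d (n+1) n w = z := by
  have hex := (ShortComplex.moduleCat_exact_iff _).1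
    ((ShortComplex.exact_of_g_is_cokernel (ShortComplex.mk _ _ ((cpx ρ).toCycles_comp_homologyπ (n+1) n)) ((cpx ρ).homologyIsCokernel (n+1) n (by simp))))
  have hc := (cpx ρ).toCycles_comp_homologyπ (n+1) n
  constructor
  · intro h
    obtain ⟨w, hw⟩ := hex _ h
    refine ⟨w, ?_⟩
    have := congrArg ((cpx ρ).iCycles n) hw
    rw [i_mk] at this
    rw [← this]
    exact congrArg (fun a => a w) (congrArg ModuleCat.Hom.hom ((cpx ρ).toCycles_i (n+1) n).symm)
  · rintro ⟨w, hw⟩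
    have : (cpx ρ).cyclesMk z (n-1) (next_eq n) hz = (cpx ρ).toCycles (n+1) n w := by
      apply i_inj
      rw [i_mk, ← hw]
      exact congrArg (fun a => a w) (congrArg ModuleCat.Hom.hom ((cpx ρ).toCycles_i (n+1) n).symm)
    unfold cls
    erw [this]
    exact congrArg (fun a => a w) (congrArg ModuleCat.Hom.hom hc)

lemma cmap_d (h : Eqv f ρ ρ' φ) (i j : ℕ) (z : (cpx ρ).X i) :
   (cpx ρ').d i j ((cmap h).f i z) = (cmap h).f j ((cpx ρ).d i j z) := by
  exact congrArg (fun a => a z) (congrArg ModuleCat.Hom.hom ((cmap h).comm i j))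

lemma hmap_cls (h : Eqv f ρ ρ' φ) (n : ℕ) (z : (cpx ρ).X n) (hz : (cpx ρ).d n (n-1) z = 0) :
    hmap h n (cls ρ n z hz) = cls ρ' n ((cmap h).f n z) (by rw [cmap_d, hz, map_zero]) := by
  have h1 := HomologicalComplex.homologyπ_naturality (cmap h) n
  have h2 := congrArg (fun a => a ((cpx ρ).cyclesMk z (n-1) (next_eq n) hz)) (congrArg ModuleCat.Hom.hom h1)
  refine h2.trans ?_
  unfold cls
  refine congrArg ((cpx ρ').homologyπ n) ?_
  apply i_inj
  rw [i_mk]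
  have h3 := congrArg (fun a => a ((cpx ρ).cyclesMk z (n-1) (next_eq n) hz)) (congrArg ModuleCat.Hom.hom (HomologicalComplex.cyclesMap_i (cmap h) n))
  refine h3.trans ?_
  exact congrArg ((cmap h).f n) (i_mk n z hz)

lemma d_single' (n : ℕ) (g : Fin (n+1) → G) (m : M) :
    (cpx ρ).d (n+1) n (Finsupp.single g m) = (Finsupp.single (fun i => g i.succ) (ρ (g 0)⁻¹ m) +
      Finset.univ.sum fun j : Fin (n + 1) =>
        (-1 : ℤ) ^ ((j : ℕ) + 1) • Finsupp.single (Fin.contractNth j (· * ·) g) m : (Fin n → G) →₀ M) := by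
  rw [inhomogeneousChains.d_def]
  exact inhomogeneousChains.d_single (A := Rep.of ρ) n g m

/-- the zeroth homology class of a module element -/
noncomputable def h0 (ρ : Representation ℤ G M) (m : M) : H ρ 0 :=
  cls ρ 0 (Finsupp.single default m) (by rw [HomologicalComplex.shape _ _ _ (by simp)]; rfl)

lemma h0_surj (x : H ρ 0) : ∃ m, h0 ρ m = x := by
  obtain ⟨z, hz, rfl⟩ := exists_cls 0 x
  refine ⟨z default, ?_⟩
  unfold h0
  congr 1
  refine Finsupp.ext fun a => ?_
  rw [Subsingleton.elim a default]; simp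

lemma hmap_h0 (h : Eqv f ρ ρ' φ) (m : M) : hmap h 0 (h0 ρ m) = h0 ρ' (φ m) := by
  unfold h0
  rw [hmap_cls]
  congr 1
  rw [cmap_f]
  congr 1
  exact Subsingleton.elim _ _

lemma h0_zero (m : M) : h0 ρ m = 0 ↔ m ∈ AddSubgroup.closure {x | ∃ g m', x = ρ g m' - m'} := by
  unfold h0
  rw [cls_zero]
  have key : ∀ (g : Fin 1 → G) (m : M), (cpx ρ).d 1 0 (Finsupp.single g m) = (Finsupp.single default (ρ (g 0)⁻¹ m - m) : (Fin 0 → G) →₀ M) := by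
    intro g m
    rw [d_single']
    simp [sub_eq_add_neg]
    congr 1
    · congr 1; exact Subsingleton.elim _ _
    · congr 2; exact Subsingleton.elim _ _
  constructor
  · rintro ⟨w, hw⟩
    have h2 : (show (Fin 0 → G) →₀ M from (cpx ρ).d 1 0 w) default = m := by
      rw [hw]; simp
    rw [← h2]
    clear h2 hw
    revert w
    intro w
    change (Fin 1 → G) →₀ M at w
    induction w using Finsupp.induction_linear with
    | zero =>
      have : (cpx ρ).d 1 0 (0 : (Fin 1 → G) →₀ M) = (0 : (Fin 0 → G) →₀ M) := map_zero ((cpx ρ).d 1 0).hom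
      rw [this]; exact zero_mem _
    | add a b ha hb =>
      have : (cpx ρ).d 1 0 (a+b : (Fin 1 → G) →₀ M) = ((cpx ρ).d 1 0 a + (cpx ρ).d 1 0 b : (Fin 0 → G) →₀ M) := 
        map_add ((cpx ρ).d 1 0).hom a b
      rw [this]; exact add_mem ha hb
    | single g m =>
      rw [key]
      refine AddSubgroup.subset_closure ⟨(g 0)⁻¹, m, ?_⟩
      simp
  · intro hm
    induction hm using AddSubgroup.closure_induction with
    | mem x hx =>
      obtain ⟨g, m', rfl⟩ := hx
      refine ⟨Finsupp.single (fun _ => g⁻¹) m', ?_⟩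
      rw [key]; simp
    | zero => exact ⟨0, by rw [map_zero]; simp⟩
    | add x y _ _ hx hy =>
      obtain ⟨a, ha⟩ := hx
      obtain ⟨b, hb⟩ := hy
      refine ⟨a + b, ?_⟩
      rw [map_add, ha, hb]; simp
    | neg x _ hx =>
      obtain ⟨a, ha⟩ := hx
      refine ⟨-a, ?_⟩
      rw [map_neg, ha]; simp

lemma h0_add (m m' : M) : h0 ρ (m + m') = h0 ρ m + h0 ρ m' := by
  have : ∀ m, h0 ρ m = (cpx ρ).homologyπ 0 ((cpx ρ).cyclesMk (Finsupp.single default m : (Fin 0 → G) →₀ M) 0 (next_eq 0) (by rw [HomologicalComplex.shape _ _ _ (by simp)]; rfl)) := fun m => rfl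
  rw [this, this, this, ← map_add]
  congr 1
  apply i_inj
  rw [map_add]
  erw [i_mk, i_mk, i_mk]
  simp
end
end HG

namespace HG
open groupHomology

section
variable {G M Z N : Type} [Group G] [AddCommGroup M] [AddCommGroup N]

/-- permutation module twisted by a module -/
noncomputable def permRep (a : G →* Equiv.Perm Z) (ν : Representation ℤ G N) : Representation ℤ G (Z →₀ N) where
  toFun g := Finsupp.lsum ℤ fun z => Finsupp.lsingle (a g z) ∘ₗ ν g
  map_one' := by
    refine Finsupp.lhom_ext fun z n => ?_
    simp
  map_mul' g h := by
    refine Finsupp.lhom_ext fun z n => ?_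
    simp

@[simp] lemma permRep_single (a : G →* Equiv.Perm Z) (ν : Representation ℤ G N) (g : G) (z : Z) (n : N) :
   permRep a ν g (Finsupp.single z n) = Finsupp.single (a g z) (ν g n) := by
  simp [permRep]

lemma contractNth_zero_cons {n : ℕ} (c : G) (g : Fin (n+1) → G) :
   Fin.contractNth 0 (· * ·) (Fin.cons c g : Fin (n+2) → G) = Fin.cons (c * g 0) (fun i => g i.succ) := by
  funext k
  refine Fin.cases ?_ (fun k => ?_) k
  · rw [Fin.contractNth_apply_of_eq _ _ _ _ rfl]; simp
  · rw [Fin.contractNth_apply_of_gt _ _ _ _ (by simp)]; simp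

lemma contractNth_succ_cons {n : ℕ} (c : G) (g : Fin (n+1) → G) (j : Fin (n+1)) :
   Fin.contractNth j.succ (· * ·) (Fin.cons c g : Fin (n+2) → G) = Fin.cons c (Fin.contractNth j (· * ·) g) := by
  funext k
  refine Fin.cases ?_ (fun k => ?_) k
  · rw [Fin.contractNth_apply_of_lt _ _ _ _ (by simp)]; simp
  · simp only [Fin.cons_succ]
    rcases lt_trichotomy (k : ℕ) j with h | h | h
    · rw [Fin.contractNth_apply_of_lt _ _ _ _ (by simpa using h), Fin.contractNth_apply_of_lt _ _ _ _ h]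
      rfl
    · rw [Fin.contractNth_apply_of_eq _ _ _ _ (by simpa using h), Fin.contractNth_apply_of_eq _ _ _ _ h]
      rfl
    · rw [Fin.contractNth_apply_of_gt _ _ _ _ (by simpa using h), Fin.contractNth_apply_of_gt _ _ _ _ h]
      rfl

noncomputable def hty (a : G →* Equiv.Perm Z) (c : Z → G) (ν : Representation ℤ G N) (n : ℕ) :
    ((Fin n → G) →₀ (Z →₀ N)) →ₗ[ℤ] ((Fin (n+1) → G) →₀ (Z →₀ N)) :=
  Finsupp.lsum ℤ fun g => Finsupp.lsum ℤ fun z =>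
    Finsupp.lsingle (Fin.cons (c z)⁻¹ g) ∘ₗ Finsupp.lsingle (a (c z)⁻¹ z) ∘ₗ ν (c z)⁻¹

lemma hty_single (a : G →* Equiv.Perm Z) (c : Z → G) (ν : Representation ℤ G N) (n : ℕ) (g : Fin n → G) (z : Z) (x : N) :
   hty a c ν n (Finsupp.single g (Finsupp.single z x)) =
     Finsupp.single (Fin.cons (c z)⁻¹ g) (Finsupp.single (a (c z)⁻¹ z) (ν (c z)⁻¹ x)) := by
  unfold hty
  rw [Finsupp.lsum_single, Finsupp.lsum_single]
  rfl

noncomputable def dl (ρ : Representation ℤ G M) (n : ℕ) : ((Fin (n+1) → G) →₀ M) →ₗ[ℤ] ((Fin n → G) →₀ M) :=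
   ((cpx ρ).d (n+1) n).hom

lemma dl_single (ρ : Representation ℤ G M) (n : ℕ) (g : Fin (n+1) → G) (m : M) :
   dl ρ n (Finsupp.single g m) = (Finsupp.single (fun i => g i.succ) (ρ (g 0)⁻¹ m) +
      Finset.univ.sum fun j : Fin (n + 1) =>
        (-1 : ℤ) ^ ((j : ℕ) + 1) • Finsupp.single (Fin.contractNth j (· * ·) g) m : (Fin n → G) →₀ M) :=
  d_single' n g m

lemma hty_homotopy (a : G →* Equiv.Perm Z) (c : Z → G) (hc : ∀ g z, c (a g z) = g * c z) (ν : Representation ℤ G N) (n : ℕ) :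
   dl (permRep a ν) (n+1) ∘ₗ hty a c ν (n+1) + hty a c ν n ∘ₗ dl (permRep a ν) n = LinearMap.id := by
  refine Finsupp.lhom_ext' fun g => Finsupp.lhom_ext fun z x => ?_
  simp only [LinearMap.comp_apply, LinearMap.add_apply, Finsupp.lsingle_apply, LinearMap.id_apply]
  rw [hty_single, dl_single, dl_single, Fin.sum_univ_succ, contractNth_zero_cons]
  simp only [contractNth_succ_cons, map_add, map_sum, map_smul, hty_single, permRep_single, hc,
    Fin.cons_zero, Fin.cons_succ, inv_inv]
  simp only [← Module.End.mul_apply, ← map_mul, ← Equiv.Perm.mul_apply, mul_inv_rev, inv_inv, mul_inv_cancel, map_one, Module.End.one_apply, Equiv.Perm.one_apply]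
  simp only [mul_assoc, mul_inv_cancel, mul_one]
  have : ∀ i : Fin (n+1), (-1 : ℤ) ^ ((i.succ : Fin (n+2)) + 1 : ℕ) = - (-1 : ℤ) ^ ((i : ℕ) + 1) := by
    intro i; simp [pow_succ]
  simp only [this, neg_smul, Finset.sum_neg_distrib]
  simp only [Fin.val_zero, zero_add, pow_one, neg_smul, one_smul]
  abel

lemma V (a : G →* Equiv.Perm Z) (c : Z → G) (hc : ∀ g z, c (a g z) = g * c z) (ν : Representation ℤ G N) (n : ℕ)
   (x : H (permRep a ν) (n+1)) : x = 0 := by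
  obtain ⟨z, hz, rfl⟩ := exists_cls _ x
  rw [cls_zero]
  refine ⟨hty a c ν (n+1) z, ?_⟩
  have := congrArg (fun L => L z) (hty_homotopy a c hc ν n)
  simp only [LinearMap.add_apply, LinearMap.comp_apply, LinearMap.id_apply] at this
  have h2 : dl (permRep a ν) n z = 0 := hz
  rw [h2, map_zero, add_zero] at this
  exact this
end
end HG

namespace HG
open groupHomology

/-- restriction along a homomorphism -/
abbrev res {K G N : Type} [Group K] [Group G] [AddCommGroup N] (f : K →* G) (ν : Representation ℤ G N) :
   Representation ℤ K N := MonoidHom.comp ν f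

/-- subrepresentation -/
def subRep {G N : Type} [Group G] [AddCommGroup N] (ν : Representation ℤ G N) (S : Submodule ℤ N)
    (hS : ∀ g, ∀ m ∈ S, ν g m ∈ S) : Representation ℤ G S where
  toFun g := (ν g).restrict (hS g)
  map_one' := by ext; simp [LinearMap.restrict_apply]
  map_mul' g h := by ext; simp [LinearMap.restrict_apply]

@[simp] lemma subRep_coe {G N : Type} [Group G] [AddCommGroup N] (ν : Representation ℤ G N) (S : Submodule ℤ N)
    (hS : ∀ g, ∀ m ∈ S, ν g m ∈ S) (g : G) (m : S) : (subRep ν S hS g m : N) = ν g m := rfl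

/-- kernel of an equivariant map -/
def kerRep {G M N : Type} [Group G] [AddCommGroup M] [AddCommGroup N] {ρ : Representation ℤ G M}
   {ν : Representation ℤ G N} {β : M →ₗ[ℤ] N} (e : Eqv (MonoidHom.id G) ρ ν β) : Representation ℤ G (LinearMap.ker β) :=
  subRep ρ (LinearMap.ker β) (fun g m hm => by
      rw [LinearMap.mem_ker] at hm ⊢; rw [e, hm, map_zero])

/-- The short exact sequence attached to a surjective equivariant map. -/
lemma sesKer {G M N : Type} [Group G] [AddCommGroup M] [AddCommGroup N] {ρ : Representation ℤ G M}
   {ν : Representation ℤ G N} {β : M →ₗ[ℤ] N} (e : Eqv (MonoidHom.id G) ρ ν β) (hs : Function.Surjective β) :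
   SES (kerRep e) ρ ν (LinearMap.ker β).subtype β where
  eα := fun _ _ => rfl
  eβ := e
  inj := Subtype.val_injective
  surj := hs
  zero := fun x => x.2
  ex := fun y hy => ⟨⟨y, hy⟩, rfl⟩

noncomputable def aug (Z N : Type) [AddCommGroup N] : (Z →₀ N) →ₗ[ℤ] N := Finsupp.lsum ℤ fun _ => LinearMap.id

@[simp] lemma aug_single {Z N : Type} [AddCommGroup N] (z : Z) (n : N) : aug Z N (Finsupp.single z n) = n := by
  simp [aug]

lemma aug_surj {Z N : Type} [AddCommGroup N] (z : Z) : Function.Surjective (aug Z N) :=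
  fun n => ⟨Finsupp.single z n, aug_single z n⟩

lemma Eqv.of_single {G G' Z N N' : Type} [Group G] [Group G'] [AddCommGroup N] [AddCommGroup N'] {f : G →* G'}
   {a : G →* Equiv.Perm Z} {ν : Representation ℤ G N} {ν' : Representation ℤ G' N'} {φ : (Z →₀ N) →ₗ[ℤ] N'}
   (h : ∀ g z n, φ (Finsupp.single (a g z) (ν g n)) = ν' (f g) (φ (Finsupp.single z n))) :
   Eqv f (permRep a ν) ν' φ := by
  intro g m
  have : φ ∘ₗ permRep a ν g = ν' (f g) ∘ₗ φ := Finsupp.lhom_ext fun z n => by simp [h]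
  exact congrArg (fun L => L m) this

lemma Eqv.aug {G Z N : Type} [Group G] [AddCommGroup N] (a : G →* Equiv.Perm Z) (ν : Representation ℤ G N) :
    Eqv (MonoidHom.id G) (permRep a ν) ν (aug Z N) := Eqv.of_single fun g z n => by simp

/-- map of permutation modules -/
noncomputable def permMap {Z Z' N N' : Type} [AddCommGroup N] [AddCommGroup N'] (t : Z → Z') (φ : N →ₗ[ℤ] N') :
   (Z →₀ N) →ₗ[ℤ] (Z' →₀ N') := Finsupp.lsum ℤ fun z => Finsupp.lsingle (t z) ∘ₗ φ

@[simp] lemma permMap_single {Z Z' N N' : Type} [AddCommGroup N] [AddCommGroup N'] (t : Z → Z') (φ : N →ₗ[ℤ] N') (z : Z) (n : N) :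
   permMap t φ (Finsupp.single z n) = Finsupp.single (t z) (φ n) := by
  simp [permMap]

lemma Eqv.permMap {G G' Z Z' N N' : Type} [Group G] [Group G'] [AddCommGroup N] [AddCommGroup N'] {f : G →* G'}
   {a : G →* Equiv.Perm Z} {a' : G' →* Equiv.Perm Z'} {ν : Representation ℤ G N} {ν' : Representation ℤ G' N'} {φ : N →ₗ[ℤ] N'}
   {t : Z → Z'} (e : Eqv f ν ν' φ) (ht : ∀ g z, t (a g z) = a' (f g) (t z)) :
   Eqv f (permRep a ν) (permRep a' ν') (permMap t φ) := by
  refine Eqv.of_single fun g z n => ?_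
  simp [ht, e g n]

lemma Eqv.lsingle {K G Z N : Type} [Group K] [Group G] [AddCommGroup N] {f : K →* G}
   {a : G →* Equiv.Perm Z} (ν : Representation ℤ G N) {z : Z} (hz : ∀ k, a (f k) z = z) :
   Eqv f (res f ν) (permRep a ν) (Finsupp.lsingle z) := by
  intro k n
  simp [hz]

lemma permMap_id_eq {Z N N' : Type} [AddCommGroup N] [AddCommGroup N'] (φ : N →ₗ[ℤ] N') :
   permMap (id : Z → Z) φ = Finsupp.mapRange.linearMap φ := Finsupp.lhom_ext fun z n => by simp

lemma SES.perm {G Z M₁ M₂ M₃ : Type} [Group G] [AddCommGroup M₁] [AddCommGroup M₂] [AddCommGroup M₃]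
  {ρ₁ : Representation ℤ G M₁} {ρ₂ : Representation ℤ G M₂} {ρ₃ : Representation ℤ G M₃}
  {α : M₁ →ₗ[ℤ] M₂} {β : M₂ →ₗ[ℤ] M₃} (a : G →* Equiv.Perm Z) (s : SES ρ₁ ρ₂ ρ₃ α β) :
  SES (permRep a ρ₁) (permRep a ρ₂) (permRep a ρ₃) (permMap id α) (permMap id β) where
  eα := s.eα.permMap (fun _ _ => rfl)
  eβ := s.eβ.permMap (fun _ _ => rfl)
  inj := by rw [permMap_id_eq]; exact Finsupp.mapRange_injective _ (map_zero _) s.inj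
  surj := by rw [permMap_id_eq]; exact Finsupp.mapRange_surjective _ (map_zero _) s.surj
  zero := by
    intro x; rw [permMap_id_eq, permMap_id_eq]; ext z; simp [s.zero]
  ex := by
    intro y hy
    rw [permMap_id_eq] at hy
    have hr := Finsupp.range_mapRange_linearMap (I := Z) α (LinearMap.ker_eq_bot.2 s.inj)
    have : y ∈ (Finsupp.mapRange.linearMap (α := Z) α).range := by
      rw [hr]
      intro z
      have := congrArg (fun f => f z) hy
      simp at this
      exact s.ex _ this
    rw [permMap_id_eq]
    exact this

lemma SES.res {K G M₁ M₂ M₃ : Type} [Group G] [Group K] [AddCommGroup M₁] [AddCommGroup M₂] [AddCommGroup M₃]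
  {ρ₁ : Representation ℤ G M₁} {ρ₂ : Representation ℤ G M₂} {ρ₃ : Representation ℤ G M₃}
  {α : M₁ →ₗ[ℤ] M₂} {β : M₂ →ₗ[ℤ] M₃} (f : K →* G) (s : SES ρ₁ ρ₂ ρ₃ α β) :
  SES (res f ρ₁) (HG.res f ρ₂) (HG.res f ρ₃) α β where
  eα := fun g m => s.eα (f g) m
  eβ := fun g m => s.eβ (f g) m
  inj := s.inj
  surj := s.surj
  zero := s.zero
  ex := s.ex

section shift
variable {G G' M₁ M₂ M₃ N₁ N₂ N₃ : Type} [Group G] [Group G'] [AddCommGroup M₁] [AddCommGroup M₂] [AddCommGroup M₃]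
  [AddCommGroup N₁] [AddCommGroup N₂] [AddCommGroup N₃]
  {ρ₁ : Representation ℤ G M₁} {ρ₂ : Representation ℤ G M₂} {ρ₃ : Representation ℤ G M₃}
  {σ₁ : Representation ℤ G' N₁} {σ₂ : Representation ℤ G' N₂} {σ₃ : Representation ℤ G' N₃}
  {α : M₁ →ₗ[ℤ] M₂} {β : M₂ →ₗ[ℤ] M₃} {α' : N₁ →ₗ[ℤ] N₂} {β' : N₂ →ₗ[ℤ] N₃}

lemma SES.δ_inj (s : SES ρ₁ ρ₂ ρ₃ α β) (n : ℕ) (hs : ∀ x : H ρ₂ (n+1), x = 0) :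
    Function.Injective (s.δ n) := by
  rw [injective_iff_map_eq_zero]
  intro x hx
  obtain ⟨y, rfl⟩ := s.ex₃ n x hx
  rw [hs y, map_zero]

lemma SES.δ_surj (s : SES ρ₁ ρ₂ ρ₃ α β) (n : ℕ) (hs : ∀ x : H ρ₂ n, x = 0) :
    Function.Surjective (s.δ n) := fun x => s.ex₁ n x (hs _)

lemma hmap_sq {A B C D MA MB MC MD : Type} [Group A] [Group B] [Group C] [Group D] [AddCommGroup MA] [AddCommGroup MB]
   [AddCommGroup MC] [AddCommGroup MD] {ra : Representation ℤ A MA} {rb : Representation ℤ B MB} {rc : Representation ℤ C MC}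
   {rd : Representation ℤ D MD} {f1 : A →* B} {f2 : B →* D} {f3 : A →* C} {f4 : C →* D} {p1 : MA →ₗ[ℤ] MB} {p2 : MB →ₗ[ℤ] MD}
   {p3 : MA →ₗ[ℤ] MC} {p4 : MC →ₗ[ℤ] MD} (h1 : Eqv f1 ra rb p1) (h2 : Eqv f2 rb rd p2) (h3 : Eqv f3 ra rc p3) (h4 : Eqv f4 rc rd p4)
   (hf : ∀ a, f2 (f1 a) = f4 (f3 a)) (hp : ∀ a, p2 (p1 a) = p4 (p3 a)) (n : ℕ) (x : H ra n) :
   hmap h2 n (hmap h1 n x) = hmap h4 n (hmap h3 n x) := by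
  rw [hmap_comp, hmap_comp]
  exact hmap_congr _ _ (MonoidHom.ext hf) (LinearMap.ext hp) _ _

lemma shift (s : SES ρ₁ ρ₂ ρ₃ α β) (t : SES σ₁ σ₂ σ₃ α' β') {f : G →* G'} {φ₁ : M₁ →ₗ[ℤ] N₁}
   {φ₂ : M₂ →ₗ[ℤ] N₂} {φ₃ : M₃ →ₗ[ℤ] N₃} (h₁ : Eqv f ρ₁ σ₁ φ₁) (h₂ : Eqv f ρ₂ σ₂ φ₂) (h₃ : Eqv f ρ₃ σ₃ φ₃)
   (c : ∀ m, φ₂ (α m) = α' (φ₁ m)) (c' : ∀ m, φ₃ (β m) = β' (φ₂ m)) (n : ℕ)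
   (i₁ : Function.Bijective (hmap h₁ n)) (i₂ : Function.Injective (hmap h₂ n))
   (v : ∀ x : H ρ₂ (n+1), x = 0) (v' : ∀ x : H σ₂ (n+1), x = 0) : Function.Bijective (hmap h₃ (n+1)) := by
  have nat := s.δ_nat t h₁ h₂ h₃ c c' n
  constructor
  · rw [injective_iff_map_eq_zero]
    intro x hx
    apply s.δ_inj n v
    apply i₁.1
    rw [← nat, hx]; simp
  · intro y
    obtain ⟨w, hw⟩ := i₁.2 (t.δ n y)
    have : hmap s.eα n w = 0 := by
      apply i₂
      rw [map_zero, hmap_sq s.eα h₂ h₁ t.eα (fun _ => rfl) c, hw, t.αδ]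
    obtain ⟨x, hx⟩ := s.ex₁ n w this
    refine ⟨x, t.δ_inj n v' ?_⟩
    rw [nat, hx, hw]
end shift

/-- left regular action -/
def lreg (G : Type) [Group G] : G →* Equiv.Perm G := MulAction.toPermHom G G

@[simp] lemma lreg_apply {G : Type} [Group G] (g x : G) : lreg G g x = g * x := rfl

section
variable {G N : Type} [Group G] [AddCommGroup N]

/-- The dimension shifting sequence -/
lemma sesG (ν : Representation ℤ G N) :
    SES (kerRep (Eqv.aug (lreg G) ν)) (permRep (lreg G) ν) ν (LinearMap.ker (aug G N)).subtype (aug G N) :=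
  sesKer (Eqv.aug (lreg G) ν) (aug_surj 1)

lemma Vreg (ν : Representation ℤ G N) (n : ℕ) (x : H (permRep (lreg G) ν) (n+1)) : x = 0 :=
  V (lreg G) id (fun _ _ => rfl) ν n x

lemma h0_act (ν : Representation ℤ G N) (g : G) (m : N) : h0 ν (ν g m) = h0 ν m := by
  have : h0 ν (ν g m - m) = 0 := (h0_zero _).2 (AddSubgroup.subset_closure ⟨g, m, rfl⟩)
  have h2 := h0_add (ρ := ν) (ν g m - m) m
  rw [this, sub_add_cancel, zero_add] at h2
  exact h2

lemma Eqv.conj (ν : Representation ℤ G N) (g : G) : Eqv (MulAut.conj g).toMonoidHom ν ν (ν g) := by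
  intro x m
  simp [← Module.End.mul_apply, ← map_mul]

lemma conj_id (n : ℕ) : ∀ {N : Type} [AddCommGroup N] (ν : Representation ℤ G N) (g : G) (x : H ν n),
   hmap (Eqv.conj ν g) n x = x := by
  induction n with
  | zero =>
    intro N _ ν g x
    obtain ⟨m, rfl⟩ := h0_surj x
    rw [hmap_h0, h0_act]
  | succ n ih =>
    intro N _ ν g x
    apply (sesG ν).δ_inj n (Vreg ν n)
    rw [(sesG ν).δ_nat (sesG ν) (Eqv.conj _ g) (Eqv.conj _ g) (Eqv.conj ν g) (fun m => rfl) (fun m => ?_) n, ih]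
    rw [(sesG ν).eβ]; rfl
end

section Shapiro
variable {K G X : Type} [Group K] [Group G] {f : K →* G} (hf : Function.Injective f) (a : G →* Equiv.Perm X) (x₀ : X)
  (tr : ∀ x, ∃ g, a g x₀ = x) (st : ∀ g, a g x₀ = x₀ ↔ ∃ k, f k = g)

include hf in
lemma exists_coset : ∃ c : G → K, ∀ k g, c (f k * g) = k * c g := by
  have h1 : ∀ q : Quotient (QuotientGroup.rightRel f.range), ∃ r : G, Quotient.mk _ r = q := Quotient.exists_rep
  choose r hr using h1
  have h2 : ∀ g : G, ∃ k, f k = g * (r (Quotient.mk _ g))⁻¹ := by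
    intro g
    have := Quotient.exact (hr (Quotient.mk _ g))
    have h3 := QuotientGroup.rightRel_apply.1 this
    exact h3
  choose c hc using h2
  refine ⟨c, fun k g => hf ?_⟩
  rw [map_mul, hc, hc, ← mul_assoc]
  congr 3
  apply Quotient.sound
  apply QuotientGroup.rightRel_apply.2
  refine ⟨k⁻¹, ?_⟩
  simp

include hf in
lemma V_res {N : Type} [AddCommGroup N] (ν : Representation ℤ G N) (n : ℕ) (x : H (res f (permRep (lreg G) ν)) (n+1)) : x = 0 := by
  obtain ⟨c, hc⟩ := exists_coset hf
  have e : res f (permRep (lreg G) ν) = permRep ((lreg G).comp f) (res f ν) := by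
    ext g; simp [permRep]
  have : ∀ r, r = permRep ((lreg G).comp f) (res f ν) → ∀ x : H r (n+1), x = 0 := by
    rintro r rfl x
    exact V _ c hc _ n x
  exact this _ e x

lemma V_perm {N : Type} [AddCommGroup N] (ν : Representation ℤ G N) (n : ℕ) (x : H (permRep a (permRep (lreg G) ν)) (n+1)) : x = 0 := by
  let b : G →* Equiv.Perm (X × G) :=
    { toFun := fun g => (a g).prodCongr (lreg G g)
      map_one' := by ext x <;> simp
      map_mul' := by intro g h; ext x <;> simp [mul_assoc] }
  let e := (Finsupp.curryLinearEquiv (α := X) (β := G) (M := N) ℤ)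
  have e1 : Eqv (MonoidHom.id G) (permRep b ν) (permRep a (permRep (lreg G) ν)) e.toLinearMap := by
    refine Eqv.of_single fun g z n => ?_
    obtain ⟨x, y⟩ := z
    change Finsupp.curry _ = (permRep a (permRep (lreg G) ν)) g (Finsupp.curry _)
    rw [Finsupp.curry_single]
    simp [b]
  have e2 : Eqv (MonoidHom.id G) (permRep a (permRep (lreg G) ν)) (permRep b ν) e.symm.toLinearMap := by
    intro g m
    apply e.injective
    have := e1 g (e.symm m)
    simp at this
    simp [this]
  have h := hmap_inj_of_retract e1 e2 (fun _ => rfl) (fun m => by simp) (n+1) x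
  rw [← h, V b (fun p => p.2) (fun _ _ => rfl) ν n (hmap e2 (n+1) x), map_zero]

include hf tr st in
theorem shapiro (n : ℕ) : ∀ {N : Type} [AddCommGroup N] (ν : Representation ℤ G N),
    Function.Bijective (hmap (Eqv.lsingle (f := f) (a := a) ν (z := x₀) (fun k => (st _).2 ⟨k, rfl⟩)) n) := by
  induction n with
  | zero =>
    intro N _ ν
    constructor
    · rw [injective_iff_map_eq_zero]
      intro x hx
      obtain ⟨m, rfl⟩ := h0_surj x
      rw [hmap_h0, h0_zero] at hx
      rw [h0_zero]
      set S := AddSubgroup.closure {x | ∃ g m', x = res f ν g m' - m'} with hS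
      choose s hs using tr
      let ψ : (X →₀ N) →+ (N ⧸ S) := Finsupp.liftAddHom fun x => (QuotientAddGroup.mk' S).comp (ν (s x)⁻¹).toAddMonoidHom
      have hψ : ∀ x n, ψ (Finsupp.single x n) = QuotientAddGroup.mk' S (ν (s x)⁻¹ n) := by
        intro x n; simp [ψ]
      have hstab : ∀ g n, a g x₀ = x₀ → QuotientAddGroup.mk' S (ν g n) = QuotientAddGroup.mk' S n := by
        intro g n hg
        obtain ⟨k, rfl⟩ := (st g).1 hg
        symm
        rw [QuotientAddGroup.mk'_apply, QuotientAddGroup.mk'_apply, QuotientAddGroup.eq]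
        refine AddSubgroup.subset_closure ⟨k, n, ?_⟩
        simp [sub_eq_add_neg, add_comm]
      have hg : ∀ g v, ψ (permRep a ν g v) = ψ v := by
        intro g v
        induction v using Finsupp.induction_linear with
        | zero => simp
        | add x y hx hy => rw [map_add, map_add, hx, hy, map_add]
        | single x n =>
          rw [permRep_single, hψ, hψ]
          have := hstab ((s (a g x))⁻¹ * g * s x) (ν (s x)⁻¹ n) (by
            rw [map_mul, map_mul, Equiv.Perm.mul_apply, Equiv.Perm.mul_apply, hs, map_inv, Equiv.Perm.inv_eq_iff_eq, hs])
          rw [← this, ← Module.End.mul_apply, ← Module.End.mul_apply, ← map_mul, ← map_mul]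
          simp
      have hle : ∀ v ∈ AddSubgroup.closure {x | ∃ g m', x = permRep a ν g m' - m'}, ψ v = 0 := by
        intro v hv
        induction hv using AddSubgroup.closure_induction with
        | mem x hx => obtain ⟨g, m', rfl⟩ := hx; rw [map_sub, hg, sub_self]
        | zero => simp
        | add x y _ _ hx hy => rw [map_add, hx, hy, add_zero]
        | neg x _ hx => rw [map_neg, hx, neg_zero]
      have h1 := hle _ hx
      rw [Finsupp.lsingle_apply, hψ, hstab _ _ (by rw [map_inv, Equiv.Perm.inv_eq_iff_eq, hs])] at h1
      exact (QuotientAddGroup.eq_zero_iff m).1 h1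
    · intro y
      obtain ⟨v, rfl⟩ := h0_surj y
      induction v using Finsupp.induction_linear with
      | zero => exact ⟨0, by rw [map_zero]; exact ((h0_zero _).2 (zero_mem _)).symm⟩
      | add x y hx hy =>
        obtain ⟨p, hp⟩ := hx
        obtain ⟨q, hq⟩ := hy
        exact ⟨p + q, by rw [map_add, hp, hq, h0_add]⟩
      | single x n =>
        obtain ⟨g, rfl⟩ := tr x
        refine ⟨h0 _ (ν g⁻¹ n), ?_⟩
        rw [hmap_h0, ← h0_act _ g]
        simp [← Module.End.mul_apply, ← map_mul]
  | succ n ih =>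
    intro N _ ν
    refine shift ((sesG ν).res f) ((sesG ν).perm a) (Eqv.lsingle _ (fun k => (st _).2 ⟨k, rfl⟩))
      (Eqv.lsingle _ (fun k => (st _).2 ⟨k, rfl⟩)) _ (fun m => ?_) (fun m => ?_) n (ih _) (ih _).1 (V_res hf ν n) (V_perm a ν n)
    · simp
    · simp
end Shapiro
end HG

namespace HG
open groupHomology

/-- trivial module -/
abbrev triv (G M : Type) [Group G] [AddCommGroup M] : Representation ℤ G M := (1 : G →* (M →ₗ[ℤ] M))

section
variable {G K L : Type} [Group G] [Group K] [Group L]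

lemma Eqv.triv (f : G →* K) {M N : Type} [AddCommGroup M] [AddCommGroup N] (φ : M →ₗ[ℤ] N) :
  Eqv f (triv G M) (triv K N) φ := fun _ _ => rfl

/-- induced map in homology with trivial coefficients -/
noncomputable def hT (f : G →* K) (M : Type) [AddCommGroup M] (n : ℕ) : H (triv G M) n →+ H (triv K M) n :=
  hmap (Eqv.triv f LinearMap.id) n

variable {M : Type} [AddCommGroup M]

lemma hT_comp (g : K →* L) (f : G →* K) (n : ℕ) (x : H (triv G M) n) : hT g M n (hT f M n x) = hT (g.comp f) M n x :=
  hmap_comp_eq _ _ _ (fun _ => rfl) (fun _ => rfl) _ _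

lemma hT_comp_eq {g : K →* L} {f : G →* K} {h : G →* L} (e : ∀ x, g (f x) = h x) (n : ℕ) (x : H (triv G M) n) :
    hT g M n (hT f M n x) = hT h M n x :=
  hmap_comp_eq _ _ _ e (fun _ => rfl) _ _

lemma hT_congr {f g : G →* K} (e : ∀ x, f x = g x) (n : ℕ) (x : H (triv G M) n) :
    hT f M n x = hT g M n x := by
  rw [MonoidHom.ext e]

lemma hT_id {f : G →* G} (e : ∀ x, f x = x) (n : ℕ) (x : H (triv G M) n) : hT f M n x = x :=
  hmap_id' _ e (fun _ => rfl) _ _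

lemma hT_retract {f : G →* K} {g : K →* G} (e : ∀ x, g (f x) = x) (n : ℕ) (x : H (triv G M) n) :
    hT g M n (hT f M n x) = x := by
  rw [hT_comp, hT_id e]

lemma hT_conj (g : G) (n : ℕ) (x : H (triv G M) n) : hT (MulAut.conj g).toMonoidHom M n x = x :=
  conj_id n (triv G M) g x

/-- homology vanishes in degree n for all trivial coefficients -/
def Van (G : Type) [Group G] (n : ℕ) : Prop := ∀ (M : Type) [AddCommGroup M] (x : H (triv G M) n), x = 0

/-- a homomorphism induces zero in degree n for all trivial coefficients -/
def QZ (f : G →* K) (n : ℕ) : Prop := ∀ (M : Type) [AddCommGroup M] (x : H (triv G M) n), hT f M n x = 0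

lemma Van.qz (h : Van G n) : QZ (MonoidHom.id G) n := fun M _ x => by rw [h M x, map_zero]
lemma Van.qz' {f : G →* K} (h : Van G n) : QZ f n := fun M _ x => by rw [h M x, map_zero]
lemma Van.qz_right {f : G →* K} (h : Van K n) : QZ f n := fun M _ _ => h M _

lemma van_of_subsingleton [Subsingleton G] (n : ℕ) : Van G (n+1) := by
  intro M _ x
  have e1 : Eqv (MonoidHom.id G) (triv G M) (permRep (lreg G) (triv G M)) (Finsupp.lsingle 1) := by
    intro g m
    simp [Subsingleton.elim g 1]
  have := hmap_inj_of_retract (Eqv.aug (lreg G) (triv G M)) e1 (fun _ => rfl) (fun m => by simp) (n+1) x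
  rw [← this, Vreg _ n (hmap e1 (n+1) x), map_zero]

lemma hT_one (f : G →* K) (hf : ∀ x, f x = 1) (n : ℕ) (x : H (triv G M) (n+1)) : hT f M (n+1) x = 0 := by
  have : hT (1 : Unit →* K) M (n+1) (hT (1 : G →* Unit) M (n+1) x) = hT f M (n+1) x :=
    hT_comp_eq (fun x => by simp [hf]) _ _
  rw [← this, van_of_subsingleton n M (hT (1 : G →* Unit) M (n+1) x), map_zero]
end

section prod
variable {K K' K'' : Type} [Group K] [Group K'] [Group K'']

lemma eFst (K : Type) [Group K] {G M : Type} [Group G] [AddCommGroup M] (ν : Representation ℤ G M) :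
   Eqv (MonoidHom.fst G K) (res (MonoidHom.fst G K) ν) ν LinearMap.id := fun _ _ => rfl

lemma eMap (f : K →* K') {G M : Type} [Group G] [AddCommGroup M] (ν : Representation ℤ G M) :
   Eqv (MonoidHom.prodMap (MonoidHom.id G) f) (res (MonoidHom.fst G K) ν) (res (MonoidHom.fst G K') ν) LinearMap.id :=
  fun _ _ => rfl

def PA (m : ℕ) (f : K →* K') : Prop :=
  ∀ (G M : Type) [Group G] [AddCommGroup M] (ν : Representation ℤ G M) (z : H (res (MonoidHom.fst G K) ν) m),
    hmap (eFst K ν) m z = 0 → hmap (eMap f ν) m z = 0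

lemma PA_zero (f : K →* K') : PA 0 f := by
  intro G M _ _ ν z hz
  obtain ⟨m, rfl⟩ := h0_surj z
  rw [hmap_h0, h0_zero] at hz ⊢
  refine AddSubgroup.closure_mono ?_ hz
  rintro x ⟨g, m', rfl⟩
  exact ⟨(g, 1), m', rfl⟩

lemma eSh {G M : Type} [Group G] [AddCommGroup M] (K : Type) [Group K] (ν : Representation ℤ G M) :
   Eqv (MonoidHom.inr G K) (triv K M) (res (MonoidHom.fst G K) (permRep (lreg G) ν)) (Finsupp.lsingle 1) := by
  intro k m
  simp

lemma sh_bij {G M : Type} [Group G] [AddCommGroup M] (K : Type) [Group K] (ν : Representation ℤ G M) (n : ℕ) :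
   Function.Bijective (hmap (eSh K ν) n) := by
  have h1 := shapiro (f := MonoidHom.inr G K) (fun a b h => by simpa using h) ((lreg G).comp (MonoidHom.fst G K)) 1
    (fun x => ⟨(x, 1), by simp⟩) (fun g => by
      constructor
      · intro h; refine ⟨g.2, ?_⟩; ext <;> simp at h ⊢; exact h.symm
      · rintro ⟨k, rfl⟩; simp) n (res (MonoidHom.fst G K) ν)
  have e1 : Eqv (MonoidHom.id K) (triv K M) (res (MonoidHom.inr G K) (res (MonoidHom.fst G K) ν)) LinearMap.id := by
    intro g m; simp
  have e2 : Eqv (MonoidHom.id K) (res (MonoidHom.inr G K) (res (MonoidHom.fst G K) ν)) (triv K M) LinearMap.id := by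
    intro g m; simp
  have b1 : Function.Bijective (hmap e1 n) := by
    refine ⟨(hmap_inj_of_retract e2 e1 (fun _ => rfl) (fun _ => rfl) n).injective,
      (hmap_inj_of_retract e1 e2 (fun _ => rfl) (fun _ => rfl) n).surjective⟩
  have e : ∀ x, hmap (eSh K ν) n x = hmap (Eqv.lsingle (f := MonoidHom.inr G K) (a := (lreg G).comp (MonoidHom.fst G K))
     (res (MonoidHom.fst G K) ν) (z := 1) (fun k => by simp)) n (hmap e1 n x) :=
    fun x => (hmap_comp_eq _ _ _ (fun _ => rfl) (fun _ => rfl) _ _).symm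
  constructor
  · intro x y hxy
    rw [e, e] at hxy
    exact b1.1 (h1.1 hxy)
  · intro y
    obtain ⟨w, hw⟩ := h1.2 y
    obtain ⟨x, rfl⟩ := b1.2 w
    exact ⟨x, (e x).trans hw⟩

/-- the common part of the product lemmas -/
lemma PA_aux {m : ℕ} {f : K →* K'} (h : PA m f) {G M : Type} [Group G] [AddCommGroup M] (ν : Representation ℤ G M)
   (z : H (res (MonoidHom.fst G K) ν) (m+1)) (hz : hmap (eFst K ν) (m+1) z = 0) :
   ∃ w' : H (triv K' M) (m+1), hmap (eMap f ν) (m+1) z =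
      hmap ((sesG ν).res (MonoidHom.fst G K')).eβ (m+1) (hmap (eSh K' ν) (m+1) w') := by
  have h1 : hmap (eMap f _) m (((sesG ν).res (MonoidHom.fst G K)).δ m z) = 0 := by
    apply h
    rw [← SES.δ_nat ((sesG ν).res (MonoidHom.fst G K)) (sesG ν) (eFst K _) (eFst K _) (eFst K ν) (fun _ => rfl) (fun _ => rfl),
      hz, map_zero]
  rw [← SES.δ_nat ((sesG ν).res (MonoidHom.fst G K)) ((sesG ν).res (MonoidHom.fst G K'))
     (eMap f _) (eMap f _) (eMap f ν) (fun _ => rfl) (fun _ => rfl)] at h1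
  obtain ⟨w, hw⟩ := SES.ex₃ _ _ _ h1
  obtain ⟨w', rfl⟩ := (sh_bij K' ν (m+1)).2 w
  exact ⟨w', hw.symm⟩

lemma PA_succ {m : ℕ} {f : K →* K'} {f' : K' →* K''} (h : PA m f) (hq : QZ f' (m+1)) : PA (m+1) (f'.comp f) := by
  intro G M _ _ ν z hz
  obtain ⟨w', hw⟩ := PA_aux h ν z hz
  have e : hmap (eMap (f'.comp f) ν) (m+1) z = hmap (eMap f' ν) (m+1) (hmap (eMap f ν) (m+1) z) :=
    (hmap_comp_eq _ _ _ (fun _ => rfl) (fun _ => rfl) _ _).symm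
  rw [e, hw, hmap_sq ((sesG ν).res (MonoidHom.fst G K')).eβ (eMap f' ν) (eMap f' (permRep (lreg G) ν))
    ((sesG ν).res (MonoidHom.fst G K'')).eβ (fun _ => rfl) (fun _ => rfl),
    hmap_sq (eSh K' ν) (eMap f' (permRep (lreg G) ν)) (Eqv.triv f' LinearMap.id) (eSh K'' ν) (fun _ => by simp) (fun _ => rfl)]
  have := hq M w'
  unfold hT at this
  rw [this, map_zero, map_zero]

lemma PR {m : ℕ} {f : K →* K'} (h : PA m f) {G M : Type} [Group G] [AddCommGroup M] (z : H (triv (G × K) M) (m+1))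
   (h1 : hT (MonoidHom.fst G K) M (m+1) z = 0) (h2 : hT (MonoidHom.snd G K) M (m+1) z = 0) :
   hT (MonoidHom.prodMap (MonoidHom.id G) f) M (m+1) z = 0 := by
  obtain ⟨w', hw⟩ := PA_aux h (triv G M) z h1
  have e : hmap ((sesG (triv G M)).res (MonoidHom.fst G K')).eβ (m+1) (hmap (eSh K' (triv G M)) (m+1) w') = hT (MonoidHom.inr G K') M (m+1) w' :=
    hmap_comp_eq _ _ _ (fun _ => rfl) (fun _ => by simp) _ _
  have hw2 : hT (MonoidHom.prodMap (MonoidHom.id G) f) M (m+1) z = hT (MonoidHom.inr G K') M (m+1) w' := hw.trans e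
  have h3 : hT (MonoidHom.snd G K') M (m+1) (hT (MonoidHom.prodMap (MonoidHom.id G) f) M (m+1) z) = 0 := by
    rw [hT_comp, ← hT_comp_eq (g := f) (f := MonoidHom.snd G K) (fun x => by rfl), h2, map_zero]
  rw [hw2, hT_retract (fun x => rfl)] at h3
  rw [hw2, h3, map_zero]

/-- acyclic for trivial coefficients -/
def Acyc (G : Type) [Group G] : Prop := ∀ n, Van G (n+1)

lemma PA_of_van (n : ℕ) (h : ∀ i, i < n → Van K (i+1)) : PA n (MonoidHom.id K) := by
  induction n with
  | zero => exact PA_zero _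
  | succ n ih =>
    have := PA_succ (f := MonoidHom.id K) (f' := MonoidHom.id K) (ih fun i hi => h i (by omega)) (h n (by omega)).qz
    rwa [MonoidHom.comp_id] at this

lemma Acyc.pa (h : Acyc K) (n : ℕ) : PA n (MonoidHom.id K) := PA_of_van n fun i _ => h i

/-- product with an acyclic group -/
lemma Acyc.fst_bij (h : Acyc K) (G M : Type) [Group G] [AddCommGroup M] (n : ℕ) :
   Function.Bijective (hT (MonoidHom.fst G K) M n) := by
  constructor
  · rw [injective_iff_map_eq_zero]
    intro z hz
    have h1 := h.pa n G M (triv G M) z hz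
    rw [hmap_id' (eMap (MonoidHom.id K) (triv G M)) (fun _ => rfl) (fun _ => rfl)] at h1
    exact h1
  · intro x
    exact ⟨hT (MonoidHom.inl G K) M n x, hT_retract (fun _ => rfl) _ _⟩

lemma prod_inj {n : ℕ} (h : PA n (MonoidHom.id K)) {G M : Type} [Group G] [AddCommGroup M] (z : H (triv (G × K) M) (n+1))
  (h1 : hT (MonoidHom.fst G K) M (n+1) z = 0) (h2 : hT (MonoidHom.snd G K) M (n+1) z = 0) : z = 0 := by
  rw [← PR h z h1 h2, hT_id]
  intro x; rfl
end prod
end HG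

namespace HG

section step
variable {G : Type} [Group G]

/-- one step of the tower -/
abbrev Stp (G : Type) : Type := Equiv.Perm ((G × G) × ℕ)

/-- permute only the levels satisfying a predicate -/
def tw (G : Type) (P : ℕ → Prop) [DecidablePred P] : Equiv.Perm (G × G) →* Stp G where
  toFun e :=
    { toFun := fun p => if P p.2 then (e p.1, p.2) else p
      invFun := fun p => if P p.2 then (e.symm p.1, p.2) else p
      left_inv := by rintro ⟨x, n⟩; by_cases h : P n <;> simp [h]
      right_inv := by rintro ⟨x, n⟩; by_cases h : P n <;> simp [h] }
  map_one' := by ext1 ⟨x, n⟩; simp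
  map_mul' a b := by ext1 ⟨x, n⟩; by_cases h : P n <;> simp [h]

lemma tw_apply (P : ℕ → Prop) [DecidablePred P] (e : Equiv.Perm (G × G)) (x : G × G) (n : ℕ) :
   tw G P e (x, n) = if P n then (e x, n) else (x, n) := rfl

def pr : G × G →* Equiv.Perm (G × G) where
  toFun g := (Equiv.mulLeft g.1).prodCongr (Equiv.mulLeft g.2)
  map_one' := by ext1 ⟨x, y⟩; simp
  map_mul' a b := by ext1 ⟨x, y⟩; simp [mul_assoc]

lemma pr_apply (g x : G × G) : pr g x = (g.1 * x.1, g.2 * x.2) := rfl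

def ush : Equiv.Perm (G × G) where
  toFun p := (p.2 * p.1, p.2)
  invFun p := (p.2⁻¹ * p.1, p.2)
  left_inv := by rintro ⟨x, y⟩; simp
  right_inv := by rintro ⟨x, y⟩; simp

lemma ush_conj (h : G) : ush * pr (1, h) * ush⁻¹ = pr (h, h) := by
  rw [mul_inv_eq_iff_eq_mul]
  ext1 ⟨x, y⟩
  simp [pr_apply, ush, mul_assoc]

lemma ush_comm (h : G) : ush * pr (1, h) * ush⁻¹ * (pr (1, h))⁻¹ = pr (h, 1) := by
  rw [ush_conj, mul_inv_eq_iff_eq_mul, ← map_mul]; simp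

/-- all levels -/
abbrev allTw (G : Type) : Equiv.Perm (G × G) →* Stp G := tw G (fun _ => True)

/-- the embedding of a group in the next step -/
def ebd (G : Type) [Group G] : G →* Stp G := ((allTw G).comp pr).comp (MonoidHom.inl G G)

lemma ebd_apply (g a b : G) (n : ℕ) : ebd G g ((a, b), n) = ((g * a, b), n) := by
  simp [ebd, tw_apply, pr_apply]

lemma ebd_inj : Function.Injective (ebd G) := by
  intro g h e
  have := congrArg (fun p => (p ((1, 1), 0)).1.1) e
  simpa [ebd_apply] using this

lemma card_aux [Infinite G] (S : Set ((G × G) × ℕ)) (e : G → S) (he : Function.Injective e) :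
   Cardinal.mk S = Cardinal.mk G := by
  have h1 : Cardinal.mk ((G × G) × ℕ) = Cardinal.mk G := by
    simp only [Cardinal.mk_prod, Cardinal.lift_id, Cardinal.mk_nat, Cardinal.lift_uzero]
    rw [Cardinal.mul_eq_self (Cardinal.aleph0_le_mk G), Cardinal.mul_aleph0_eq (Cardinal.aleph0_le_mk G)]
  apply le_antisymm
  · rw [← h1]; exact Cardinal.mk_set_le S
  · exact Cardinal.mk_le_of_injective he

lemma exists_perm {X : Type} (S T : Set X) (h1 : Nonempty (S ≃ T)) (h2 : Nonempty ((Sᶜ : Set X) ≃ (Tᶜ : Set X))) :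
   ∃ v : Equiv.Perm X, ∀ x, v x ∈ T ↔ x ∈ S := by
  classical
  obtain ⟨a⟩ := h1
  obtain ⟨b⟩ := h2
  refine ⟨((Equiv.Set.sumCompl S).symm.trans (a.sumCongr b)).trans (Equiv.Set.sumCompl T), fun x => ?_⟩
  by_cases hx : x ∈ S
  · simp [hx, Equiv.Set.sumCompl_symm_apply_of_mem]
  · simp only [hx, iff_false, Equiv.trans_apply, Equiv.Set.sumCompl_symm_apply_of_notMem hx]
    exact (b ⟨x, hx⟩).2

lemma disj_comm {X : Type} (S : Set X) (x w : Equiv.Perm X) (hx : ∀ p, p ∉ S → x p = p) (hw : ∀ p, p ∈ S → w p = p) :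
   x * w = w * x := by
  have hwS : ∀ p, p ∉ S → w p ∉ S := by
    intro p hp h
    have := hw _ h
    rw [w.injective this] at h
    exact hp h
  have hxS : ∀ p, p ∈ S → x p ∈ S := by
    intro p hp
    by_contra h
    have := hx _ h
    rw [x.injective this] at h
    exact h hp
  ext1 p
  by_cases hp : p ∈ S
  · simp [hw p hp, hw _ (hxS p hp)]
  · simp [hx p hp, hx _ (hwS p hp)]

lemma comm_mem {X : Type} (N : Subgroup (Equiv.Perm X)) [N.Normal] (S : Set X) (γ : Equiv.Perm X) (hγ : γ ∈ N)
   (hd : ∀ p ∈ S, γ p ∉ S) (x y : Equiv.Perm X) (hx : ∀ p, p ∉ S → x p = p) (hy : ∀ p, p ∉ S → y p = p) :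
   x * y * x⁻¹ * y⁻¹ ∈ N := by
  set w := γ * x⁻¹ * γ⁻¹ with hw
  have hx' : ∀ p, p ∉ S → x⁻¹ p = p := by
    intro p hp; rw [Equiv.Perm.inv_eq_iff_eq, hx p hp]
  have hwS : ∀ p, p ∈ S → w p = p := by
    intro p hp
    have : γ⁻¹ p ∉ S := by
      intro h; apply hd _ h; simpa using hp
    rw [hw, Equiv.Perm.mul_apply, Equiv.Perm.mul_apply, hx' _ this]; simp
  have c1 : y * w = w * y := disj_comm S y w hy hwS
  have hm : x * w ∈ N := by
    rw [hw, ← mul_assoc, ← mul_assoc]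
    exact N.mul_mem (Subgroup.Normal.conj_mem inferInstance _ hγ _) (N.inv_mem hγ)
  have hm2 : (x * w) * (y * (x * w)⁻¹ * y⁻¹) ∈ N :=
    N.mul_mem hm (Subgroup.Normal.conj_mem inferInstance _ (N.inv_mem hm) _)
  have e : (x * w) * (y * (x * w)⁻¹ * y⁻¹) = x * y * x⁻¹ * y⁻¹ := by
    rw [mul_inv_rev]
    calc _ = x * (w * y) * w⁻¹ * x⁻¹ * y⁻¹ := by group
      _ = x * (y * w) * w⁻¹ * x⁻¹ * y⁻¹ := by rw [c1]
      _ = _ := by group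
  rwa [e] at hm2

lemma half_mem [Infinite G] (P : ℕ → Prop) [DecidablePred P] (n₁ n₀ : ℕ) (h₁ : P n₁) (h₀ : ¬ P n₀) (g : G) (hg : g ≠ 1) (h : G) :
   tw G P (pr (h, 1)) ∈ Subgroup.normalClosure {ebd G g} := by
  let Y' : Set ((G × G) × ℕ) := {p | p.1.1 = 1}
  let Y : Set ((G × G) × ℕ) := {p | P p.2}
  have c1 := card_aux Y' (fun b => ⟨((1, b), 0), rfl⟩) (fun a b h => by simpa using h)
  have c2 := card_aux (Y'ᶜ) (fun b => ⟨((g, b), 0), hg⟩) (fun a b h => by simpa using h)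
  have c3 := card_aux Y (fun b => ⟨((1, b), n₁), h₁⟩) (fun a b h => by simpa using h)
  have c4 := card_aux (Yᶜ) (fun b => ⟨((1, b), n₀), h₀⟩) (fun a b h => by simpa using h)
  obtain ⟨v, hv⟩ := exists_perm Y' Y (Cardinal.eq.1 (c1.trans c3.symm)) (Cardinal.eq.1 (c2.trans c4.symm))
  rw [← ush_comm, map_mul, map_mul, map_mul, map_inv, map_inv]
  refine comm_mem (Subgroup.normalClosure {ebd G g}) Y (v * ebd G g * v⁻¹) (Subgroup.Normal.conj_mem inferInstance _ (Subgroup.subset_normalClosure (Set.mem_singleton _)) _) ?_ _ _ ?_ ?_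
  · intro p hp hp2
    obtain ⟨q, rfl⟩ := v.surjective p
    rw [hv] at hp
    have e0 : (v * ebd G g * v⁻¹) (v q) = v (ebd G g q) := by simp
    rw [e0] at hp2
    rw [hv] at hp2
    obtain ⟨⟨a, b⟩, n⟩ := q
    have h1 : a = 1 := hp
    subst h1
    rw [ebd_apply] at hp2
    exact hg (by simpa [Y'] using hp2)
  · rintro ⟨q, n⟩ hp; rw [tw_apply]; exact if_neg hp
  · rintro ⟨q, n⟩ hp; rw [tw_apply]; exact if_neg hp

lemma step_simple [Infinite G] (g : G) (hg : g ≠ 1) (h : G) : ebd G h ∈ Subgroup.normalClosure {ebd G g} := by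
  have : ebd G h = tw G (fun n => n = 0) (pr (h, 1)) * tw G (fun n => n ≠ 0) (pr (h, 1)) := by
    ext1 ⟨⟨a, b⟩, n⟩
    by_cases hn : n = 0 <;> simp [ebd_apply, tw_apply, pr_apply, hn]
  rw [this]
  exact Subgroup.mul_mem _ (half_mem (fun n => n = 0) 0 1 rfl (by simp) g hg h) (half_mem (fun n => n ≠ 0) 1 0 (by simp) (by simp) g hg h)

lemma step_qz {J : Type} [Group J] {m : ℕ} {s : J →* G} (h : PA m s) : QZ ((ebd G).comp s) (m+1) := by
  intro M _ x
  let z := hT ((MonoidHom.id J).prod (MonoidHom.id J)) M (m+1) x - hT (MonoidHom.inl J J) M (m+1) x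
     - hT (MonoidHom.inr J J) M (m+1) x
  have h0 : hT (MonoidHom.prodMap (MonoidHom.id J) s) M (m+1) z = 0 := by
    apply PR h
    · have a1 := hT_retract (f := (MonoidHom.id J).prod (MonoidHom.id J)) (g := MonoidHom.fst J J) (fun _ => rfl) (m+1) x
      have a2 := hT_retract (f := MonoidHom.inl J J) (g := MonoidHom.fst J J) (fun _ => rfl) (m+1) x
      have a3 := hT_one ((MonoidHom.fst J J).comp (MonoidHom.inr J J)) (fun _ => rfl) m x
      rw [← hT_comp] at a3
      simp only [z, map_sub, a1, a2, a3, sub_self]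
    · have a1 := hT_retract (f := (MonoidHom.id J).prod (MonoidHom.id J)) (g := MonoidHom.snd J J) (fun _ => rfl) (m+1) x
      have a2 := hT_retract (f := MonoidHom.inr J J) (g := MonoidHom.snd J J) (fun _ => rfl) (m+1) x
      have a3 := hT_one ((MonoidHom.snd J J).comp (MonoidHom.inl J J)) (fun _ => rfl) m x
      rw [← hT_comp] at a3
      simp only [z, map_sub, a1, a2, a3, sub_self, sub_zero]
  let μ : J × G →* Stp G := ((allTw G).comp pr).comp (MonoidHom.prodMap s (MonoidHom.id G))
  have h1 := congrArg (hT μ M (m+1)) h0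
  simp only [z, map_sub, map_zero, hT_comp] at h1
  have e1 : hT (μ.comp (((MonoidHom.id J).prodMap s).comp ((MonoidHom.id J).prod (MonoidHom.id J)))) M (m+1) x
     = hT (μ.comp (((MonoidHom.id J).prodMap s).comp (MonoidHom.inr J J))) M (m+1) x := by
    rw [← hT_conj (allTw G ush) (m+1) (hT (μ.comp (((MonoidHom.id J).prodMap s).comp (MonoidHom.inr J J))) M (m+1) x), hT_comp]
    apply hT_congr
    intro g
    have := congrArg (allTw G) (ush_conj (s g))
    simp only [map_mul, map_inv] at this
    simp [μ, this]
  rw [e1] at h1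
  have e2 : hT (μ.comp (((MonoidHom.id J).prodMap s).comp (MonoidHom.inl J J))) M (m+1) x = hT ((ebd G).comp s) M (m+1) x := by
    apply hT_congr
    intro g; simp [μ, ebd]
  rw [e2] at h1
  simpa using h1
end step
end HG

namespace HG

section lim
variable {T : ℕ → Type} [∀ n, Group (T n)]

/-- iterated transition maps -/
def sh (φ : ∀ n, T n →* T (n+1)) (n : ℕ) : ∀ k, T n →* T k
  | 0 => if h : n = 0 then h ▸ MonoidHom.id (T n) else 1
  | k+1 => if h : n = k+1 then h ▸ MonoidHom.id (T n) else (φ k).comp (sh φ n k)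

variable (φ : ∀ n, T n →* T (n+1))

lemma sh_self (n : ℕ) (x : T n) : sh φ n n x = x := by
  cases n with
  | zero => simp [sh]
  | succ n => simp [sh]

lemma sh_succ {n k : ℕ} (h : n ≤ k) (x : T n) : sh φ n (k+1) x = φ k (sh φ n k x) := by
  rw [sh, dif_neg (by omega)]; rfl

lemma sh_sh {i j k : ℕ} (hij : i ≤ j) (hjk : j ≤ k) (x : T i) : sh φ j k (sh φ i j x) = sh φ i k x := by
  induction k, hjk using Nat.le_induction with
  | base => rw [sh_self]
  | succ k hk ih => rw [sh_succ φ hk, ih, sh_succ φ (hij.trans hk)]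

lemma sh_inj (hφ : ∀ n, Function.Injective (φ n)) {i j : ℕ} (hij : i ≤ j) : Function.Injective (sh φ i j) := by
  induction j, hij using Nat.le_induction with
  | base => intro x y h; rwa [sh_self, sh_self] at h
  | succ k hk ih => intro x y h; rw [sh_succ φ hk, sh_succ φ hk] at h; exact ih (hφ _ h)

theorem exists_lim (hφ : ∀ n, Function.Injective (φ n)) : ∃ (L : Type) (_ : Group L) (ι : ∀ n, T n →* L),
    (∀ n, Function.Injective (ι n)) ∧ (∀ n k, n ≤ k → ∀ x, ι k (sh φ n k x) = ι n x) ∧ (∀ y, ∃ n x, ι n x = y) := by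
  let F : ∀ i j : ℕ, i ≤ j → (T i →* T j) := fun i j _ => sh φ i j
  haveI : DirectedSystem T (fun i j h => F i j h) :=
    ⟨fun i x => sh_self φ i x, fun k j i h1 h2 x => sh_sh φ h1 h2 x⟩
  refine ⟨DirectLimit T F, inferInstance, fun n => ⟨⟨fun x => ⟦⟨n, x⟩⟧, ?_⟩, ?_⟩, ?_, ?_, ?_⟩
  · exact (DirectLimit.one_def n).symm
  · intro x y; exact (DirectLimit.mul_def n x y).symm
  · intro n; exact DirectLimit.mk_injective F (fun i j hij => sh_inj φ hφ hij) n
  · intro n k h x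
    exact DirectLimit.mk_apply n k x h
  · intro y
    obtain ⟨i, x, rfl⟩ := DirectLimit.exists_eq_mk F y
    exact ⟨i, x, rfl⟩

lemma cmap_inj {G G' M : Type} [Group G] [Group G'] [AddCommGroup M] {f : G →* G'} {ρ : Representation ℤ G M}
   {ρ' : Representation ℤ G' M} (h : Eqv f ρ ρ' LinearMap.id) (hf : Function.Injective f) (n : ℕ) :
   Function.Injective ((cmap h).f n) := by
  have e : ∀ z : (Fin n → G) →₀ M, (cmap h).f n z = Finsupp.mapDomain (fun g => f ∘ g) z := by
    intro z
    induction z using Finsupp.induction_linear with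
    | zero => simp
    | add x y hx hy => rw [Finsupp.mapDomain_add, ← hx, ← hy]; exact map_add ((cmap h).f n).hom x y
    | single g m => rw [Finsupp.mapDomain_single]; exact cmap_f h n g m
  intro x y hxy
  refine Finsupp.mapDomain_injective (f := fun g : Fin n → G => f ∘ g) (fun a b hab => ?_) ((e x).symm.trans (hxy.trans (e y)))
  funext i; exact hf (congrFun hab i)

variable {φ}
theorem lim_surj {L : Type} [Group L] (ι : ∀ n, T n →* L) (h1 : ∀ n, Function.Injective (ι n))
    (h2 : ∀ n k, n ≤ k → ∀ x, ι k (sh φ n k x) = ι n x) (h3 : ∀ y, ∃ n x, ι n x = y)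
    {M : Type} [AddCommGroup M] (m : ℕ) (y : H (triv L M) m) : ∃ n x, hT (ι n) M m x = y := by
  have key : ∀ k, ∀ z : (Fin m → L) →₀ M, ∃ n, k ≤ n ∧ ∃ z' : (Fin m → T n) →₀ M, (cmap (Eqv.triv (ι n) LinearMap.id)).f m z' = z := by
    have up : ∀ n k, n ≤ k → ∀ z' : (Fin m → T n) →₀ M, (cmap (Eqv.triv (ι n) LinearMap.id)).f m z' =
        (cmap (Eqv.triv (ι k) LinearMap.id)).f m ((cmap (Eqv.triv (sh φ n k) (LinearMap.id (R := ℤ) (M := M)))).f m z') := by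
      intro n k hk z'
      have e : cmap (Eqv.triv (ι n) (LinearMap.id (R := ℤ) (M := M))) = cmap (Eqv.triv (sh φ n k) (LinearMap.id (R := ℤ) (M := M))) ≫ cmap (Eqv.triv (ι k) LinearMap.id) := by
        rw [cmap_comp]
        have : ι n = (ι k).comp (sh φ n k) := by ext x; exact (h2 n k hk x).symm
        subst_vars
        congr 1
      rw [e]; rfl
    have fin : ∀ r, ∀ g : Fin r → L, ∃ n, ∃ g' : Fin r → T n, ∀ i, ι n (g' i) = g i := by
      intro r
      induction r with
      | zero => intro g; exact ⟨0, Fin.elim0, fun i => i.elim0⟩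
      | succ r ih =>
        intro g
        obtain ⟨n, g', hg⟩ := ih (fun i => g i.succ)
        obtain ⟨n2, x, hx⟩ := h3 (g 0)
        refine ⟨max n n2, Fin.cons (sh φ n2 (max n n2) x) (fun i => sh φ n (max n n2) (g' i)), fun i => ?_⟩
        refine Fin.cases ?_ (fun i => ?_) i
        · simp [h2 _ _ (le_max_right n n2), hx]
        · simp [h2 _ _ (le_max_left n n2), hg]
    intro k z
    induction z using Finsupp.induction_linear with
    | zero => exact ⟨k, le_rfl, 0, map_zero ((cmap (Eqv.triv (ι k) LinearMap.id)).f m).hom⟩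
    | add x y hx hy =>
      obtain ⟨n, hn, x', rfl⟩ := hx
      obtain ⟨l, hl, y', rfl⟩ := hy
      refine ⟨max n l, hn.trans (le_max_left _ _),
        (cmap (Eqv.triv (sh φ n (max n l)) (LinearMap.id (R := ℤ) (M := M)))).f m x' +
        (cmap (Eqv.triv (sh φ l (max n l)) (LinearMap.id (R := ℤ) (M := M)))).f m y', ?_⟩
      rw [up n _ (le_max_left n l), up l _ (le_max_right n l)]
      exact map_add ((cmap (Eqv.triv (ι (max n l)) LinearMap.id)).f m).hom _ _
    | single g m' =>
      obtain ⟨n, g', hg⟩ := fin m g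
      refine ⟨max k n, le_max_left _ _, Finsupp.single (fun i => sh φ n (max k n) (g' i)) m', ?_⟩
      refine (cmap_f _ _ _ _).trans ?_
      congr 1
      funext i
      simp [h2 _ _ (le_max_right k n), hg]
  obtain ⟨z, hz, rfl⟩ := exists_cls m y
  obtain ⟨n, -, z', rfl⟩ := key 0 z
  refine ⟨n, cls _ m z' ?_, hmap_cls _ _ _ _⟩
  apply cmap_inj (Eqv.triv (ι n) LinearMap.id) (h1 n)
  rw [← cmap_d, hz, map_zero]

theorem lim_acyc {L : Type} [Group L] (ι : ∀ n, T n →* L) (h1 : ∀ n, Function.Injective (ι n))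
    (h2 : ∀ n k, n ≤ k → ∀ x, ι k (sh φ n k x) = ι n x) (h3 : ∀ y, ∃ n x, ι n x = y)
    (h4 : ∀ m n, ∃ k, n ≤ k ∧ QZ (sh φ n k) (m+1)) : Acyc L := by
  intro m M _ y
  obtain ⟨n, x, rfl⟩ := lim_surj ι h1 h2 h3 (m+1) y
  obtain ⟨k, hk, hq⟩ := h4 m n
  rw [← hT_comp_eq (g := ι k) (f := sh φ n k) (h2 n k hk), hq, map_zero]
end lim
end HG

namespace HG

/-- the tower of permutation groups -/
def towB (X : Type) (g : Group X) : ℕ → (Σ Y : Type, Group Y)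
  | 0 => ⟨X, g⟩
  | n+1 => ⟨Stp (towB X g n).1, inferInstance⟩

abbrev tow (X : Type) [g : Group X] (n : ℕ) : Type := (towB X g n).1

instance (X : Type) [g : Group X] (n : ℕ) : Group (tow X n) := (towB X g n).2

def towφ (X : Type) [Group X] (n : ℕ) : tow X n →* tow X (n+1) := ebd (tow X n)

lemma towφ_inj (X : Type) [Group X] (n : ℕ) : Function.Injective (towφ X n) := ebd_inj

lemma tow_inf (X : Type) [Group X] [hX : Infinite X] (n : ℕ) : Infinite (tow X n) := by
  induction n with
  | zero => exact hX
  | succ n ih => exact Infinite.of_injective (towφ X n) (towφ_inj X n)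

lemma tow_PA (X : Type) [Group X] (m : ℕ) : ∀ j, ∃ k, j ≤ k ∧ PA m (sh (towφ X) j k) := by
  induction m with
  | zero => intro j; exact ⟨j, le_rfl, PA_zero _⟩
  | succ m ih =>
    intro j
    obtain ⟨k, hk, h1⟩ := ih j
    obtain ⟨l, hl, h2⟩ := ih k
    have h3 : QZ (sh (towφ X) k (l+1)) (m+1) := by
      have := step_qz h2
      have e : sh (towφ X) k (l+1) = (ebd (tow X l)).comp (sh (towφ X) k l) := by
        ext1 x; exact sh_succ _ hl x
      rw [e]; exact this
    refine ⟨l+1, by omega, ?_⟩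
    have e : sh (towφ X) j (l+1) = (sh (towφ X) k (l+1)).comp (sh (towφ X) j k) := by
      ext1 x; exact (sh_sh _ hk (by omega) x).symm
    rw [e]
    exact PA_succ h1 h3

lemma tow_QZ (X : Type) [Group X] (m : ℕ) (j : ℕ) : ∃ k, j ≤ k ∧ QZ (sh (towφ X) j k) (m+1) := by
  obtain ⟨l, hl, h2⟩ := tow_PA X m j
  refine ⟨l+1, by omega, ?_⟩
  have := step_qz h2
  have e : sh (towφ X) j (l+1) = (ebd (tow X l)).comp (sh (towφ X) j l) := by
    ext1 x; exact sh_succ _ hl x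
  rw [e]; exact this

/-- the properties of the big acyclic simple group -/
structure IsD (W D : Type) [Group W] [Group D] (d : W →* D) : Prop where
  inj : Function.Injective d
  acyc : Acyc D
  simple : ∀ g : D, g ≠ 1 → Subgroup.normalClosure {g} = ⊤
  tors : ∀ n : ℕ, 2 ≤ n → ∃ g : D, orderOf g = n
  center : ∀ z : D, (∀ g, g * z = z * g) → z = 1
  big : ∀ f : D → W × ℕ, ¬ Function.Injective f

theorem exists_D (W : Type) [Group W] : ∃ (D : Type) (_ : Group D) (d : W →* D), IsD W D d := by
  let X := W × (W × ℕ → Multiplicative (ZMod 2)) × (∀ n : ℕ, Multiplicative (ZMod n))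
  obtain ⟨D, _, ι, h1, h2, h3⟩ := exists_lim (towφ X) (towφ_inj X)
  let r : (∀ n : ℕ, Multiplicative (ZMod n)) →* X := (MonoidHom.inr W _).comp (MonoidHom.inr _ _)
  let o : ∀ n : ℕ, Multiplicative (ZMod n) →* X := fun n => r.comp (MonoidHom.mulSingle (fun n => Multiplicative (ZMod n)) n)
  have ho : ∀ n, Function.Injective (o n) := by
    intro n a b hab
    have := congrArg (fun x : X => x.2.2 n) hab
    simpa [o, r] using this
  haveI : Infinite X := by
    haveI : Infinite (Multiplicative (ZMod 0)) := inferInstanceAs (Infinite ℤ)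
    exact Infinite.of_injective (o 0) (ho 0)
  have h2' : ∀ n x, ι (n+1) (towφ X n x) = ι n x := by
    intro n x
    rw [← h2 n (n+1) (by omega), sh_succ _ le_rfl, sh_self]
  have simple : ∀ g : D, g ≠ 1 → Subgroup.normalClosure {g} = ⊤ := by
    intro g hg
    rw [eq_top_iff]
    rintro h -
    obtain ⟨n, x, rfl⟩ := h3 g
    obtain ⟨k, y, rfl⟩ := h3 h
    have hx := h2 n (max n k) (le_max_left _ _) x
    have hy := h2 k (max n k) (le_max_right _ _) y
    generalize sh (towφ X) n (max n k) x = x' at hx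
    generalize sh (towφ X) k (max n k) y = y' at hy
    generalize max n k = l at *
    rw [← hx] at hg ⊢
    rw [← hy]
    haveI := tow_inf X l
    have := step_simple x' (fun h => hg (by rw [h, map_one])) y'
    rw [← h2' l x', ← h2' l y']
    have le : Subgroup.normalClosure {towφ X l x'} ≤ (Subgroup.normalClosure {ι (l+1) (towφ X l x')}).comap (ι (l+1)) := by
      apply Subgroup.normalClosure_le_normal
      simpa using Subgroup.subset_normalClosure (Set.mem_singleton _)
    exact le this
  let ι0 : X →* D := ι 0
  let ι1 : Stp X →* D := ι 1
  have h0 : Function.Injective ι0 := h1 0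
  have h11 : Function.Injective ι1 := h1 1
  refine ⟨D, inferInstance, (ι0).comp (MonoidHom.inl W _), ?_, lim_acyc ι h1 h2 h3 (fun m n => tow_QZ X m n), simple, ?_, ?_, ?_⟩
  · exact h0.comp (fun a b h => congrArg Prod.fst h)
  · intro n hn
    refine ⟨ι0 (o n (Multiplicative.ofAdd 1)), ?_⟩
    rw [orderOf_injective (ι0) h0, orderOf_injective (o n) (ho n), orderOf_ofAdd_eq_addOrderOf, ZMod.addOrderOf_one]
  · intro z hz
    by_contra hne
    have hc : ∀ a b : D, a * b = b * a := by
      have : Subgroup.normalClosure {z} ≤ Subgroup.center D := by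
        apply Subgroup.normalClosure_le_normal
        simpa [Subgroup.mem_center_iff] using hz
      rw [simple z hne] at this
      intro a b
      exact (Subgroup.mem_center_iff.1 (this (Subgroup.mem_top b))) a
    obtain ⟨x, hx⟩ := exists_ne (1 : X)
    have e1 := congrArg (allTw X) (ush_comm x)
    simp only [map_mul, map_inv] at e1
    have e2 : ι1 (ebd X x) = 1 := by
      have : ebd X x = allTw X (pr (x, 1)) := rfl
      rw [this, ← e1]
      rw [map_mul, map_mul, map_mul, map_inv, map_inv, hc (ι1 _) (ι1 _)]
      group
    have := h11 (e2.trans (map_one _).symm)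
    exact hx (ebd_inj (this.trans (map_one _).symm))
  · intro f hf
    let p : (W × ℕ → Multiplicative (ZMod 2)) →* X := (MonoidHom.inr W _).comp (MonoidHom.inl _ _)
    have hp : Function.Injective p := fun a b h => congrArg (fun x : X => x.2.1) h
    classical
    let e : Set (W × ℕ) → (W × ℕ → Multiplicative (ZMod 2)) := fun s x => if x ∈ s then Multiplicative.ofAdd 1 else 1
    have he : Function.Injective e := by
      intro s t hst
      ext x
      have := congrFun hst x
      simp only [e] at this
      have h01 : (Multiplicative.ofAdd 1 : Multiplicative (ZMod 2)) ≠ 1 := by decide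
      by_cases hs : x ∈ s <;> by_cases ht : x ∈ t <;> simp_all
    exact Function.cantor_injective (fun s => f (ι0 (p (e s)))) (hf.comp (h0.comp (hp.comp he)))
end HG

namespace HG

/-- an amalgamated product -/
structure Amal {H G1 G2 G : Type} [Group H] [Group G1] [Group G2] [Group G]
   (j1 : H →* G1) (j2 : H →* G2) (i1 : G1 →* G) (i2 : G2 →* G) : Prop where
  j1inj : Function.Injective j1
  j2inj : Function.Injective j2
  i1inj : Function.Injective i1
  i2inj : Function.Injective i2
  comm : ∀ h, i1 (j1 h) = i2 (j2 h)
  gen : ∀ S : Subgroup G, (∀ x, i1 x ∈ S) → (∀ x, i2 x ∈ S) → ∀ g, g ∈ S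
  univ : ∀ (K : Type) [Group K] (a : G1 →* K) (b : G2 →* K), (∀ h, a (j1 h) = b (j2 h)) →
    ∃ f : G →* K, (∀ x, f (i1 x) = a x) ∧ (∀ x, f (i2 x) = b x)

section
universe u
/-- two-element family -/
abbrev fam2 (G1 G2 : Type) : Bool → Type := fun b => match b with
  | true => G1
  | false => G2

instance (G1 G2 : Type) [g1 : Group G1] [g2 : Group G2] (b : Bool) : Group (fam2 G1 G2 b) := match b with
  | true => g1
  | false => g2

def hom2 {K G1 G2 : Type} [Group K] [g1 : Group G1] [g2 : Group G2] (a : K →* G1) (c : K →* G2) : ∀ b, K →* fam2 G1 G2 b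
  | true => a
  | false => c

def hom2' {K G1 G2 : Type} [Group K] [g1 : Group G1] [g2 : Group G2] (a : G1 →* K) (c : G2 →* K) : ∀ b, fam2 G1 G2 b →* K
  | true => a
  | false => c
end

theorem exists_amal {H G1 G2 : Type} [Group H] [Group G1] [Group G2] (j1 : H →* G1) (j2 : H →* G2)
   (h1 : Function.Injective j1) (h2 : Function.Injective j2) :
   ∃ (G : Type) (_ : Group G) (i1 : G1 →* G) (i2 : G2 →* G), Amal j1 j2 i1 i2 := by
  have hinj : ∀ b, Function.Injective (hom2 j1 j2 b) := by rintro (_ | _); exacts [h2, h1]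
  let i : ∀ b, fam2 G1 G2 b →* Monoid.PushoutI (hom2 j1 j2) := fun b => Monoid.PushoutI.of b
  let i1 : G1 →* Monoid.PushoutI (hom2 j1 j2) := i true
  let i2 : G2 →* Monoid.PushoutI (hom2 j1 j2) := i false
  have hc : ∀ h, i1 (j1 h) = i2 (j2 h) := fun h =>
    (Monoid.PushoutI.of_apply_eq_base (hom2 j1 j2) true h).trans (Monoid.PushoutI.of_apply_eq_base (hom2 j1 j2) false h).symm
  refine ⟨Monoid.PushoutI (hom2 j1 j2), inferInstance, i1, i2, h1, h2, Monoid.PushoutI.of_injective hinj true,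
    Monoid.PushoutI.of_injective hinj false, hc, ?_, ?_⟩
  · intro S s1 s2 g
    induction g using Monoid.PushoutI.induction_on with
    | of b g => cases b; exacts [s2 g, s1 g]
    | base h => rw [← Monoid.PushoutI.of_apply_eq_base (hom2 j1 j2) true h]; exact s1 _
    | mul x y hx hy => exact S.mul_mem hx hy
  · intro K _ a b hab
    refine ⟨Monoid.PushoutI.lift (hom2' a b) (a.comp j1) ?_, fun x => ?_, fun x => ?_⟩
    · rintro (_ | _)
      · ext h; exact (hab h).symm
      · rfl
    · exact Monoid.PushoutI.lift_of (φ := hom2 j1 j2) (hom2' a b) (a.comp j1) (i := true) _ x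
    · exact Monoid.PushoutI.lift_of (φ := hom2 j1 j2) (hom2' a b) (a.comp j1) (i := false) _ x

section
variable {K G : Type} [Group K] [Group G]
/-- action on cosets -/
abbrev qa (f : K →* G) : G →* Equiv.Perm (G ⧸ f.range) := MulAction.toPermHom G _

abbrev qx (f : K →* G) (g : G) : G ⧸ f.range := QuotientGroup.mk g

lemma qa_apply (f : K →* G) (g h : G) : qa f g (qx f h) = qx f (g * h) := rfl

lemma qx_eq (f : K →* G) (g h : G) : qx f g = qx f h ↔ ∃ k, g * f k = h := by
  rw [QuotientGroup.eq]
  constructor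
  · rintro ⟨k, hk⟩; exact ⟨k, by rw [hk]; group⟩
  · rintro ⟨k, rfl⟩; exact ⟨k, by group⟩

lemma qx_mul (f : K →* G) (g : G) (k : K) : qx f (g * f k) = qx f g := ((qx_eq f g _).2 ⟨k, rfl⟩).symm

lemma qx_surj (f : K →* G) (x : G ⧸ f.range) : ∃ g, qx f g = x := QuotientGroup.mk_surjective x

lemma q_tr (f : K →* G) (x : G ⧸ f.range) : ∃ g, qa f g (qx f 1) = x := by
  obtain ⟨g, rfl⟩ := qx_surj f x
  exact ⟨g, by rw [qa_apply, mul_one]⟩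

lemma q_st (f : K →* G) (g : G) : qa f g (qx f 1) = qx f 1 ↔ ∃ k, f k = g := by
  rw [qa_apply, mul_one, eq_comm, qx_eq]; simp

lemma q_fix (f : K →* G) (k : K) : qa f (f k) (qx f 1) = qx f 1 := (q_st f _).2 ⟨k, rfl⟩

end

namespace Amal
variable {H G1 G2 G : Type} [Group H] [Group G1] [Group G2] [Group G]
   {j1 : H →* G1} {j2 : H →* G2} {i1 : G1 →* G} {i2 : G2 →* G}

lemma symm (A : Amal j1 j2 i1 i2) : Amal j2 j1 i2 i1 :=
  ⟨A.j2inj, A.j1inj, A.i2inj, A.i1inj, fun h => (A.comm h).symm, fun S a b => A.gen S b a, fun K _ a b h => by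
    obtain ⟨f, x, y⟩ := A.univ K b a (fun k => (h k).symm)
    exact ⟨f, y, x⟩⟩

/-- projections of coset spaces -/
def q1 (_ : Amal j1 j2 i1 i2) : G ⧸ (i1.comp j1).range → G ⧸ i1.range :=
  Quotient.map' id (fun a b h => by
    rw [QuotientGroup.leftRel_apply] at h ⊢
    obtain ⟨k, hk⟩ := h
    exact ⟨j1 k, hk⟩)

def q2 (A : Amal j1 j2 i1 i2) : G ⧸ (i1.comp j1).range → G ⧸ i2.range :=
  Quotient.map' id (fun a b h => by
    rw [QuotientGroup.leftRel_apply] at h ⊢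
    obtain ⟨k, hk⟩ := h
    exact ⟨j2 k, (A.comm k).symm.trans hk⟩)

variable (A : Amal j1 j2 i1 i2)
@[simp] lemma q1_mk (g : G) : A.q1 (qx _ g) = qx i1 g := rfl
@[simp] lemma q2_mk (g : G) : A.q2 (qx _ g) = qx i2 g := rfl

include A in
lemma exists_der (M : Type) [AddCommGroup M] : ∃ d : G → (M →ₗ[ℤ] ((G ⧸ (i1.comp j1).range) →₀ M)),
    (∀ g h, d (g * h) = d g + permRep (qa (i1.comp j1)) (triv G M) g ∘ₗ d h) ∧
    (∀ x m, d (i1 x) m = Finsupp.single (qx _ (i1 x)) m - Finsupp.single (qx _ 1) m) ∧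
    (∀ y, d (i2 y) = 0) := by
  let ρ := permRep (qa (i1.comp j1)) (triv G M)
  let V := M →ₗ[ℤ] ((G ⧸ (i1.comp j1).range) →₀ M)
  let e : G → V := fun g => Finsupp.lsingle (qx _ g)
  have he : ∀ g h, ρ g ∘ₗ e h = e (g * h) := by
    intro g h
    refine LinearMap.ext fun m => ?_
    simp only [e, ρ, LinearMap.comp_apply, Finsupp.lsingle_apply, permRep_single, qa_apply]; rfl
  have hρ1 : ∀ v : V, ρ 1 ∘ₗ v = v := fun v => by rw [map_one]; rfl
  have hρm : ∀ g h, ∀ v : V, ρ (g * h) ∘ₗ v = ρ g ∘ₗ (ρ h ∘ₗ v) := fun g h v => by rw [map_mul]; rfl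
  have hρi : ∀ g, ∀ v : V, ρ g⁻¹ ∘ₗ (ρ g ∘ₗ v) = v := fun g v => by rw [← hρm]; simp only [inv_mul_cancel, mul_inv_cancel, hρ1]
  have hρi' : ∀ g, ∀ v : V, ρ g ∘ₗ (ρ g⁻¹ ∘ₗ v) = v := fun g v => by rw [← hρm]; simp only [inv_mul_cancel, mul_inv_cancel, hρ1]
  -- affine action of G via conjugation of linear action by translation
  let lin : G →* Equiv.Perm V :=
    { toFun := fun g => ⟨fun v => ρ g ∘ₗ v, fun v => ρ g⁻¹ ∘ₗ v, hρi g, hρi' g⟩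
      map_one' := by ext1 v; exact hρ1 v
      map_mul' := fun g h => by ext1 v; exact hρm g h v }
  let τ : Equiv.Perm V := Equiv.addRight (e 1)
  let aff : G →* Equiv.Perm V := (MulAut.conj τ⁻¹).toMonoidHom.comp lin
  have haff : ∀ g v, aff g v = ρ g ∘ₗ v + (e g - e 1) := by
    intro g v
    have : aff g v = ρ g ∘ₗ (v + e 1) + - e 1 := rfl
    rw [this, LinearMap.comp_add, he, mul_one]; abel
  obtain ⟨F, hF1, hF2⟩ := A.univ (Equiv.Perm V) (aff.comp i1) (lin.comp i2) (by
    intro h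
    ext1 v
    have h1 : (aff.comp i1) (j1 h) v = ρ (i1 (j1 h)) ∘ₗ v + (e (i1 (j1 h)) - e 1) := haff _ _
    have h2 : e (i1 (j1 h)) = e 1 := by
      refine congrArg (fun x => (Finsupp.lsingle x : V)) ?_
      have := qx_mul (i1.comp j1) 1 h
      rwa [one_mul] at this
    rw [h1, h2, sub_self, add_zero, A.comm]
    rfl)
  have hF : ∀ g, ∀ v, F g v = ρ g ∘ₗ v + F g 0 := by
    let S : Subgroup G :=
      { carrier := {g | ∀ v, F g v = ρ g ∘ₗ v + F g 0}
        one_mem' := by intro v; rw [map_one, hρ1]; simp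
        mul_mem' := by
          intro g h hg hh v
          have e1 : F (g * h) v = F g (F h v) := by rw [map_mul]; rfl
          have e2 : F (g * h) 0 = F g (F h 0) := by rw [map_mul]; rfl
          rw [e1, e2, hh v, hg, hg (F h 0), hρm, LinearMap.comp_add]; abel
        inv_mem' := by
          intro g hg v
          apply (F g).injective
          have e1 : ∀ w, F g (F g⁻¹ w) = w := by intro w; rw [map_inv]; simp
          rw [e1, hg, LinearMap.comp_add, hρi']
          have := hg (F g⁻¹ 0)
          rw [e1] at this
          rw [add_assoc, ← this, add_zero] }
    intro g
    refine A.gen S (fun x v => ?_) (fun x v => ?_) g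
    · rw [hF1]
      have := haff (i1 x)
      exact (this v).trans (by rw [show (aff.comp i1) x 0 = _ from this 0, LinearMap.comp_zero, zero_add])
    · rw [hF2]
      change ρ (i2 x) ∘ₗ v = ρ (i2 x) ∘ₗ v + ρ (i2 x) ∘ₗ 0
      rw [LinearMap.comp_zero, add_zero]
  refine ⟨fun g => F g 0, fun g h => ?_, fun x m => ?_, fun y => ?_⟩
  · have e1 : F (g * h) 0 = F g (F h 0) := by rw [map_mul]; rfl
    exact e1.trans ((hF _ _).trans (add_comm _ _))
  · have : F (i1 x) 0 = e (i1 x) - e 1 := by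
      rw [hF1]
      exact (haff (i1 x) 0).trans (by rw [LinearMap.comp_zero, zero_add])
    dsimp only
    rw [this]; rfl
  · change F (i2 y) 0 = 0
    rw [hF2]; exact LinearMap.comp_zero _

lemma coef_inj {M : Type} [AddCommGroup M] (w : (G ⧸ (i1.comp j1).range) →₀ M)
   (h1 : permMap A.q1 (LinearMap.id (R := ℤ) (M := M)) w = 0) (h2 : permMap A.q2 (LinearMap.id (R := ℤ) (M := M)) w = 0) : w = 0 := by
  obtain ⟨d, hd, hd1, hd2⟩ := A.exists_der M
  let ρ := permRep (qa (i1.comp j1)) (triv G M)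
  let c2 : G ⧸ i2.range → (M →ₗ[ℤ] ((G ⧸ (i1.comp j1).range) →₀ M)) := Quotient.lift d (by
    intro a b hab
    obtain ⟨k, rfl⟩ := (qx_eq i2 a b).1 (Quotient.sound hab)
    rw [hd, hd2, LinearMap.comp_zero, add_zero])
  let c1 : G ⧸ i1.range → (M →ₗ[ℤ] ((G ⧸ (i1.comp j1).range) →₀ M)) := Quotient.lift (fun g => d g - Finsupp.lsingle (qx _ g)) (by
    intro a b hab
    obtain ⟨k, rfl⟩ := (qx_eq i1 a b).1 (Quotient.sound hab)
    refine LinearMap.ext fun m => ?_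
    simp only [hd, LinearMap.sub_apply, LinearMap.add_apply, LinearMap.comp_apply, hd1, map_sub, permRep_single, qa_apply,
      Finsupp.lsingle_apply, mul_one, MonoidHom.one_apply, Module.End.one_apply]
    abel)
  have key : LinearMap.id = (Finsupp.lsum ℤ c2) ∘ₗ permMap A.q2 LinearMap.id - (Finsupp.lsum ℤ c1) ∘ₗ permMap A.q1 LinearMap.id := by
    refine Finsupp.lhom_ext fun x m => ?_
    obtain ⟨g, rfl⟩ := qx_surj _ x
    simp only [LinearMap.sub_apply, LinearMap.comp_apply, permMap_single, q1_mk, q2_mk, Finsupp.lsum_single, LinearMap.id_apply]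
    change _ = d g m - (d g m - Finsupp.single (qx _ g) m)
    abel
  have := congrArg (fun L => L w) key
  simpa [h1, h2] using this

lemma coef_ex {M : Type} [AddCommGroup M] (x : (G ⧸ i1.range) →₀ M) (y : (G ⧸ i2.range) →₀ M)
   (h : aug _ M x + aug _ M y = 0) : ∃ w, permMap A.q1 (LinearMap.id (R := ℤ) (M := M)) w = x ∧ 
      permMap A.q2 (LinearMap.id (R := ℤ) (M := M)) w = - y := by
  let R : Submodule ℤ (((G ⧸ i1.range) →₀ M) × ((G ⧸ i2.range) →₀ M)) :=
    LinearMap.range (LinearMap.prod (permMap A.q1 (LinearMap.id (R := ℤ) (M := M))) (- permMap A.q2 (LinearMap.id (R := ℤ) (M := M))))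
  have r0 : ∀ g m, ((Finsupp.single (qx i1 g) m, - Finsupp.single (qx i2 g) m) : ((G ⧸ i1.range) →₀ M) × ((G ⧸ i2.range) →₀ M)) ∈ R := by
    intro g m
    exact ⟨Finsupp.single (qx _ g) m, by simp⟩
  have r1 : ∀ g h m, ((Finsupp.single (qx i1 (g * h)) m - Finsupp.single (qx i1 g) m, 0) : ((G ⧸ i1.range) →₀ M) × ((G ⧸ i2.range) →₀ M)) ∈ R := by
    intro g h m
    let S : Subgroup G :=
      { carrier := {h | ∀ g, ((Finsupp.single (qx i1 (g * h)) m - Finsupp.single (qx i1 g) m, 0) : ((G ⧸ i1.range) →₀ M) × ((G ⧸ i2.range) →₀ M)) ∈ R}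
        one_mem' := by intro g; rw [mul_one, sub_self]; exact R.zero_mem
        mul_mem' := by
          intro a b ha hb g
          have := R.add_mem (hb (g * a)) (ha g)
          rw [Prod.mk_add_mk] at this
          simpa [mul_assoc] using this
        inv_mem' := by
          intro a ha g
          have := R.neg_mem (ha (g * a⁻¹))
          simpa using this }
    refine A.gen S (fun x g => ?_) (fun x g => ?_) h g
    · rw [qx_mul, sub_self]; exact R.zero_mem
    · have := R.sub_mem (r0 (g * i2 x) m) (r0 g m)
      rw [qx_mul] at this
      simpa using this
  have r2 : ∀ x : (G ⧸ i1.range) →₀ M, ((x - Finsupp.single (qx i1 1) (aug _ M x), 0) : ((G ⧸ i1.range) →₀ M) × ((G ⧸ i2.range) →₀ M)) ∈ R := by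
    intro x
    induction x using Finsupp.induction_linear with
    | zero => simp; exact R.zero_mem
    | add x y hx hy =>
      have := R.add_mem hx hy
      rw [Prod.mk_add_mk, add_zero] at this
      rw [map_add, Finsupp.single_add]
      convert this using 2
      abel
    | single z m =>
      obtain ⟨g, rfl⟩ := qx_surj _ z
      have := r1 1 g m
      rw [one_mul] at this
      rwa [aug_single]
  have r3 : ∀ y : (G ⧸ i2.range) →₀ M, ((Finsupp.single (qx i1 1) (aug _ M y), -y) : ((G ⧸ i1.range) →₀ M) × ((G ⧸ i2.range) →₀ M)) ∈ R := by
    intro x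
    induction x using Finsupp.induction_linear with
    | zero => simp; exact R.zero_mem
    | add x y hx hy =>
      have := R.add_mem hx hy
      rw [Prod.mk_add_mk] at this
      rw [map_add, Finsupp.single_add, neg_add]
      exact this
    | single z m =>
      obtain ⟨g, rfl⟩ := qx_surj _ z
      have := R.sub_mem (r0 g m) (r1 1 g m)
      rw [one_mul] at this
      rw [aug_single]
      simpa using this
  have r4 : (x, y) ∈ R := by
    have := R.sub_mem (r2 x) (r3 y)
    rw [Prod.mk_sub_mk] at this
    convert this using 2
    · rw [sub_sub, ← Finsupp.single_add, h]; simp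
    · simp
  obtain ⟨w, hw⟩ := r4
  refine ⟨w, congrArg Prod.fst hw, ?_⟩
  have : - permMap A.q2 (LinearMap.id (R := ℤ) (M := M)) w = y := congrArg Prod.snd hw
  rw [← this, neg_neg]
end Amal
end HG

namespace HG

section
variable {G M N : Type} [Group G] [AddCommGroup M] [AddCommGroup N]
def prodRep (ρ : Representation ℤ G M) (σ : Representation ℤ G N) : Representation ℤ G (M × N) where
  toFun g := (ρ g).prodMap (σ g)
  map_one' := by rw [map_one, map_one]; rfl
  map_mul' g h := by rw [map_mul, map_mul]; rfl

variable (ρ : Representation ℤ G M) (σ : Representation ℤ G N)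
lemma pe_inl : Eqv (MonoidHom.id G) ρ (prodRep ρ σ) (LinearMap.inl ℤ M N) := by
  intro g m; simp [prodRep]
lemma pe_inr : Eqv (MonoidHom.id G) σ (prodRep ρ σ) (LinearMap.inr ℤ M N) := by
  intro g m; simp [prodRep]
lemma pe_fst : Eqv (MonoidHom.id G) (prodRep ρ σ) ρ (LinearMap.fst ℤ M N) := fun _ _ => rfl
lemma pe_snd : Eqv (MonoidHom.id G) (prodRep ρ σ) σ (LinearMap.snd ℤ M N) := fun _ _ => rfl

lemma prod_dec (n : ℕ) (x : H (prodRep ρ σ) n) :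
   x = hmap (pe_inl ρ σ) n (hmap (pe_fst ρ σ) n x) + hmap (pe_inr ρ σ) n (hmap (pe_snd ρ σ) n x) := by
  have e1 : Eqv (MonoidHom.id G) (prodRep ρ σ) (prodRep ρ σ) (LinearMap.inl ℤ M N ∘ₗ LinearMap.fst ℤ M N) := (pe_inl ρ σ).comp (pe_fst ρ σ)
  have e2 : Eqv (MonoidHom.id G) (prodRep ρ σ) (prodRep ρ σ) (LinearMap.inr ℤ M N ∘ₗ LinearMap.snd ℤ M N) := (pe_inr ρ σ).comp (pe_snd ρ σ)
  have e3 : Eqv (MonoidHom.id G) (prodRep ρ σ) (prodRep ρ σ) (LinearMap.inl ℤ M N ∘ₗ LinearMap.fst ℤ M N + LinearMap.inr ℤ M N ∘ₗ LinearMap.snd ℤ M N) := by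
    intro g m
    rw [LinearMap.add_apply, LinearMap.add_apply, map_add, e1 g m, e2 g m]
  have h := hmap_add e1 e2 e3 n x
  rw [hmap_id' e3 (fun _ => rfl) (fun m => by simp)] at h
  rw [hmap_comp_eq (pe_inl ρ σ) (pe_fst ρ σ) e1 (fun _ => rfl) (fun _ => rfl), hmap_comp_eq (pe_inr ρ σ) (pe_snd ρ σ) e2 (fun _ => rfl) (fun _ => rfl)]
  exact h

variable {K P : Type} [Group K] [AddCommGroup P] {τ : Representation ℤ K P} {f : K →* G} {φ : P →ₗ[ℤ] M} {ψ : P →ₗ[ℤ] N}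
lemma pe_fst_comp (h : Eqv f τ (prodRep ρ σ) (φ.prod ψ)) (h1 : Eqv f τ ρ φ) (n : ℕ) (x : H τ n) :
    hmap (pe_fst ρ σ) n (hmap h n x) = hmap h1 n x := hmap_comp_eq _ _ _ (fun _ => rfl) (fun _ => rfl) _ _
lemma pe_snd_comp (h : Eqv f τ (prodRep ρ σ) (φ.prod ψ)) (h1 : Eqv f τ σ ψ) (n : ℕ) (x : H τ n) :
    hmap (pe_snd ρ σ) n (hmap h n x) = hmap h1 n x := hmap_comp_eq _ _ _ (fun _ => rfl) (fun _ => rfl) _ _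
lemma pe_fi (n : ℕ) (x : H ρ n) : hmap (pe_fst ρ σ) n (hmap (pe_inl ρ σ) n x) = x := by
  rw [hmap_comp_eq (pe_fst ρ σ) (pe_inl ρ σ) (Eqv.id _) (fun _ => rfl) (fun _ => rfl), hmap_id]
lemma pe_si (n : ℕ) (x : H σ n) : hmap (pe_snd ρ σ) n (hmap (pe_inr ρ σ) n x) = x := by
  rw [hmap_comp_eq (pe_snd ρ σ) (pe_inr ρ σ) (Eqv.id _) (fun _ => rfl) (fun _ => rfl), hmap_id]
lemma pe_f0 (n : ℕ) (x : H σ n) : hmap (pe_fst ρ σ) n (hmap (pe_inr ρ σ) n x) = 0 := by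
  rw [hmap_comp_eq (φ₁ := 0) (pe_fst ρ σ) (pe_inr ρ σ) (f₁ := MonoidHom.id G) (fun g m => by simp) (fun _ => rfl) (fun _ => rfl)]; exact hmap_zero _ _ _
lemma pe_s0 (n : ℕ) (x : H ρ n) : hmap (pe_snd ρ σ) n (hmap (pe_inl ρ σ) n x) = 0 := by
  rw [hmap_comp_eq (φ₁ := 0) (pe_snd ρ σ) (pe_inl ρ σ) (f₁ := MonoidHom.id G) (fun g m => by simp) (fun _ => rfl) (fun _ => rfl)]; exact hmap_zero _ _ _
end

section
variable {K G : Type} [Group K] [Group G] (f : K →* G) (M : Type) [AddCommGroup M]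
lemma eS : Eqv f (triv K M) (permRep (qa f) (triv G M)) (Finsupp.lsingle (qx f 1)) := by
  intro k m
  rw [Finsupp.lsingle_apply, Finsupp.lsingle_apply, permRep_single, q_fix]; rfl

lemma S_bij (hf : Function.Injective f) (n : ℕ) : Function.Bijective (hmap (eS f M) n) :=
  shapiro hf (qa f) (qx f 1) (q_tr f) (q_st f) n (triv G M)

lemma hT_zero_bij (n : ℕ) (hn : n = 0) : Function.Injective (hT f M n) := by
  subst hn
  rw [injective_iff_map_eq_zero]
  intro x hx
  obtain ⟨m, rfl⟩ := h0_surj x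
  unfold hT at hx
  rw [hmap_h0, h0_zero] at hx
  have : m = 0 := by
    have hle : AddSubgroup.closure {x | ∃ (g : G) (m' : M), x = triv G M g m' - m'} ≤ ⊥ := by
      rw [AddSubgroup.closure_le]
      rintro x ⟨g, m', rfl⟩
      simp
    exact hle hx
  rw [this, h0_zero]; exact AddSubgroup.zero_mem _
end

namespace Amal
variable {H G1 G2 G : Type} [Group H] [Group G1] [Group G2] [Group G]
   {j1 : H →* G1} {j2 : H →* G2} {i1 : G1 →* G} {i2 : G2 →* G} (A : Amal j1 j2 i1 i2)

lemma e_q1 (M : Type) [AddCommGroup M] : Eqv (MonoidHom.id G) (permRep (qa (i1.comp j1)) (triv G M)) (permRep (qa i1) (triv G M))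
    (permMap A.q1 LinearMap.id) := Eqv.permMap (fun _ _ => rfl) (fun g z => by
      obtain ⟨t, rfl⟩ := qx_surj _ z; rfl)

lemma e_q2 (M : Type) [AddCommGroup M] : Eqv (MonoidHom.id G) (permRep (qa (i1.comp j1)) (triv G M)) (permRep (qa i2) (triv G M))
    (permMap A.q2 LinearMap.id) := Eqv.permMap (fun _ _ => rfl) (fun g z => by
      obtain ⟨t, rfl⟩ := qx_surj _ z; rfl)

lemma e_q2n (M : Type) [AddCommGroup M] : Eqv (MonoidHom.id G) (permRep (qa (i1.comp j1)) (triv G M)) (permRep (qa i2) (triv G M))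
    (-permMap A.q2 LinearMap.id) := fun g m => by
  rw [LinearMap.neg_apply, A.e_q2 M g m, LinearMap.neg_apply, map_neg]

lemma mvSES (M : Type) [AddCommGroup M] : SES (permRep (qa (i1.comp j1)) (triv G M))
   (prodRep (permRep (qa i1) (triv G M)) (permRep (qa i2) (triv G M))) (triv G M)
   (LinearMap.prod (permMap A.q1 LinearMap.id) (-permMap A.q2 LinearMap.id)) (LinearMap.coprod (aug _ M) (aug _ M)) where
  eα := fun g m => Prod.ext (A.e_q1 M g m) (A.e_q2n M g m)
  eβ := fun g m => by
    rw [LinearMap.coprod_apply, LinearMap.coprod_apply, map_add]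
    exact congrArg₂ (· + ·) (Eqv.aug (qa i1) (triv G M) g m.1) (Eqv.aug (qa i2) (triv G M) g m.2)
  inj := by
    rw [injective_iff_map_eq_zero]
    intro w hw
    refine A.coef_inj w (congrArg Prod.fst hw) ?_
    have h : - permMap A.q2 (LinearMap.id (R := ℤ) (M := M)) w = 0 := congrArg Prod.snd hw
    exact neg_eq_zero.1 h
  surj := fun m => ⟨(Finsupp.single (qx i1 1) m, 0), by simp⟩
  zero := by
    intro w
    have : LinearMap.coprod (aug _ M) (aug _ M) ∘ₗ (LinearMap.prod (permMap A.q1 LinearMap.id) (-permMap A.q2 LinearMap.id)) = 0 := by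
      refine Finsupp.lhom_ext fun z m => ?_
      simp
    exact congrArg (fun L => L w) this
  ex := by
    rintro ⟨x, y⟩ h
    obtain ⟨w, h1, h2⟩ := A.coef_ex x y h
    exact ⟨w, Prod.ext h1 (by simp [h2])⟩

variable (M : Type) [AddCommGroup M] (n : ℕ)

lemma hneg (x : HG.H (permRep (qa (i1.comp j1)) (triv G M)) n) : hmap (A.e_q2n M) n x = - hmap (A.e_q2 M) n x := by
  have e3 : Eqv (MonoidHom.id G) (permRep (qa (i1.comp j1)) (triv G M)) (permRep (qa i2) (triv G M))
    (-permMap A.q2 LinearMap.id + permMap A.q2 LinearMap.id) := fun g m => by simp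
  have h := hmap_add (A.e_q2n M) (A.e_q2 M) e3 n x
  have h0 : hmap e3 n x = 0 := by
    rw [hmap_congr e3 (f₂ := MonoidHom.id G) (φ₂ := 0) (fun g m => by simp) rfl (by simp)]
    exact hmap_zero _ _ _
  rw [h0] at h
  exact eq_neg_of_add_eq_zero_left h.symm

-- the map from the homology of the amalgamated subgroup
lemma fst_α (y : HG.H (triv H M) n) : hmap (pe_fst (permRep (qa i1) (triv G M)) (permRep (qa i2) (triv G M))) n (hmap (A.mvSES M).eα n (hmap (eS (i1.comp j1) M) n y)) =
    hmap (eS i1 M) n (hT j1 M n y) := by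
  rw [pe_fst_comp _ _ (A.mvSES M).eα (A.e_q1 M)]
  exact hmap_sq (eS (i1.comp j1) M) (A.e_q1 M) (Eqv.triv j1 LinearMap.id) (eS i1 M) (fun _ => rfl) (fun m => by simp) _ _

lemma snd_α (y : HG.H (triv H M) n) : hmap (pe_snd (permRep (qa i1) (triv G M)) (permRep (qa i2) (triv G M))) n (hmap (A.mvSES M).eα n (hmap (eS (i1.comp j1) M) n y)) =
    - hmap (eS i2 M) n (hT j2 M n y) := by
  rw [pe_snd_comp _ _ (A.mvSES M).eα (A.e_q2n M), hneg]
  congr 1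
  exact hmap_sq (eS (i1.comp j1) M) (A.e_q2 M) (Eqv.triv j2 LinearMap.id) (eS i2 M) (fun g => A.comm g) (fun m => by simp) _ _

lemma β_inl (x : HG.H (triv G1 M) n) : hmap (A.mvSES M).eβ n (hmap (pe_inl (permRep (qa i1) (triv G M)) (permRep (qa i2) (triv G M))) n (hmap (eS i1 M) n x)) = hT i1 M n x := by
  have e : Eqv i1 (triv G1 M) (prodRep (permRep (qa i1) (triv G M)) (permRep (qa i2) (triv G M))) (LinearMap.inl _ _ _ ∘ₗ Finsupp.lsingle (qx i1 1)) :=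
    (pe_inl (permRep (qa i1) (triv G M)) (permRep (qa i2) (triv G M))).comp (eS i1 M)
  rw [hmap_comp_eq (pe_inl (permRep (qa i1) (triv G M)) (permRep (qa i2) (triv G M))) (eS i1 M) e (fun _ => rfl) (fun _ => rfl)]
  exact hmap_comp_eq _ _ _ (fun _ => rfl) (fun m => by simp) _ _

lemma β_inr (x : HG.H (triv G2 M) n) : hmap (A.mvSES M).eβ n (hmap (pe_inr (permRep (qa i1) (triv G M)) (permRep (qa i2) (triv G M))) n (hmap (eS i2 M) n x)) = hT i2 M n x := by
  have e : Eqv i2 (triv G2 M) (prodRep (permRep (qa i1) (triv G M)) (permRep (qa i2) (triv G M))) (LinearMap.inr _ _ _ ∘ₗ Finsupp.lsingle (qx i2 1)) :=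
    (pe_inr (permRep (qa i1) (triv G M)) (permRep (qa i2) (triv G M))).comp (eS i2 M)
  rw [hmap_comp_eq (pe_inr (permRep (qa i1) (triv G M)) (permRep (qa i2) (triv G M))) (eS i2 M) e (fun _ => rfl) (fun _ => rfl)]
  exact hmap_comp_eq _ _ _ (fun _ => rfl) (fun m => by simp) _ _

lemma mid (w : HG.H (prodRep (permRep (qa i1) (triv G M)) (permRep (qa i2) (triv G M))) n) : ∃ x1 x2,
    hmap (pe_fst (permRep (qa i1) (triv G M)) (permRep (qa i2) (triv G M))) n w = hmap (eS i1 M) n x1 ∧ hmap (pe_snd (permRep (qa i1) (triv G M)) (permRep (qa i2) (triv G M))) n w = hmap (eS i2 M) n x2 ∧ hmap (A.mvSES M).eβ n w = hT i1 M n x1 + hT i2 M n x2 := by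
  obtain ⟨x1, h1⟩ := (S_bij i1 M A.i1inj n).2 (hmap (pe_fst (permRep (qa i1) (triv G M)) (permRep (qa i2) (triv G M))) n w)
  obtain ⟨x2, h2⟩ := (S_bij i2 M A.i2inj n).2 (hmap (pe_snd (permRep (qa i1) (triv G M)) (permRep (qa i2) (triv G M))) n w)
  refine ⟨x1, x2, h1.symm, h2.symm, ?_⟩
  rw [prod_dec (permRep (qa i1) (triv G M)) (permRep (qa i2) (triv G M)) n w, ← h1, ← h2, map_add, A.β_inl, A.β_inr]

include A in
lemma ij_inj : Function.Injective (i1.comp j1) := A.i1inj.comp A.j1inj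

include A in
/-- Mayer-Vietoris, middle part -/
theorem mv_mid (x1 : HG.H (triv G1 M) n) (x2 : HG.H (triv G2 M) n) (h : hT i1 M n x1 + hT i2 M n x2 = 0) :
   ∃ y, hT j1 M n y = x1 ∧ hT j2 M n y = - x2 := by
  have e0 : hmap (A.mvSES M).eβ n (hmap (pe_inl (permRep (qa i1) (triv G M)) (permRep (qa i2) (triv G M))) n (hmap (eS i1 M) n x1) + hmap (pe_inr (permRep (qa i1) (triv G M)) (permRep (qa i2) (triv G M))) n (hmap (eS i2 M) n x2)) = 0 := by
    rw [map_add, A.β_inl, A.β_inr, h]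
  obtain ⟨y', hy⟩ := (A.mvSES M).ex₂ _ _ e0
  obtain ⟨y, rfl⟩ := (S_bij _ M A.ij_inj n).2 y'
  refine ⟨y, ?_, ?_⟩
  · apply (S_bij i1 M A.i1inj n).1
    rw [← A.fst_α, hy, map_add, pe_fi, pe_f0, add_zero]
  · apply (S_bij i2 M A.i2inj n).1
    rw [map_neg, ← neg_eq_iff_eq_neg, ← A.snd_α, hy, map_add, pe_si, pe_s0, zero_add]

include A in
/-- Mayer-Vietoris, connecting map -/
theorem mv : ∃ δ : HG.H (triv G M) (n+1) →+ HG.H (triv H M) n,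
    (∀ z, hT j1 M n (δ z) = 0 ∧ hT j2 M n (δ z) = 0) ∧
    (∀ z, δ z = 0 → ∃ x1 x2, z = hT i1 M (n+1) x1 + hT i2 M (n+1) x2) ∧
    (∀ y, hT j1 M n y = 0 → hT j2 M n y = 0 → ∃ z, δ z = y) := by
  let e := AddEquiv.ofBijective (hmap (eS (i1.comp j1) M) n) (S_bij _ M A.ij_inj n)
  have he : ∀ x, hmap (eS (i1.comp j1) M) n (e.symm x) = x := fun x => e.apply_symm_apply x
  refine ⟨e.symm.toAddMonoidHom.comp (((A.mvSES M).δ n)), fun z => ⟨?_, ?_⟩, fun z hz => ?_, fun y h1 h2 => ?_⟩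
  · apply (S_bij i1 M A.i1inj n).1
    rw [← A.fst_α]
    change hmap (pe_fst (permRep (qa i1) (triv G M)) (permRep (qa i2) (triv G M))) n (hmap (A.mvSES M).eα n (hmap (eS (i1.comp j1) M) n (e.symm ((A.mvSES M).δ n z)))) = _
    rw [he, SES.αδ, map_zero, map_zero]
  · apply (S_bij i2 M A.i2inj n).1
    rw [← neg_eq_iff_eq_neg.2 (A.snd_α M n _)]
    change - hmap (pe_snd (permRep (qa i1) (triv G M)) (permRep (qa i2) (triv G M))) n (hmap (A.mvSES M).eα n (hmap (eS (i1.comp j1) M) n (e.symm ((A.mvSES M).δ n z)))) = _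
    rw [he, SES.αδ, map_zero, map_zero, neg_zero]
  · have h0 : (A.mvSES M).δ n z = 0 := e.symm.injective (hz.trans (map_zero _).symm)
    obtain ⟨w, rfl⟩ := (A.mvSES M).ex₃ _ _ h0
    obtain ⟨x1, x2, -, -, h⟩ := A.mid M (n+1) w
    exact ⟨x1, x2, h⟩
  · have h0 : hmap (A.mvSES M).eα n (hmap (eS (i1.comp j1) M) n y) = 0 := by
      rw [prod_dec (permRep (qa i1) (triv G M)) (permRep (qa i2) (triv G M)) n (hmap (A.mvSES M).eα n (hmap (eS (i1.comp j1) M) n y)), A.fst_α, A.snd_α, h1, h2]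
      simp
    obtain ⟨z, hz⟩ := (A.mvSES M).ex₁ _ _ h0
    refine ⟨z, ?_⟩
    change e.symm ((A.mvSES M).δ n z) = y
    rw [hz]; exact e.symm_apply_apply y

include A in
/-- central elements lie in a large factor -/
theorem center_mem (z : G) (hz : ∀ g, g * z = z * g) (big : ∀ f : G1 → H × ℕ, ¬ Function.Injective f) : ∃ x, i1 x = z := by
  obtain ⟨c, h1, h2⟩ := A.coef_ex (M := ℤ) (Finsupp.single (qx i1 z) 1 - Finsupp.single (qx i1 1) 1) 0 (by simp)
  rw [neg_zero] at h2
  have inv : ∀ g, permRep (qa (i1.comp j1)) (triv G ℤ) (i1 g) c = c := by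
    intro g
    rw [← sub_eq_zero]
    apply A.coef_inj
    · have e := A.e_q1 ℤ (i1 g) c
      rw [map_sub, e, h1, map_sub, MonoidHom.id_apply, permRep_single, permRep_single, qa_apply, qa_apply, hz, mul_one,
        qx_mul]
      have := qx_mul i1 1 g
      rw [one_mul] at this
      rw [this]
      simp
    · have e := A.e_q2 ℤ (i1 g) c
      rw [map_sub, e, h2, map_zero, sub_zero]
  by_cases hc : c = 0
  · rw [hc, map_zero, eq_comm, sub_eq_zero] at h1
    have := Finsupp.single_left_injective (one_ne_zero) h1
    obtain ⟨k, hk⟩ := (qx_eq i1 _ _).1 this.symm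
    exact ⟨k, by rw [← hk, one_mul]⟩
  · exfalso
    obtain ⟨s, hs⟩ := Finsupp.support_nonempty_iff.2 hc
    have ap : ∀ g (c : (G ⧸ (i1.comp j1).range) →₀ ℤ) s, permRep (qa (i1.comp j1)) (triv G ℤ) g c (qa (i1.comp j1) g s) = c s := by
      intro g c s
      induction c using Finsupp.induction_linear with
      | zero => simp
      | add x y hx hy => rw [map_add, Finsupp.add_apply, hx, hy, Finsupp.add_apply]
      | single t m =>
        classical
        rw [permRep_single, Finsupp.single_apply, Finsupp.single_apply]
        simp
    have orb : ∀ g, qa (i1.comp j1) (i1 g) s ∈ c.support := by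
      intro g
      have := ap (i1 g) c s
      rw [inv] at this
      rw [Finsupp.mem_support_iff, this]
      exact Finsupp.mem_support_iff.1 hs
    obtain ⟨t, rfl⟩ := qx_surj _ s
    have ch : ∀ p, ∃ a, (∃ g, qa (i1.comp j1) (i1 g) (qx _ t) = p) → qa (i1.comp j1) (i1 a) (qx _ t) = p := by
      intro p
      by_cases hp : ∃ g, qa (i1.comp j1) (i1 g) (qx _ t) = p
      · obtain ⟨g, hg⟩ := hp; exact ⟨g, fun _ => hg⟩
      · exact ⟨1, fun h => (hp h).elim⟩
    choose u hu using ch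
    have ch2 : ∀ g, ∃ k, i1 (u (qa (i1.comp j1) (i1 g) (qx _ t))) * t * (i1.comp j1) k = i1 g * t := by
      intro g
      exact (qx_eq (i1.comp j1) _ _).1 (hu _ ⟨g, rfl⟩)
    choose k hk using ch2
    obtain ⟨idx, hidx⟩ := exists_injective_nat c.support
    refine big (fun g => (k g, idx ⟨_, orb g⟩)) fun g g' h => ?_
    obtain ⟨ha, hb⟩ := Prod.mk.inj h
    have hb' := congrArg Subtype.val (hidx hb)
    dsimp only at hb'
    have e1 := hk g
    have e2 := hk g'
    rw [ha, hb', e2] at e1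
    exact A.i1inj (mul_right_cancel e1.symm)
end Amal
end HG

namespace HG

lemma ncl_map {D G : Type} [Group D] [Group G] (f : D →* G) (g : D) (h : Subgroup.normalClosure {g} = ⊤)
    (N : Subgroup G) [N.Normal] (hg : f g ∈ N) (x : D) : f x ∈ N := by
  have : Subgroup.normalClosure {g} ≤ N.comap f := Subgroup.normalClosure_le_normal (by simpa using hg)
  rw [h] at this
  exact this (Subgroup.mem_top x)

structure IsSusp (W S : Type) [Group W] [Group S] : Prop where
  stg : ∀ n : ℕ, 2 ≤ n → ∃ g : S, orderOf g = n ∧ Subgroup.normalClosure {g} = ⊤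
  cen : ∀ z : S, (∀ g, g * z = z * g) → z = 1
  van : Van S 1
  iso : ∀ (M : Type) [AddCommGroup M] (n : ℕ), Nonempty (H (triv S M) (n+2) ≃+ H (triv W M) (n+1))

theorem exists_susp (W : Type) [Group W] [Nontrivial W] : ∃ (S : Type) (_ : Group S), IsSusp W S := by
  obtain ⟨D, _, d, hD⟩ := exists_D W
  obtain ⟨S, _, i1, i2, hA⟩ := exists_amal d d hD.inj hD.inj
  have key : ∀ (M : Type) [AddCommGroup M] (n : ℕ) (x1 x2 : H (triv D M) (n+1)), hT i1 M (n+1) x1 + hT i2 M (n+1) x2 = 0 := by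
    intro M _ n x1 x2
    rw [hD.acyc n M x1, hD.acyc n M x2, map_zero, map_zero, add_zero]
  refine ⟨S, inferInstance, ?_, ?_, ?_, ?_⟩
  · intro n hn
    obtain ⟨g, hg⟩ := hD.tors n hn
    refine ⟨i1 g, by rw [orderOf_injective i1 hA.i1inj, hg], ?_⟩
    have hg1 : g ≠ 1 := by
      rintro rfl; rw [orderOf_one] at hg; omega
    have h1 := ncl_map i1 g (hD.simple g hg1) (Subgroup.normalClosure {i1 g}) (Subgroup.subset_normalClosure rfl)
    obtain ⟨w, hw⟩ := exists_ne (1 : W)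
    have hw' : d w ≠ 1 := fun h => hw (hD.inj (h.trans (map_one d).symm))
    have h2 := ncl_map i2 (d w) (hD.simple _ hw') (Subgroup.normalClosure {i1 g}) (by
      rw [← hA.comm]; exact h1 _)
    rw [eq_top_iff]
    exact fun x _ => hA.gen _ h1 h2 x
  · intro z hz
    obtain ⟨x, rfl⟩ := hA.center_mem z hz hD.big
    rw [hD.center x fun g => hA.i1inj (by rw [map_mul, map_mul, hz]), map_one]
  · intro M _ z
    obtain ⟨δ, h1, h2, h3⟩ := hA.mv M 0
    obtain ⟨x1, x2, h⟩ := h2 z (hT_zero_bij d M 0 rfl ((h1 z).1.trans (map_zero _).symm))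
    exact h.trans (key M 0 x1 x2)
  · intro M _ n
    obtain ⟨δ, h1, h2, h3⟩ := hA.mv M (n+1)
    refine ⟨AddEquiv.ofBijective δ ⟨?_, ?_⟩⟩
    · rw [injective_iff_map_eq_zero]
      intro z hz
      obtain ⟨x1, x2, h⟩ := h2 z hz
      exact h.trans (key M (n+1) x1 x2)
    · intro y
      exact h3 y (hD.acyc _ _ _) (hD.acyc _ _ _)

/-- one step of the construction of groups with prescribed central subgroup -/
structure CStep {A E E' : Type} [CommGroup A] [Group E] [Group E'] (c : A →* E) (φ : E →* E') : Prop where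
  inj : Function.Injective φ
  cen : ∀ a e, φ (c a) * e = e * φ (c a)
  qz : ∀ n, QZ φ (n+1)
  acyc : Acyc E → Acyc E'
  center : ∀ z : E', (∀ g, g * z = z * g) → ∃ a, φ (c a) = z
  stg : Nontrivial A → ∀ n : ℕ, 2 ≤ n → ∃ g : E', orderOf g = n ∧ Subgroup.normalClosure {g} = ⊤

theorem exists_cstep {A E : Type} [CommGroup A] [Group E] (c : A →* E) (hc : Function.Injective c)
    (hz : ∀ a e, c a * e = e * c a) : ∃ (E' : Type) (_ : Group E') (φ : E →* E'), CStep c φ := by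
  obtain ⟨D, _, d, hD⟩ := exists_D E
  obtain ⟨D', _, d', hD'⟩ := exists_D (A × E)
  let j1 : A × E →* E × D :=
    { toFun := fun p => (c p.1 * p.2, d p.2)
      map_one' := by simp
      map_mul' := fun p q => Prod.ext (by
        simp only [Prod.fst_mul, Prod.snd_mul, map_mul]
        rw [mul_assoc, mul_assoc, ← mul_assoc (c q.1), hz q.1 p.2, mul_assoc]) (by simp) }
  let j2 : A × E →* A × D' := (MonoidHom.fst A E).prod (d'.comp ((MonoidHom.inr A E).comp (MonoidHom.snd A E)))
  have j1_ap : ∀ a e, j1 (a, e) = (c a * e, d e) := fun _ _ => rfl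
  have j2_ap : ∀ a e, j2 (a, e) = (a, d' (1, e)) := fun _ _ => rfl
  have hj1 : Function.Injective j1 := by
    rintro ⟨a, e⟩ ⟨a', e'⟩ h
    obtain ⟨h1, h2⟩ := Prod.mk.inj h
    have := hD.inj h2
    dsimp only at this h1
    subst this
    rw [hc (mul_right_cancel h1)]
  have hj2 : Function.Injective j2 := by
    rintro ⟨a, e⟩ ⟨a', e'⟩ h
    obtain ⟨h1, h2⟩ := Prod.mk.inj h
    have := hD'.inj h2
    exact Prod.ext h1 (Prod.mk.inj this).2
  obtain ⟨E', _, i1, i2, hA⟩ := exists_amal j1 j2 hj1 hj2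
  have hc' : ∀ a, i1 (c a, 1) = i2 (a, 1) := by
    intro a
    have := hA.comm (a, 1)
    rw [j1_ap, j2_ap, mul_one, map_one] at this
    rw [this]; congr 1; exact Prod.ext rfl (map_one d')
  have hgr : ∀ g, i1 (g, d g) = i2 (1, d' (1, g)) := by
    intro g
    have := hA.comm (1, g)
    rwa [j1_ap, j2_ap, map_one, one_mul] at this
  have hAD : ∀ (M : Type) [AddCommGroup M] (n : ℕ) (y : H (triv (A × E) M) n),
     hT (MonoidHom.fst A D') M n (hT j2 M n y) = hT (MonoidHom.fst A E) M n y := by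
    intro M _ n y
    exact hT_comp_eq (fun _ => rfl) _ _
  refine ⟨E', inferInstance, i1.comp (MonoidHom.inl E D), ?_, ?_, ?_, ?_, ?_, ?_⟩
  · exact hA.i1inj.comp fun x y h => (Prod.mk.inj h).1
  · intro a e
    change i1 (c a, 1) * e = e * i1 (c a, 1)
    have := hA.gen (Subgroup.centralizer {i1 (c a, 1)}) (fun x => by
      rw [Subgroup.mem_centralizer_singleton_iff, ← map_mul, ← map_mul]
      congr 1
      exact Prod.ext (hz a x.1).symm (by simp)) (fun x => by
      rw [Subgroup.mem_centralizer_singleton_iff, hc', ← map_mul, ← map_mul]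
      congr 1
      exact Prod.ext (mul_comm _ _) (by simp)) e
    rw [Subgroup.mem_centralizer_singleton_iff] at this
    exact this.symm
  · intro n M _ x
    let gr : E →* E × D := (MonoidHom.id E).prod d
    have e1 : hT (MonoidHom.inl E D) M (n+1) x = hT gr M (n+1) x := by
      apply (hD.acyc.fst_bij E M (n+1)).1
      rw [hT_comp_eq (h := MonoidHom.id E) (fun _ => rfl), hT_comp_eq (h := MonoidHom.id E) (fun _ => rfl)]
    rw [← hT_comp, e1, hT_comp_eq (h := (i2.comp (MonoidHom.inr A D')).comp (d'.comp (MonoidHom.inr A E))) (fun g => hgr g), ← hT_comp,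
      hD'.acyc n M (hT (d'.comp (MonoidHom.inr A E)) M (n+1) x), map_zero]
  · intro hE n M _ z
    have h1D : ∀ x : H (triv (E × D) M) (n+1), x = 0 := fun x =>
      (hD.acyc.fst_bij E M (n+1)).1 ((hE n M _).trans (map_zero _).symm)
    have h2D : ∀ x : H (triv (A × D') M) (n+1), hT i2 M (n+1) x = 0 := by
      intro x
      obtain ⟨y, hy⟩ := (hE.fst_bij A M (n+1)).2 (hT (MonoidHom.fst A D') M (n+1) x)
      rw [← hAD] at hy
      have := (hD'.acyc.fst_bij A M (n+1)).1 hy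
      rw [← this, hT_comp_eq (h := i1.comp j1) (fun x => (hA.comm x).symm), ← hT_comp, h1D (hT j1 M (n+1) y), map_zero]
    obtain ⟨δ, h1, h2, h3⟩ := hA.mv M n
    have hδ : δ z = 0 := by
      cases n with
      | zero => exact hT_zero_bij j1 M 0 rfl ((h1 z).1.trans (map_zero _).symm)
      | succ n =>
        apply (hE.fst_bij A M (n+1)).1
        rw [← hAD, (h1 z).2, map_zero, map_zero]
    obtain ⟨x1, x2, h⟩ := h2 z hδ
    rw [h, h1D x1, h2D x2, map_zero, add_zero]
  · intro z hzz
    obtain ⟨⟨a, x⟩, rfl⟩ := hA.symm.center_mem z hzz (fun f hf => by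
      refine hD'.big (fun x => f (1, x)) fun x y h => ?_
      exact (Prod.mk.inj (hf h)).2)
    refine ⟨a, ?_⟩
    have : x = 1 := hD'.center x fun g => by
      have := hA.i2inj (a₁ := (1, g) * (a, x)) (a₂ := (a, x) * (1, g)) (by rw [map_mul, map_mul, hzz])
      exact (Prod.mk.inj this).2
    rw [this]
    exact hc' a
  · intro hAn n hn
    obtain ⟨g, hg⟩ := hD.tors n hn
    let k : D →* E' := i1.comp (MonoidHom.inr E D)
    have hk : Function.Injective k := hA.i1inj.comp fun x y h => (Prod.mk.inj h).2
    refine ⟨k g, by rw [orderOf_injective k hk, hg], ?_⟩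
    have hg1 : g ≠ 1 := by
      rintro rfl; rw [orderOf_one] at hg; omega
    set N := Subgroup.normalClosure {k g} with hN
    have h1 : ∀ x, i1 (1, x) ∈ N := ncl_map k g (hD.simple g hg1) N (Subgroup.subset_normalClosure rfl)
    obtain ⟨a, ha⟩ := exists_ne (1 : A)
    let u : D' := d' (1, c a⁻¹)
    have hu : u ≠ 1 := by
      intro h
      have := hD'.inj (h.trans (map_one d').symm)
      have := (Prod.mk.inj this).2
      exact ha (inv_eq_one.1 (hc (this.trans (map_one c).symm)))
    have hau : i2 (a, u) ∈ N := by
      have := hA.comm (a, c a⁻¹)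
      rw [j1_ap, j2_ap, ← map_mul, mul_inv_cancel, map_one] at this
      change i2 (a, d' (1, c a⁻¹)) ∈ N
      rw [← this]; exact h1 _
    clear_value u
    obtain ⟨y, hy⟩ : ∃ y, y * u ≠ u * y := by
      by_contra h
      push Not at h
      exact hu (hD'.center u h)
    have hv : y * u * y⁻¹ * u⁻¹ ≠ 1 := by
      intro h
      apply hy
      rw [mul_inv_eq_one, mul_inv_eq_iff_eq_mul] at h
      exact h
    have h2 : ∀ x, i2 (1, x) ∈ N := ncl_map (i2.comp (MonoidHom.inr A D')) _ (hD'.simple _ hv) N (by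
      have e : (i2.comp (MonoidHom.inr A D')) (y * u * y⁻¹ * u⁻¹) = i2 (1, y) * i2 (a, u) * (i2 (1, y))⁻¹ * (i2 (a, u))⁻¹ := by
        rw [← map_inv, ← map_inv, ← map_mul, ← map_mul, ← map_mul, MonoidHom.comp_apply]
        congr 1
        exact Prod.ext (by simp) (by simp)
      rw [e]
      exact N.mul_mem (Subgroup.Normal.conj_mem inferInstance _ hau _) (N.inv_mem hau))
    have h3 : ∀ e, i1 (e, 1) ∈ N := by
      intro e
      have := N.mul_mem ((hgr e).symm ▸ h2 (d' (1, e)) : i1 (e, d e) ∈ N) (N.inv_mem (h1 (d e)))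
      rw [← map_inv, ← map_mul] at this
      convert this using 2
      exact Prod.ext (by simp) (by simp)
    rw [eq_top_iff]
    refine fun x _ => hA.gen N (fun p => ?_) (fun p => ?_) x
    · have := N.mul_mem (h3 p.1) (h1 p.2)
      rw [← map_mul] at this
      convert this using 2
      exact Prod.ext (by simp) (by simp)
    · have := N.mul_mem (h3 (c p.1)) (h2 p.2)
      rw [hc', ← map_mul] at this
      convert this using 2
      exact Prod.ext (by simp) (by simp)

structure CB (A : Type) [CommGroup A] where
  E : Type
  [grp : Group E]
  c : A →* E
  inj : Function.Injective c
  cen : ∀ a e, c a * e = e * c a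

attribute [instance] CB.grp

theorem CB.ex {A : Type} [CommGroup A] (b : CB A) : ∃ (b' : CB A) (φ : b.E →* b'.E), CStep b.c φ ∧ ∀ a, φ (b.c a) = b'.c a := by
  obtain ⟨E', _, φ, h⟩ := exists_cstep b.c b.inj b.cen
  exact ⟨⟨E', φ.comp b.c, h.inj.comp b.inj, h.cen⟩, φ, h, fun _ => rfl⟩

noncomputable def cbs (A : Type) [CommGroup A] : ℕ → CB A
  | 0 => ⟨A, MonoidHom.id A, fun _ _ h => h, fun a e => mul_comm a e⟩
  | n+1 => (CB.ex (cbs A n)).choose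

noncomputable def cbφ (A : Type) [CommGroup A] (n : ℕ) : (cbs A n).E →* (cbs A (n+1)).E := (CB.ex (cbs A n)).choose_spec.choose

lemma cbφ_step (A : Type) [CommGroup A] (n : ℕ) : CStep (cbs A n).c (cbφ A n) := (CB.ex (cbs A n)).choose_spec.choose_spec.1
lemma cbφ_c (A : Type) [CommGroup A] (n : ℕ) (a : A) : cbφ A n ((cbs A n).c a) = (cbs A (n+1)).c a :=
  (CB.ex (cbs A n)).choose_spec.choose_spec.2 a

/-- an acyclic group with prescribed nontrivial centre -/
theorem exists_E (A : Type) [CommGroup A] [Nontrivial A] : ∃ (E : Type) (_ : Group E) (c : A →* E), Function.Injective c ∧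
    Acyc E ∧ (∀ a e, c a * e = e * c a) ∧ (∀ z : E, (∀ g, g * z = z * g) → ∃ a, c a = z) ∧
    (∀ n : ℕ, 2 ≤ n → ∃ g : E, orderOf g = n ∧ Subgroup.normalClosure {g} = ⊤) := by
  obtain ⟨L, _, ι, h1, h2, h3⟩ := exists_lim (cbφ A) (fun n => (cbφ_step A n).inj)
  have hs : ∀ n x, ι (n+1) (cbφ A n x) = ι n x := by
    intro n x
    have := h2 n (n+1) (by omega) x
    rwa [sh_succ _ le_rfl, sh_self] at this
  have ha : Acyc L := by
    refine lim_acyc ι h1 h2 h3 fun m n => ⟨n+1, by omega, ?_⟩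
    have e : sh (cbφ A) n (n+1) = cbφ A n := by
      ext1 x; rw [sh_succ _ le_rfl, sh_self]
    rw [e]; exact (cbφ_step A n).qz m
  let c : A →* L := (ι 0).comp (cbs A 0).c
  have hc : ∀ n a, c a = ι n ((cbs A n).c a) := by
    intro n a
    induction n with
    | zero => rfl
    | succ n ih => rw [ih, ← cbφ_c, hs]
  have hcen : ∀ a e, c a * e = e * c a := by
    intro a e
    obtain ⟨n, x, rfl⟩ := h3 e
    rw [hc n, ← map_mul, ← map_mul, (cbs A n).cen]
  have hinj : Function.Injective c := (h1 0).comp (cbs A 0).inj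
  obtain ⟨E, _, φ, hE⟩ := exists_cstep c hinj hcen
  exact ⟨E, inferInstance, φ.comp c, hE.inj.comp hinj, hE.acyc ha, hE.cen, hE.center, hE.stg inferInstance⟩

end HG

namespace HG
section
open groupHomology
variable {G K : Type} [Group G] [Group K] (f : G →* K)
instance (M : Type) [AddCommGroup M] : (triv G M).IsTrivial := ⟨fun _ => rfl⟩
noncomputable def h1 (G : Type) [Group G] : H (triv G ℤ) 1 ≃+ Additive (Abelianization G) :=
  (H1AddEquivOfIsTrivial (Rep.of (triv G ℤ))).trans (TensorProduct.rid ℤ (Additive (Abelianization G))).toAddEquiv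

lemma h1_symm (g : G) : (h1 G).symm (Additive.ofMul (Abelianization.of g)) = H1π (Rep.of (triv G ℤ)) ((cycles₁IsoOfIsTrivial (Rep.of (triv G ℤ))).inv (Finsupp.single g (1:ℤ))) := by
  refine (AddEquiv.symm_apply_eq _).2 ?_
  refine Eq.symm ((congrArg (TensorProduct.rid ℤ (Additive (Abelianization G))) (H1AddEquivOfIsTrivial_single (A := Rep.of (triv G ℤ)) g (1:ℤ))).trans ?_)
  exact (TensorProduct.rid_tmul _ _).trans (one_smul _ _)
lemma h1_nat (x : H (triv G ℤ) 1) : h1 K (hT f ℤ 1 x) = Additive.ofMul (Abelianization.map f (h1 G x).toMul) := by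
  obtain ⟨y, rfl⟩ := (h1 G).symm.surjective x
  obtain ⟨g, rfl⟩ := QuotientGroup.mk_surjective y
  change h1 K (hT f ℤ 1 ((h1 G).symm (Additive.ofMul (Abelianization.of g)))) = Additive.ofMul (Abelianization.map f (h1 G ((h1 G).symm (Additive.ofMul (Abelianization.of g)))).toMul)
  rw [AddEquiv.apply_symm_apply, toMul_ofMul, Abelianization.map_of, ← AddEquiv.eq_symm_apply, h1_symm, h1_symm]
  have := H1π_comp_map_apply (A := Rep.of (triv G ℤ)) (B := Rep.of (triv K ℤ)) f (Rep.ofHom ⟨LinearMap.id, fun g => rfl⟩) ((cycles₁IsoOfIsTrivial (Rep.of (triv G ℤ))).inv (Finsupp.single g (1:ℤ)))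
  refine this.trans ?_
  congr 1
  apply Subtype.ext
  change chainsMap₁ (A := Rep.of (triv G ℤ)) (B := Rep.of (triv K ℤ)) f (Rep.ofHom ⟨LinearMap.id, fun g => rfl⟩) (Finsupp.single g (1:ℤ)) = Finsupp.single (f g) (1:ℤ)
  simp
end

section
variable {X : Type}

lemma free_der {V : Type} [AddCommGroup V] (ρ : Representation ℤ (FreeGroup X) V) (e : X → V) :
    ∃ d : FreeGroup X → V, (∀ g h, d (g * h) = d g + ρ g (d h)) ∧ ∀ x, d (FreeGroup.of x) = e x := by
  let φ : FreeGroup X →* MulAut (Multiplicative V) :=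
    { toFun := fun g =>
        { toFun := fun v => Multiplicative.ofAdd (ρ g v.toAdd)
          invFun := fun v => Multiplicative.ofAdd (ρ g⁻¹ v.toAdd)
          left_inv := fun v => by simp
          right_inv := fun v => by simp
          map_mul' := fun v w => by simp }
      map_one' := by ext v; simp
      map_mul' := fun g h => by ext v; simp }
  let F : FreeGroup X →* Multiplicative V ⋊[φ] FreeGroup X := FreeGroup.lift (fun x => ⟨Multiplicative.ofAdd (e x), FreeGroup.of x⟩)
  have hr : ∀ g, (F g).right = g := by
    intro g
    have : SemidirectProduct.rightHom.comp F = MonoidHom.id _ := by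
      ext x; simp [F]
    exact congrArg (fun f => f g) this
  refine ⟨fun g => (F g).left.toAdd, fun g h => ?_, fun x => by simp [F]⟩
  dsimp only
  rw [map_mul, SemidirectProduct.mul_left, hr]
  rfl

def actL (G : Type) [Group G] : G →* Equiv.Perm G := MulAction.toPermHom G G

def actLX (G X : Type) [Group G] : G →* Equiv.Perm (G × X) where
  toFun g := Equiv.prodCongr (actL G g) (Equiv.refl X)
  map_one' := by ext p <;> simp [actL]
  map_mul' g h := by ext p <;> simp [actL, mul_assoc]

noncomputable def freeα (X M : Type) [AddCommGroup M] : ((FreeGroup X × X) →₀ M) →ₗ[ℤ] (FreeGroup X →₀ M) :=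
  Finsupp.lsum ℤ fun p => Finsupp.lsingle (p.1 * FreeGroup.of p.2) - Finsupp.lsingle p.1

@[simp] lemma freeα_single (M : Type) [AddCommGroup M] (p : FreeGroup X × X) (m : M) :
   freeα X M (Finsupp.single p m) = Finsupp.single (p.1 * FreeGroup.of p.2) m - Finsupp.single p.1 m := by
  simp [freeα]

lemma free_ses (X M : Type) [AddCommGroup M] : SES (permRep (actLX (FreeGroup X) X) (triv (FreeGroup X) M))
    (permRep (actL (FreeGroup X)) (triv (FreeGroup X) M)) (triv (FreeGroup X) M) (freeα X M) (aug _ M) where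
  eα := Eqv.of_single fun g p m => by simp [actLX, actL, mul_assoc]
  eβ := Eqv.aug _ _
  inj := by
    rw [injective_iff_map_eq_zero]
    intro w hw
    let V := M →ₗ[ℤ] ((FreeGroup X × X) →₀ M)
    let τ := permRep (actLX (FreeGroup X) X) (triv (FreeGroup X) M)
    let ρ : Representation ℤ (FreeGroup X) V :=
      { toFun := fun g => LinearMap.llcomp ℤ M _ _ (τ g)
        map_one' := by rw [map_one]; rfl
        map_mul' := fun g h => by rw [map_mul]; rfl }
    obtain ⟨d, hd, hx⟩ := free_der ρ (fun x => Finsupp.lsingle (1, x))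
    have key : (Finsupp.lsum ℤ d) ∘ₗ freeα X M = LinearMap.id := by
      refine Finsupp.lhom_ext fun p m => ?_
      rw [LinearMap.comp_apply, freeα_single, map_sub, Finsupp.lsum_single, Finsupp.lsum_single, hd, hx, LinearMap.add_apply,
        add_sub_cancel_left]
      change τ p.1 (Finsupp.single (1, p.2) m) = _
      simp [τ, actLX, actL]
    have := congrArg (fun L => L w) key
    rw [LinearMap.comp_apply, hw, map_zero] at this
    exact this.symm
  surj := aug_surj 1
  zero := by
    intro w
    have : aug _ M ∘ₗ freeα X M = 0 := Finsupp.lhom_ext fun p m => by simp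
    exact congrArg (fun L => L w) this
  ex := by
    let R := LinearMap.range (freeα X M)
    let S : Subgroup (FreeGroup X) :=
      { carrier := {w | ∀ g m, Finsupp.single (g * w) m - Finsupp.single g m ∈ R}
        one_mem' := fun g m => by simp
        mul_mem' := fun {a b} ha hb g m => by
          have := R.add_mem (hb (g * a) m) (ha g m)
          rwa [sub_add_sub_cancel, mul_assoc] at this
        inv_mem' := fun {a} ha g m => by
          have := R.neg_mem (ha (g * a⁻¹) m)
          rwa [inv_mul_cancel_right, neg_sub] at this }
    have hS : ∀ w, w ∈ S := by
      intro w
      have : Subgroup.closure (Set.range (FreeGroup.of (α := X))) ≤ S := by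
        rw [Subgroup.closure_le]
        rintro _ ⟨x, rfl⟩ g m
        exact ⟨Finsupp.single (g, x) m, by simp⟩
      rw [FreeGroup.closure_range_of] at this
      exact this (Subgroup.mem_top w)
    have h2 : ∀ y : FreeGroup X →₀ M, y - Finsupp.single 1 (aug _ M y) ∈ R := by
      intro y
      induction y using Finsupp.induction_linear with
      | zero => simp
      | add x y hx hy =>
        have := R.add_mem hx hy
        rwa [← add_sub_add_comm, ← Finsupp.single_add, ← map_add] at this
      | single w m =>
        have := hS w 1 m
        rw [one_mul] at this
        simpa using this
    intro y hy
    have := h2 y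
    rw [hy, Finsupp.single_zero, sub_zero] at this
    exact this

theorem free_van (X : Type) (n : ℕ) : Van (FreeGroup X) (n+2) := by
  intro M _ z
  have h0 : (free_ses X M).δ (n+1) z = 0 := V _ (fun p => p.1) (fun g p => rfl) _ _ _
  obtain ⟨y, rfl⟩ := (free_ses X M).ex₃ _ _ h0
  rw [V (actL (FreeGroup X)) (fun p => p) (fun g p => rfl) _ _ y, map_zero]
end

/-- subgroups of free abelian groups are free -/
theorem free_sub (X : Type) (R : Submodule ℤ (X →₀ ℤ)) : ∃ (J : Type) (Φ : (J →₀ ℤ) →ₗ[ℤ] (X →₀ ℤ)),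
    Function.Injective Φ ∧ LinearMap.range Φ = R := by
  classical
  obtain ⟨_, hwf⟩ := exists_wellFoundedLT X
  let Rx : X → Submodule ℤ (X →₀ ℤ) := fun x => R ⊓ Finsupp.supported ℤ ℤ (Set.Iic x)
  have hI : ∀ x, ∃ r ∈ Rx x, ∀ s ∈ Rx x, ∃ k : ℤ, s x = k * r x := by
    intro x
    let I : Ideal ℤ := (Rx x).map (Finsupp.lapply x)
    obtain ⟨a, ha⟩ := (IsPrincipalIdealRing.principal I).principal
    have : a ∈ I := by rw [ha]; exact Submodule.mem_span_singleton_self a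
    obtain ⟨r, hr, hra⟩ := this
    refine ⟨r, hr, fun s hs => ?_⟩
    have : s x ∈ I := ⟨s, hs, rfl⟩
    rw [ha, Submodule.mem_span_singleton] at this
    obtain ⟨k, hk⟩ := this
    refine ⟨k, ?_⟩
    rw [← hk, ← hra]; rfl
  choose r hr hgen using hI
  let J := {x // r x x ≠ 0}
  let Φ : (J →₀ ℤ) →ₗ[ℤ] (X →₀ ℤ) := Finsupp.linearCombination ℤ (fun j : J => r j.1)
  have hlt : ∀ x y, x < y → r x y = 0 := by
    intro x y h
    by_contra hne
    have := (hr x).2 (Finsupp.mem_support_iff.2 hne)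
    exact absurd this (not_le.2 h)
  refine ⟨J, Φ, ?_, le_antisymm ?_ ?_⟩
  · rw [injective_iff_map_eq_zero]
    intro c hc
    by_contra hne
    have hs := Finsupp.support_nonempty_iff.2 hne
    let j := c.support.max' hs
    have h1 : Φ c j.1 = c j * r j.1 j.1 := by
      simp only [Φ, Finsupp.linearCombination_apply, Finsupp.sum, Finsupp.finsetSum_apply, Finsupp.smul_apply, smul_eq_mul]
      refine Finset.sum_eq_single j (fun i hi hij => ?_) (fun h => ?_)
      · rw [hlt i.1 j.1, mul_zero]
        exact lt_of_le_of_ne (c.support.le_max' i hi) (fun h => hij (Subtype.ext h))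
      · rw [Finsupp.notMem_support_iff.1 h, zero_mul]
    rw [hc] at h1
    have := mul_ne_zero (Finsupp.mem_support_iff.1 (c.support.max'_mem hs)) j.2
    exact this h1.symm
  · rintro _ ⟨c, rfl⟩
    rw [show Φ c = c.sum fun j a => a • r j.1 from Finsupp.linearCombination_apply _ _]
    exact Submodule.sum_mem _ fun j _ => R.smul_mem _ (hr j.1).1
  · have key : ∀ x, ∀ s ∈ Rx x, s ∈ LinearMap.range Φ := by
      intro x
      induction x using WellFoundedLT.induction with
      | ind x ih =>
        intro s hs
        obtain ⟨k, hk⟩ := hgen x s hs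
        have hmem : k • r x ∈ LinearMap.range Φ := by
          by_cases h : r x x = 0
          · have : k • r x ∈ Rx x := (Rx x).smul_mem _ (hr x)
            by_cases h0 : r x = 0
            · rw [h0, smul_zero]; exact Submodule.zero_mem _
            have hs' := Finsupp.support_nonempty_iff.2 h0
            let y := (r x).support.max' hs'
            have hy := (r x).support.max'_mem hs'
            have hyx : y < x := lt_of_le_of_ne ((hr x).2 hy) (by
              intro e
              have h5 := Finsupp.mem_support_iff.1 hy
              change r x y ≠ 0 at h5
              rw [e] at h5
              exact h5 h)
            apply Submodule.smul_mem
            exact ih y hyx _ ⟨(hr x).1, fun z hz => (r x).support.le_max' z hz⟩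
          · exact ⟨Finsupp.single ⟨x, h⟩ k, by simp [Φ]⟩
        have ht : s - k • r x ∈ LinearMap.range Φ := by
          set t := s - k • r x with htd
          have htR : t ∈ Rx x := (Rx x).sub_mem hs ((Rx x).smul_mem _ (hr x))
          have htx : t x = 0 := by simp [htd, hk]
          by_cases h0 : t = 0
          · rw [h0]; exact Submodule.zero_mem _
          have hs' := Finsupp.support_nonempty_iff.2 h0
          let y := t.support.max' hs'
          have hy := t.support.max'_mem hs'
          have hyx : y < x := lt_of_le_of_ne (htR.2 hy) (by
            intro e
            have h5 := Finsupp.mem_support_iff.1 hy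
            change t y ≠ 0 at h5
            rw [e] at h5
            exact h5 htx)
          exact ih y hyx _ ⟨htR.1, fun z hz => t.support.le_max' z hz⟩
        have := Submodule.add_mem _ ht hmem
        rwa [sub_add_cancel] at this
    intro s hs
    by_cases h0 : s = 0
    · rw [h0]; exact Submodule.zero_mem _
    have hs' := Finsupp.support_nonempty_iff.2 h0
    exact key (s.support.max' hs') s ⟨hs, fun z hz => s.support.le_max' z hz⟩

end HG

namespace HG

lemma equiv_of_ker {P Q R : Type} [AddCommGroup P] [AddCommGroup Q] [AddCommGroup R] (p : P →+ Q) (q : P →+ R)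
    (hp : Function.Surjective p) (hq : Function.Surjective q) (h : ∀ x, p x = 0 ↔ q x = 0) : Nonempty (Q ≃+ R) := by
  have e : p.ker = q.ker := by ext x; exact h x
  exact ⟨(QuotientAddGroup.quotientKerEquivOfSurjective p hp).symm.trans
    ((QuotientAddGroup.quotientAddEquivOfEq e).trans (QuotientAddGroup.quotientKerEquivOfSurjective q hq))⟩

noncomputable def ψ (X : Type) : H (triv (FreeGroup X) ℤ) 1 ≃+ (X →₀ ℤ) := (h1 (FreeGroup X)).trans (FreeAbelianGroup.equivFinsupp X)

lemma ψ_nat {X Y : Type} (f : FreeGroup X →* FreeGroup Y) (Φ : (X →₀ ℤ) →ₗ[ℤ] (Y →₀ ℤ))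
   (h : ∀ x, FreeAbelianGroup.equivFinsupp Y (Additive.ofMul (Abelianization.of (f (FreeGroup.of x)))) = Φ (Finsupp.single x 1))
   (x : H (triv (FreeGroup X) ℤ) 1) : ψ Y (hT f ℤ 1 x) = Φ (ψ X x) := by
  have key : ∀ y : FreeAbelianGroup X, FreeAbelianGroup.equivFinsupp Y ((Abelianization.map f).toAdditive y)
      = Φ (FreeAbelianGroup.equivFinsupp X y) := by
    intro y
    have : (FreeAbelianGroup.equivFinsupp Y).toAddMonoidHom.comp (Abelianization.map f).toAdditive
      = Φ.toAddMonoidHom.comp (FreeAbelianGroup.equivFinsupp X).toAddMonoidHom := by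
      refine FreeAbelianGroup.lift_ext _ _ fun x => ?_
      refine (h x).trans ?_
      refine congrArg Φ ?_
      exact (FreeAbelianGroup.toFinsupp_of x).symm
    exact congrArg (fun L => L y) this
  refine Eq.trans ?_ (key (h1 _ x))
  exact congrArg (FreeAbelianGroup.equivFinsupp Y) (h1_nat f x)

/-- a group with prescribed first homology and vanishing second homology -/
theorem exists_B (B : Type) [AddCommGroup B] : ∃ (G : Type) (_ : Group G), Nonempty (H (triv G ℤ) 1 ≃+ B) ∧
    ∀ z : H (triv G ℤ) 2, z = 0 := by
  let π : (B →₀ ℤ) →ₗ[ℤ] B := Finsupp.linearCombination ℤ (fun b : B => b)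
  obtain ⟨J, Φ, hΦ, hR⟩ := free_sub B (LinearMap.ker π)
  have hw : ∀ j, ∃ w : FreeGroup B, FreeAbelianGroup.equivFinsupp B (Additive.ofMul (Abelianization.of w)) = Φ (Finsupp.single j 1) := by
    intro j
    obtain ⟨y, hy⟩ := (FreeAbelianGroup.equivFinsupp B).surjective (Φ (Finsupp.single j 1))
    obtain ⟨w, hw⟩ := QuotientGroup.mk_surjective (Additive.toMul y)
    exact ⟨w, by rw [← hy]; exact congrArg (FreeAbelianGroup.equivFinsupp B) hw⟩
  choose w hw using hw
  let f : FreeGroup J →* FreeGroup B := FreeGroup.lift w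
  have hf : ∀ x, ψ B (hT f ℤ 1 x) = Φ (ψ J x) := ψ_nat f Φ fun j => by
    rw [← hw]; simp [f]
  obtain ⟨D, _, d, hD⟩ := exists_D (FreeGroup J)
  let j1 : FreeGroup J →* FreeGroup B × D := f.prod d
  have hj1 : Function.Injective j1 := fun x y h => hD.inj (Prod.mk.inj h).2
  obtain ⟨G, _, i1, i2, hA⟩ := exists_amal j1 d hj1 hD.inj
  have ffst : ∀ n (y : H (triv (FreeGroup J) ℤ) n), hT (MonoidHom.fst (FreeGroup B) D) ℤ n (hT j1 ℤ n y) = hT f ℤ n y := by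
    intro n y
    exact hT_comp_eq (fun _ => rfl) _ _
  have finl : ∀ n (x : H (triv (FreeGroup B) ℤ) n), hT (MonoidHom.fst (FreeGroup B) D) ℤ n (hT (MonoidHom.inl (FreeGroup B) D) ℤ n x) = x := by
    intro n y
    exact hT_retract (fun _ => rfl) _ _
  refine ⟨G, inferInstance, ?_, ?_⟩
  · let p : H (triv (FreeGroup B) ℤ) 1 →+ H (triv G ℤ) 1 := (hT i1 ℤ 1).comp (hT (MonoidHom.inl (FreeGroup B) D) ℤ 1)
    let q : H (triv (FreeGroup B) ℤ) 1 →+ B := π.toAddMonoidHom.comp (ψ B).toAddMonoidHom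
    refine equiv_of_ker p q ?_ ?_ ?_
    · intro z
      obtain ⟨δ, h1, h2, h3⟩ := hA.mv ℤ 0
      obtain ⟨x1, x2, h⟩ := h2 z (hT_zero_bij d ℤ 0 rfl ((h1 z).2.trans (map_zero _).symm))
      refine ⟨hT (MonoidHom.fst (FreeGroup B) D) ℤ 1 x1, ?_⟩
      rw [h, hD.acyc 0 ℤ x2, map_zero, add_zero]
      change hT i1 ℤ 1 _ = _
      congr 1
      apply (hD.acyc.fst_bij (FreeGroup B) ℤ 1).1
      rw [finl]
    · intro b
      refine ⟨(ψ B).symm (Finsupp.single b 1), ?_⟩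
      change π (ψ B ((ψ B).symm (Finsupp.single b 1))) = b
      rw [AddEquiv.apply_symm_apply]; simp [π]
    · intro x
      have hq : q x = 0 ↔ ∃ y, hT f ℤ 1 y = x := by
        have : q x = 0 ↔ ψ B x ∈ LinearMap.ker π := Iff.rfl
        rw [this, ← hR]
        constructor
        · rintro ⟨c, hc⟩
          refine ⟨(ψ J).symm c, (ψ B).injective ?_⟩
          rw [hf, AddEquiv.apply_symm_apply, hc]
        · rintro ⟨y, rfl⟩
          exact ⟨_, (hf y).symm⟩
      rw [hq]
      constructor
      · intro hx
        obtain ⟨y, hy, -⟩ := hA.mv_mid ℤ 1 (hT (MonoidHom.inl (FreeGroup B) D) ℤ 1 x) 0 (by rw [map_zero, add_zero]; exact hx)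
        refine ⟨y, ?_⟩
        rw [← ffst, hy, finl]
      · rintro ⟨y, rfl⟩
        have : hT (MonoidHom.inl (FreeGroup B) D) ℤ 1 (hT f ℤ 1 y) = hT j1 ℤ 1 y := by
          apply (hD.acyc.fst_bij (FreeGroup B) ℤ 1).1
          rw [finl, ffst]
        change hT i1 ℤ 1 (hT (MonoidHom.inl (FreeGroup B) D) ℤ 1 (hT f ℤ 1 y)) = 0
        rw [this, hT_comp_eq (h := i2.comp d) (fun x => hA.comm x), ← hT_comp, hD.acyc 0 ℤ (hT d ℤ 1 y), map_zero]
  · intro z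
    obtain ⟨δ, h1, h2, h3⟩ := hA.mv ℤ 1
    have h0 : δ z = 0 := by
      apply (ψ J).injective
      apply hΦ
      rw [← hf, ← ffst, (h1 z).1]
      simp
    obtain ⟨x1, x2, h⟩ := h2 z h0
    have e : x1 = 0 := (hD.acyc.fst_bij (FreeGroup B) ℤ 2).1 (by rw [map_zero]; exact free_van B 0 ℤ _)
    rw [h, hD.acyc 1 ℤ x2, e, map_zero, map_zero, add_zero]

/-- a surjection of the homology onto the integers -/
def Zs (G : Type) [Group G] (n : ℕ) : Prop := ∃ s : H (triv G ℤ) n →+ ℤ, Function.Surjective s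

lemma Zs.of_retract {G L : Type} [Group G] [Group L] (r : G →* L) (i : L →* G) (e : ∀ x, r (i x) = x) {n : ℕ} (h : Zs L n) : Zs G n := by
  obtain ⟨s, hs⟩ := h
  exact ⟨s.comp (hT r ℤ n), hs.comp fun x => ⟨hT i ℤ n x, hT_retract e n x⟩⟩

lemma Zs.susp {W S : Type} [Group W] [Group S] (h : IsSusp W S) {n : ℕ} (hz : Zs W (n+1)) : Zs S (n+2) := by
  obtain ⟨s, hs⟩ := hz
  obtain ⟨e⟩ := h.iso ℤ n
  exact ⟨s.comp e.toAddMonoidHom, hs.comp e.surjective⟩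

lemma IsSusp.nontrivial {W S : Type} [Group W] [Group S] (h : IsSusp W S) : Nontrivial S := by
  obtain ⟨g, hg, -⟩ := h.stg 2 le_rfl
  refine ⟨g, 1, ?_⟩
  rintro rfl
  rw [orderOf_one] at hg
  omega

noncomputable def h1c (C : Type) [AddCommGroup C] : H (triv (Multiplicative C) ℤ) 1 ≃+ C :=
  (h1 (Multiplicative C)).trans ((MulEquiv.toAdditive (Abelianization.equivOfComm (H := Multiplicative C)).symm).trans
    (AddEquiv.additiveMultiplicative C))

structure ZB (n : ℕ) where
  E : Type
  [grp : Group E]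
  [nt : Nontrivial E]
  zs : Zs E (n+1)

attribute [instance] ZB.grp ZB.nt

theorem ZB.ex (n : ℕ) (b : ZB n) : Nonempty (ZB (n+1)) := by
  obtain ⟨S, _, hS⟩ := exists_susp b.E
  haveI := hS.nontrivial
  exact ⟨⟨S, b.zs.susp hS⟩⟩

noncomputable def zbs : ∀ n, ZB n
  | 0 => ⟨Multiplicative ℤ, (h1c ℤ).toAddMonoidHom, (h1c ℤ).surjective⟩
  | n+1 => (ZB.ex n (zbs n)).some

theorem exists_L : ∃ (L : Type) (_ : Group L), Nontrivial L ∧ ∀ n, Zs L (n+1) := by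
  classical
  refine ⟨∀ n, (zbs n).E, inferInstance, inferInstance, fun n => ?_⟩
  exact Zs.of_retract (Pi.evalMonoidHom _ n) (MonoidHom.mulSingle (fun i => (zbs i).E) n) (fun x => by simp) (zbs n).zs

lemma fst_equiv {G K : Type} [Group G] [Group K] (h : Van K 1) : Nonempty (H (triv (G × K) ℤ) 1 ≃+ H (triv G ℤ) 1) := by
  refine ⟨AddEquiv.ofBijective (hT (MonoidHom.fst G K) ℤ 1) ⟨?_, fun x => ⟨hT (MonoidHom.inl G K) ℤ 1 x, hT_retract (fun _ => rfl) _ _⟩⟩⟩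
  rw [injective_iff_map_eq_zero]
  intro z hz
  exact prod_inj (PA_zero _) z hz (h ℤ _)

theorem exists_T (B C : Type) [AddCommGroup B] [AddCommGroup C] : ∃ (T : Type) (_ : Group T),
   (∀ n : ℕ, 2 ≤ n → ∃ g : T, orderOf g = n ∧ Subgroup.normalClosure {g} = ⊤) ∧
   (∀ z : T, (∀ g, g * z = z * g) → z = 1) ∧ Van T 1 ∧
   Nonempty (H (triv T ℤ) 2 ≃+ B) ∧ Nonempty (H (triv T ℤ) 3 ≃+ C) ∧ ∀ n, Zs T (n+4) := by
  obtain ⟨L, _, _, hL⟩ := exists_L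
  obtain ⟨SL, _, hSL⟩ := exists_susp L
  haveI := hSL.nontrivial
  obtain ⟨K, _, hK⟩ := exists_susp (Multiplicative C × SL)
  haveI := hK.nontrivial
  obtain ⟨G, _, ⟨eB⟩, hG2⟩ := exists_B B
  obtain ⟨T, _, hT'⟩ := exists_susp (G × K)
  refine ⟨T, inferInstance, hT'.stg, hT'.cen, hT'.van, ?_, ?_, ?_⟩
  · obtain ⟨e1⟩ := hT'.iso ℤ 0
    obtain ⟨e2⟩ := fst_equiv (G := G) hK.van
    exact ⟨e1.trans (e2.trans eB)⟩
  · obtain ⟨e1⟩ := hT'.iso ℤ 1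
    have e2 : H (triv (G × K) ℤ) 2 ≃+ H (triv K ℤ) 2 := by
      refine AddEquiv.ofBijective (hT (MonoidHom.snd G K) ℤ 2) ⟨?_, fun x => ⟨hT (MonoidHom.inr G K) ℤ 2 x, hT_retract (fun _ => rfl) _ _⟩⟩
      rw [injective_iff_map_eq_zero]
      intro z hz
      refine prod_inj (PA_of_van 1 fun i hi => ?_) z (hG2 _) hz
      obtain rfl : i = 0 := by omega
      exact hK.van
    obtain ⟨e3⟩ := hK.iso ℤ 0
    obtain ⟨e4⟩ := fst_equiv (G := Multiplicative C) hSL.van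
    exact ⟨e1.trans (e2.trans (e3.trans (e4.trans (h1c C))))⟩
  · intro n
    have z1 : Zs SL (n+2) := (hL n).susp hSL
    have z2 : Zs (Multiplicative C × SL) (n+2) := z1.of_retract (MonoidHom.snd _ _) (MonoidHom.inr _ _) (fun _ => rfl)
    have z3 : Zs K (n+3) := z2.susp hK
    have z4 : Zs (G × K) (n+3) := z3.of_retract (MonoidHom.snd _ _) (MonoidHom.inr _ _) (fun _ => rfl)
    exact z4.susp hT'

end HG

namespace HG

section stg
lemma perfect_of_stg {T : Type} [Group T] (h : ∀ n, 2 ≤ n → ∃ g : T, orderOf g = n ∧ Subgroup.normalClosure {g} = ⊤) :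
    commutator T = ⊤ := by
  have key : ∀ n, 2 ≤ n → ∀ y : T, (Abelianization.of y)^n = 1 := by
    intro n hn y
    obtain ⟨t, ht, htt⟩ := h n hn
    have := ncl_map ((powMonoidHom n).comp (Abelianization.of (G := T))) t htt (⊥ : Subgroup (Abelianization T)) (by
      rw [Subgroup.mem_bot]
      change (Abelianization.of t)^n = 1
      rw [← map_pow, ← ht, pow_orderOf_eq_one, map_one]) y
    exact Subgroup.mem_bot.1 this
  rw [← Abelianization.ker_of, eq_top_iff]
  intro y _
  rw [MonoidHom.mem_ker]
  have h2 := key 2 le_rfl y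
  have h3 := key 3 (by norm_num) y
  rw [pow_succ, h2, one_mul] at h3
  exact h3

lemma gen_mem {T G : Type} [Group T] [Group G] (ι : T →* G) (g : G) (N : Subgroup G) [hN : N.Normal] (hg : g ∈ N) (t : T)
    (hc : ∀ x, ι x * g * (ι x)⁻¹ * g⁻¹ = ι (x * t * x⁻¹ * t⁻¹)) (ht : Subgroup.normalClosure {t} = ⊤)
    (hp : commutator T = ⊤) (y : T) : ι y ∈ N := by
  have h1 := ncl_map (QuotientGroup.mk' (N.comap ι)) t ht (Subgroup.center _) (by
    rw [Subgroup.mem_center_iff]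
    intro x
    obtain ⟨x, rfl⟩ := QuotientGroup.mk'_surjective _ x
    rw [← map_mul, ← map_mul]
    refine (QuotientGroup.eq_iff_div_mem).2 ?_
    rw [Subgroup.mem_comap]
    have : x * t / (t * x) = x * t * x⁻¹ * t⁻¹ := by rw [div_eq_mul_inv, mul_inv_rev]; simp only [mul_assoc]
    rw [this, ← hc]
    exact N.mul_mem (hN.conj_mem g hg _) (N.inv_mem hg))
  have h2 : commutator T ≤ N.comap ι := by
    rw [commutator_def, Subgroup.commutator_le]
    intro a _ b _
    have := Subgroup.mem_center_iff.1 (h1 b) (QuotientGroup.mk' (N.comap ι) a)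
    rw [← map_mul, ← map_mul] at this
    have := QuotientGroup.eq_iff_div_mem.1 this
    have e : a * b / (b * a) = a * b * a⁻¹ * b⁻¹ := by rw [div_eq_mul_inv, mul_inv_rev]; simp only [mul_assoc]
    rw [e] at this
    exact this
  exact h2 (hp ▸ Subgroup.mem_top y)

lemma stg_prod {T E : Type} [Group T] [Group E]
    (h : ∀ n, 2 ≤ n → ∃ g : T, orderOf g = n ∧ Subgroup.normalClosure {g} = ⊤)
    (h' : ∀ n, 2 ≤ n → ∃ g : E, orderOf g = n ∧ Subgroup.normalClosure {g} = ⊤) :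
    ∀ n, 2 ≤ n → ∃ g : T × E, orderOf g = n ∧ Subgroup.normalClosure {g} = ⊤ := by
  intro n hn
  obtain ⟨t, ht, ht'⟩ := h n hn
  obtain ⟨e, he, he'⟩ := h' n hn
  refine ⟨(t, e), by rw [Prod.orderOf]; simp [ht, he], ?_⟩
  rw [eq_top_iff]
  rintro ⟨y, z⟩ _
  have hg : (t, e) ∈ Subgroup.normalClosure {(t, e)} := Subgroup.subset_normalClosure rfl
  have a := gen_mem (MonoidHom.inl T E) (t, e) (Subgroup.normalClosure {(t, e)}) hg t (by
    intro x; ext <;> simp) ht' (perfect_of_stg h) y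
  have b := gen_mem (MonoidHom.inr T E) (t, e) (Subgroup.normalClosure {(t, e)}) hg e (by
    intro x; ext <;> simp) he' (perfect_of_stg h') z
  simpa using Subgroup.mul_mem _ a b
end stg

section comparison
variable {G : Type} [Group G]

/-- The group element carried by an arrow of a simplex of the nerve (inverted). -/
def mp {n : ℕ} (F : ComposableArrows (SingleObj G) n) (i j : Fin (n+1)) (h : i ≤ j) : G :=
  (show G from F.map (homOfLE h))⁻¹

lemma mp_self {n : ℕ} (F : ComposableArrows (SingleObj G) n) (i : Fin (n+1)) : mp F i i le_rfl = 1 := by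
  have : F.map (homOfLE (le_refl i)) = 𝟙 _ := F.map_id i
  unfold mp
  rw [this]
  exact inv_one

lemma mp_comp {n : ℕ} (F : ComposableArrows (SingleObj G) n) (i j k : Fin (n+1)) (h : i ≤ j) (h' : j ≤ k) :
    mp F i k (h.trans h') = mp F i j h * mp F j k h' := by
  have : F.map (homOfLE (h.trans h')) = F.map (homOfLE h) ≫ F.map (homOfLE h') := by
    rw [← F.map_comp]; rfl
  unfold mp
  rw [this, ← mul_inv_rev]
  rfl

def ev {n : ℕ} (F : ComposableArrows (SingleObj G) n) (k : Fin n) : G := mp F k.castSucc k.succ (Fin.castSucc_le_succ k)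

lemma mp_zero {n : ℕ} (F : ComposableArrows (SingleObj G) n) (i : Fin (n+1)) :
    mp F 0 i (Fin.zero_le i) = Fin.partialProd (ev F) i := by
  induction i using Fin.induction with
  | zero => rw [mp_self, Fin.partialProd_zero]
  | succ i ih => rw [Fin.partialProd_succ, ← ih, ev, ← mp_comp]

lemma mp_eq {n : ℕ} (F : ComposableArrows (SingleObj G) n) (i j : Fin (n+1)) (h : i ≤ j) :
    mp F i j h = (Fin.partialProd (ev F) i)⁻¹ * Fin.partialProd (ev F) j := by
  rw [← mp_zero, ← mp_zero, mp_comp F 0 i j (Fin.zero_le i) h, inv_mul_cancel_left]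

def mkF {n : ℕ} (g : Fin n → G) : ComposableArrows (SingleObj G) n where
  obj _ := SingleObj.star G
  map {i j} _ := show G from ((Fin.partialProd g i)⁻¹ * Fin.partialProd g j)⁻¹
  map_id i := by
    change ((Fin.partialProd g i)⁻¹ * Fin.partialProd g i)⁻¹ = (1 : G)
    group
  map_comp {i j k} _ _ := by
    change ((Fin.partialProd g i)⁻¹ * Fin.partialProd g k)⁻¹ = ((Fin.partialProd g j)⁻¹ * Fin.partialProd g k)⁻¹ * ((Fin.partialProd g i)⁻¹ * Fin.partialProd g j)⁻¹
    group

lemma ev_mkF {n : ℕ} (g : Fin n → G) : ev (mkF g) = g := by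
  funext k
  change (((Fin.partialProd g k.castSucc)⁻¹ * Fin.partialProd g k.succ)⁻¹)⁻¹ = g k
  rw [inv_inv, Fin.partialProd_right_inv]

lemma mkF_ev {n : ℕ} (F : ComposableArrows (SingleObj G) n) : mkF (ev F) = F := by
  fapply CategoryTheory.Functor.ext
  · intro i; rfl
  · intro i j f
    have := mp_eq F i j (leOfHom f)
    simp only [eqToHom_refl, Category.comp_id, Category.id_comp]
    change ((Fin.partialProd (ev F) i)⁻¹ * Fin.partialProd (ev F) j)⁻¹ = (F.map f : G)
    rw [← this]
    exact inv_inv _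

def evE (n : ℕ) : ComposableArrows (SingleObj G) n ≃ (Fin n → G) := ⟨ev, mkF, mkF_ev, ev_mkF⟩

lemma ev_δ_zero {n : ℕ} (F : ComposableArrows (SingleObj G) (n+1)) :
    ev ((nerve (SingleObj G)).δ 0 F : ComposableArrows (SingleObj G) n) = fun k => ev F k.succ := rfl

lemma mp_δ {n : ℕ} (F : ComposableArrows (SingleObj G) (n+1)) (i : Fin (n+2)) (a b : Fin (n+1)) (h : a ≤ b) :
    mp ((nerve (SingleObj G)).δ i F : ComposableArrows (SingleObj G) n) a b h
      = mp F (i.succAbove a) (i.succAbove b) ((Fin.strictMono_succAbove i).monotone h) := rfl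

lemma ev_δ_succ {n : ℕ} (F : ComposableArrows (SingleObj G) (n+1)) (j : Fin (n+1)) :
    ev ((nerve (SingleObj G)).δ j.succ F : ComposableArrows (SingleObj G) n) = Fin.contractNth j (· * ·) (ev F) := by
  funext k
  rw [← Fin.inv_partialProd_mul_eq_contractNth]
  refine (mp_δ F j.succ k.castSucc k.succ (Fin.castSucc_le_succ k)).trans ?_
  rw [mp_eq, Fin.succ_succAbove_succ]

/-- Faces of simplices of the nerve. -/
def face {n : ℕ} (i : Fin (n+2)) (F : ComposableArrows (SingleObj G) (n+1)) : ComposableArrows (SingleObj G) n :=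
  (nerve (SingleObj G)).δ i F

lemma cc_d (G : Type) [Group G] (n : ℕ) :
   ((classifyingComplex G).d (n+1) n).hom = Finset.univ.sum fun i : Fin (n+2) =>
     (-1:ℤ)^(i:ℕ) • Finsupp.lmapDomain ℤ ℤ (face (G := G) i) := by
  unfold classifyingComplex
  rw [alternatingFaceMapComplex_obj_d]
  unfold AlternatingFaceMapComplex.objD
  refine (ModuleCat.hom_sum _ _).trans ?_
  refine Finset.sum_congr rfl fun i _ => ?_
  refine (ModuleCat.hom_zsmul _ _).trans ?_
  congr 1

noncomputable def cmp (G : Type) [Group G] : classifyingComplex G ≅ cpx (triv G ℤ) :=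
  HomologicalComplex.Hom.isoOfComponents (fun n => (Finsupp.domLCongr (R := ℤ) (M := ℤ) (evE (G := G) n)).toModuleIso) (by
    rintro i n rfl
    apply ModuleCat.hom_ext
    have key : (dl (triv G ℤ) n) ∘ₗ (Finsupp.domLCongr (R := ℤ) (M := ℤ) (evE (G := G) (n+1))).toLinearMap
       = (Finsupp.domLCongr (R := ℤ) (M := ℤ) (evE (G := G) n)).toLinearMap ∘ₗ (Finset.univ.sum fun i : Fin (n+2) =>
     (-1:ℤ)^(i:ℕ) • Finsupp.lmapDomain ℤ ℤ (face (G := G) i)) := by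
      refine Finsupp.lhom_ext' fun F => LinearMap.ext_ring ?_
      have h0 : ev (face 0 F) = fun k => ev F k.succ := ev_δ_zero F
      have h1 : ∀ j : Fin (n+1), ev (face j.succ F) = Fin.contractNth j (· * ·) (ev F) := ev_δ_succ F
      simp only [LinearMap.comp_apply, Finsupp.lsingle_apply, LinearEquiv.coe_coe, Finsupp.domLCongr_single,
        LinearMap.sum_apply, LinearMap.smul_apply, Finsupp.lmapDomain_apply, Finsupp.mapDomain_single, map_sum, map_smul]
      rw [dl_single]
      conv_rhs => rw [Fin.sum_univ_succ]
      simp [evE, h0, h1]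
    rw [← cc_d] at key
    exact key)

noncomputable def cmpH (G : Type) [Group G] (n : ℕ) : grpHomology G n ≃+ H (triv G ℤ) n :=
  (((HomologicalComplex.homologyFunctor (ModuleCat ℤ) _ n).mapIso (cmp G)).toLinearEquiv).toAddEquiv
end comparison

lemma split_Z {P : Type} [AddCommGroup P] (s : P →+ ℤ) (hs : Function.Surjective s) : Nonempty (P ≃+ ℤ × s.ker) := by
  obtain ⟨p, hp⟩ := hs 1
  have hk : ∀ m : ℤ, s (m • p) = m := fun m => by rw [map_zsmul, hp]; simp
  refine ⟨{ toFun := fun x => (s x, ⟨x - s x • p, by rw [AddMonoidHom.mem_ker, map_sub, hk, sub_self]⟩),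
            invFun := fun y => y.1 • p + y.2, left_inv := ?_, right_inv := ?_, map_add' := ?_ }⟩
  · intro x; simp
  · rintro ⟨m, y, hy⟩
    rw [AddMonoidHom.mem_ker] at hy
    ext
    · simp [hk, hy, hp]
    · simp [hk, hy, hp]
  · intro x y
    ext
    · simp
    · simp only [map_add, Prod.snd_add, AddSubgroup.coe_add, add_smul]; abel

lemma main_of {S : Type} [Group S] {A B C : Type} [AddCommGroup A] [AddCommGroup B] [AddCommGroup C]
    (h0 : ∀ n, 2 ≤ n → ∃ g : S, orderOf g = n ∧ Subgroup.normalClosure {g} = ⊤)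
    (hA : Nonempty (Subgroup.center S ≃* Multiplicative A))
    (h1 : ∀ x : H (triv S ℤ) 1, x = 0) (h2 : Nonempty (H (triv S ℤ) 2 ≃+ B)) (h3 : Nonempty (H (triv S ℤ) 3 ≃+ C))
    (h4 : ∀ n, Zs S (n+4)) :
      StronglyTorsionGenerated S ∧
      Nonempty (Subgroup.center S ≃* Multiplicative A) ∧
      Subsingleton (grpHomology S 1) ∧
      Nonempty (grpHomology S 2 ≃+ B) ∧
      Nonempty (grpHomology S 3 ≃+ C) ∧
      {n : ℕ | 0 < n ∧ ∃ (M : Type) (_ : AddCommGroup M),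
        Nonempty (grpHomology S n ≃+ ℤ × M)}.Infinite := by
  refine ⟨h0, hA, ⟨fun x y => (cmpH S 1).injective ((h1 _).trans (h1 _).symm)⟩, ⟨(cmpH S 2).trans h2.some⟩,
    ⟨(cmpH S 3).trans h3.some⟩, ?_⟩
  refine Set.infinite_of_injective_forall_mem (f := fun n : ℕ => n + 4) (fun a b h => by simpa using h) fun n => ?_
  obtain ⟨s, hs⟩ := h4 n
  exact ⟨by omega, s.ker, inferInstance, ⟨(cmpH S (n+4)).trans (split_Z s hs).some⟩⟩

lemma main (A B C : Type) [AddCommGroup A] [AddCommGroup B] [AddCommGroup C] :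
    ∃ (S : Type) (_ : Group S),
      StronglyTorsionGenerated S ∧
      Nonempty (Subgroup.center S ≃* Multiplicative A) ∧
      Subsingleton (grpHomology S 1) ∧
      Nonempty (grpHomology S 2 ≃+ B) ∧
      Nonempty (grpHomology S 3 ≃+ C) ∧
      {n : ℕ | 0 < n ∧ ∃ (M : Type) (_ : AddCommGroup M),
        Nonempty (grpHomology S n ≃+ ℤ × M)}.Infinite := by
  obtain ⟨T, _, t0, tz, t1, t2, t3, t4⟩ := exists_T B C
  rcases subsingleton_or_nontrivial A with hA | hA
  · refine ⟨T, inferInstance, main_of t0 ⟨?_⟩ (t1 ℤ) t2 t3 t4⟩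
    have : Subsingleton (Subgroup.center T) := ⟨fun a b => Subtype.ext
      ((tz _ (Subgroup.mem_center_iff.1 a.2)).trans (tz _ (Subgroup.mem_center_iff.1 b.2)).symm)⟩
    have : Subsingleton (Multiplicative A) := hA
    exact { toFun := fun _ => 1, invFun := fun _ => 1, left_inv := fun _ => Subsingleton.elim _ _,
            right_inv := fun _ => Subsingleton.elim _ _, map_mul' := fun _ _ => Subsingleton.elim _ _ }
  · have : Nontrivial (Multiplicative A) := hA
    obtain ⟨E, _, c, ci, ea, cc, ez, e0⟩ := exists_E (Multiplicative A)
    have iso : ∀ n, H (triv (T × E) ℤ) n ≃+ H (triv T ℤ) n := fun n =>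
      AddEquiv.ofBijective (hT (MonoidHom.fst T E) ℤ n) (ea.fst_bij T ℤ n)
    refine ⟨T × E, inferInstance, main_of (stg_prod t0 e0) ⟨?_⟩
      (fun x => (iso 1).injective ((t1 ℤ _).trans (map_zero _).symm)) ⟨(iso 2).trans t2.some⟩ ⟨(iso 3).trans t3.some⟩
      (fun n => ?_)⟩
    · let f : Multiplicative A →* Subgroup.center (T × E) := ((MonoidHom.inr T E).comp c).codRestrict _ (by
        intro a
        rw [Subgroup.mem_center_iff]
        rintro ⟨x, y⟩
        ext
        · simp
        · simp [cc])
      refine (MulEquiv.ofBijective f ⟨?_, ?_⟩).symm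
      · intro a b h
        have := congrArg (fun z : Subgroup.center (T × E) => z.1.2) h
        exact ci this
      · rintro ⟨⟨x, y⟩, h⟩
        rw [Subgroup.mem_center_iff] at h
        obtain ⟨a, ha⟩ := ez y (fun g => congrArg Prod.snd (h (1, g)))
        have hx := tz x (fun g => congrArg Prod.fst (h (g, 1)))
        refine ⟨a, Subtype.ext (Prod.ext hx.symm ha)⟩
    · obtain ⟨s, hs⟩ := t4 n
      exact ⟨s.comp (iso (n+4)).toAddMonoidHom, hs.comp (iso (n+4)).surjective⟩
end HG

theorem realization_with_infinite_cyclic_summands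
    (A B C : Type) [AddCommGroup A] [AddCommGroup B] [AddCommGroup C] :
    ∃ (S : Type) (_ : Group S),
      StronglyTorsionGenerated S ∧
      Nonempty (Subgroup.center S ≃* Multiplicative A) ∧
      Subsingleton (grpHomology S 1) ∧
      Nonempty (grpHomology S 2 ≃+ B) ∧
      Nonempty (grpHomology S 3 ≃+ C) ∧
      {n : ℕ | 0 < n ∧ ∃ (M : Type) (_ : AddCommGroup M),
        Nonempty (grpHomology S n ≃+ ℤ × M)}.Infinite := by
  exact HG.main A B C
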